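/- Let θ > 0, let φ : (−1,1) → ℝ be of class C^{1,1} (differentiable with Lipschitz derivative), and let u be a solution of the two-phase thin obstacle problem in B₁ ⊂ ℝ² (the case d = 1 with f ≡ θ): u is continuous on B₁⁺ ∪ B₁', harmonic in B₁⁺, for every x₁ ∈ (−1,1) the one-sided derivative ∂₂u(x₁,0) := lim_{t→0⁺}(u(x₁,t) − u(x₁,0))/t exists, |∂₂u(x₁,0)| ≤ θ, and ∂₂u(x₁,0) = θ·sign(u(x₁,0) − φ(x₁)) whenever u(x₁,0) ≠ φ(x₁); assume moreover ∫_{B₁⁺}(|u|² + |∇u|²) < ∞. Then the trace x₁ ↦ u(x₁,0) is continuously differentiable on (−1,1), and there exists C > 0, depending only on θ, ‖u‖_{L²(B₁⁺)}, and ‖φ‖_{C^{1,1}}, such that |u(x₁,0)| + |∂₁u(x₁,0)| ≤ C for all x₁ ∈ [−1/2,1/2] and |∂₁u(x₁,0) − ∂₁u(x₁',0)| ≤ C|x₁ − x₁'|^{1/2} for all x₁, x₁' ∈ [−1/2,1/2]. -/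

import Mathlib

open MeasureTheory Set

/-- The upper half of the unit ball, `B₁⁺ ⊂ ℝ²`. -/
def upB : Set (ℝ × ℝ) := {p | p.1^2 + p.2^2 < 1 ∧ 0 < p.2}

/-- The thin unit ball `B₁' ⊂ ℝ² ∩ {x₂ = 0}`. -/
def flatB : Set (ℝ × ℝ) := {p | p.1^2 + p.2^2 < 1 ∧ p.2 = 0}

/-- Laplacian of a function on `ℝ²`, computed through iterated coordinate derivatives. -/
noncomputable def lap2 (u : ℝ × ℝ → ℝ) (p : ℝ × ℝ) : ℝ :=
  deriv (deriv (fun t => u (t, p.2))) p.1 + deriv (deriv (fun t => u (p.1, t))) p.2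

/-- `u` is harmonic on the open set `U ⊆ ℝ²`: it is `C²` there and its Laplacian vanishes. -/
def HarmonicOn2 (u : ℝ × ℝ → ℝ) (U : Set (ℝ × ℝ)) : Prop :=
  ContDiffOn ℝ 2 u U ∧ ∀ p ∈ U, lap2 u p = 0

/-- Squared norm of the gradient of `u : ℝ² → ℝ`. -/
noncomputable def gradSq2 (u : ℝ × ℝ → ℝ) (p : ℝ × ℝ) : ℝ :=
  (deriv (fun t => u (t, p.2)) p.1)^2 + (deriv (fun t => u (p.1, t)) p.2)^2

section

open Complex Filter Topology

/-- The open upper half disc of radius `r` centred at the real point `a`. -/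
def upperHalfDisc (a r : ℝ) : Set ℂ := {z | ‖z - a‖ < r ∧ 0 < z.im}

/-- The closed upper half disc of radius `r` centred at the real point `a`. -/
def closedUpperHalfDisc (a r : ℝ) : Set ℂ := {z | ‖z - a‖ ≤ r ∧ 0 ≤ z.im}

theorem isOpen_upperHalfDisc (a r : ℝ) : IsOpen (upperHalfDisc a r) :=
  (isOpen_lt (f := fun z : ℂ => ‖z - a‖) (by fun_prop) continuous_const).and
    (isOpen_lt continuous_const Complex.continuous_im)

theorem convex_upperHalfDisc (a r : ℝ) : Convex ℝ (upperHalfDisc a r) := by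
  have h1 : upperHalfDisc a r = Metric.ball (a : ℂ) r ∩ {z | 0 < z.im} := by
    ext z; simp [upperHalfDisc, dist_eq_norm]
  rw [h1]
  exact (convex_ball _ _).inter (convex_halfSpace_im_gt 0)

theorem isCompact_closedUpperHalfDisc (a r : ℝ) : IsCompact (closedUpperHalfDisc a r) := by
  refine (isCompact_closedBall (a : ℂ) r).of_isClosed_subset ?_ ?_
  · exact (isClosed_le (f := fun z : ℂ => ‖z - a‖) (by fun_prop) continuous_const).and
      (isClosed_le continuous_const Complex.continuous_im)
  · rintro z ⟨h, -⟩; simpa [dist_eq_norm] using h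

theorem upperHalfDisc_subset (a r : ℝ) : upperHalfDisc a r ⊆ closedUpperHalfDisc a r :=
  fun _ h => ⟨h.1.le, h.2.le⟩

theorem upperHalfDisc_subset_upperHalfDisc {a b r s : ℝ} (h : |b - a| + s ≤ r) :
    upperHalfDisc b s ⊆ upperHalfDisc a r := by
  rintro z ⟨h1, h2⟩
  refine ⟨?_, h2⟩
  have h3 : ‖z - a‖ ≤ ‖z - b‖ + ‖((b - a : ℝ) : ℂ)‖ := by
    have : z - a = (z - b) + ((b - a : ℝ) : ℂ) := by push_cast; ring
    rw [this]; exact norm_add_le _ _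
  rw [Complex.norm_real, Real.norm_eq_abs] at h3
  linarith

theorem closedUpperHalfDisc_subset_closedUpperHalfDisc {a b r s : ℝ} (h : |b - a| + s ≤ r) :
    closedUpperHalfDisc b s ⊆ closedUpperHalfDisc a r := by
  rintro z ⟨h1, h2⟩
  refine ⟨?_, h2⟩
  have h3 : ‖z - a‖ ≤ ‖z - b‖ + ‖((b - a : ℝ) : ℂ)‖ := by
    have : z - a = (z - b) + ((b - a : ℝ) : ℂ) := by push_cast; ring
    rw [this]; exact norm_add_le _ _
  rw [Complex.norm_real, Real.norm_eq_abs] at h3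
  linarith

/-- The one-sided normal derivative at the real point `x`, from the upper half plane, is `L`. -/
def HasFlatNormalDeriv (w : ℂ → ℝ) (x L : ℝ) : Prop :=
  Tendsto (fun t : ℝ => (w (x + t * I) - w x) / t) (𝓝[>] 0) (𝓝 L)

theorem HasFlatNormalDeriv.add {w v : ℂ → ℝ} {x L K : ℝ} (hw : HasFlatNormalDeriv w x L)
    (hv : HasFlatNormalDeriv v x K) : HasFlatNormalDeriv (fun z => w z + v z) x (L + K) := by
  refine (Tendsto.add hw hv).congr fun t => ?_
  ring

theorem HasFlatNormalDeriv.const_mul {w : ℂ → ℝ} {x L : ℝ} (c : ℝ)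
    (hw : HasFlatNormalDeriv w x L) : HasFlatNormalDeriv (fun z => c * w z) x (c * L) := by
  refine (Tendsto.const_mul c hw).congr fun t => ?_
  ring

theorem HasFlatNormalDeriv.sub {w v : ℂ → ℝ} {x L K : ℝ} (hw : HasFlatNormalDeriv w x L)
    (hv : HasFlatNormalDeriv v x K) : HasFlatNormalDeriv (fun z => w z - v z) x (L - K) := by
  refine (Tendsto.sub hw hv).congr fun t => ?_
  ring

theorem hasFlatNormalDeriv_const (c x : ℝ) : HasFlatNormalDeriv (fun _ => c) x 0 := by
  simp [HasFlatNormalDeriv]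

theorem HasFlatNormalDeriv.comp_add {w : ℂ → ℝ} {x τ L : ℝ}
    (hw : HasFlatNormalDeriv w (x + τ) L) :
    HasFlatNormalDeriv (fun z => w (z + τ)) x L := by
  refine Tendsto.congr (fun t => ?_) hw
  push_cast
  rw [add_right_comm]

theorem HasDerivAt.hasFlatNormalDeriv_re {B : ℂ → ℂ} {x : ℝ} {B' : ℂ}
    (h : HasDerivAt B B' x) : HasFlatNormalDeriv (fun z => (B z).re) x (-B'.im) := by
  have h1 : HasDerivAt (fun t : ℝ => (x : ℂ) + t * I) I 0 := by
    simpa using ((hasDerivAt_id (0 : ℝ)).ofReal_comp.mul_const I).const_add (x : ℂ)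
  have h0 : HasDerivAt B B' ((x : ℂ) + ((0 : ℝ) : ℂ) * I) := by simpa using h
  have h2 := h0.comp (0 : ℝ) h1
  have h3 : HasDerivAt (fun t : ℝ => (B (x + t * I)).re) ((B' * I).re) 0 := by
    exact (Complex.reCLM.hasFDerivAt.comp_hasDerivAt (0 : ℝ) h2)
  have h4 := h3.tendsto_slope_zero_right
  simp only [mul_re, I_re, mul_zero, I_im, mul_one, zero_sub, zero_add, ofReal_zero, zero_mul,
    add_zero, smul_eq_mul] at h4
  refine h4.congr fun t => ?_
  ring

theorem halfDisc_max_principle {a r : ℝ} (hr : 0 < r) {w : ℂ → ℝ} {W : ℂ → ℂ}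
    (hc : ContinuousOn w (closedUpperHalfDisc a r))
    (hW : DifferentiableOn ℂ W (upperHalfDisc a r))
    (hre : ∀ z ∈ upperHalfDisc a r, (W z).re = w z)
    (hflat : ∀ x : ℝ, |x - a| < r → 0 < w x →
      ∃ L ≥ 0, HasFlatNormalDeriv w x L)
    (harc : ∀ z : ℂ, ‖z - a‖ = r → 0 ≤ z.im → w z ≤ 0) :
    ∀ z ∈ closedUpperHalfDisc a r, w z ≤ 0 := by
  rintro z₀ ⟨hz₀, hz₀'⟩
  by_contra! hpos
  obtain ⟨ε, hε, hεr⟩ : ∃ ε > 0, ε * r < w z₀ := by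
    refine ⟨w z₀ / (2 * r), by positivity, ?_⟩
    field_simp; linarith
  have hcomp := isCompact_closedUpperHalfDisc a r
  have hqc : ContinuousOn (fun z : ℂ => w z + ε * z.im) (closedUpperHalfDisc a r) :=
    hc.add (by fun_prop)
  obtain ⟨m, ⟨hm, hm'⟩, hmax⟩ := hcomp.exists_isMaxOn ⟨z₀, hz₀, hz₀'⟩ hqc
  have hmax' : ∀ z : ℂ, ‖z - a‖ ≤ r → 0 ≤ z.im → w z + ε * z.im ≤ w m + ε * m.im :=
    fun z h h' => hmax ⟨h, h'⟩
  have h1 := hmax' z₀ hz₀ hz₀'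
  have himle : ∀ z : ℂ, ‖z - a‖ ≤ r → z.im ≤ r := by
    intro z h
    have := (Complex.abs_im_le_norm (z - a)).trans h
    simp only [Complex.sub_im, Complex.ofReal_im, sub_zero] at this
    exact (abs_le.1 this).2
  have hmr := himle m hm
  have hwm : 0 < w m := by nlinarith
  have hmlt : ‖m - a‖ < r := lt_of_le_of_ne hm fun h => absurd (harc m h hm') (by linarith)
  rcases hm'.eq_or_lt with him | him
  · -- flat maximum
    have hmre : (m.re : ℂ) = m := Complex.ext (by simp) (by simp [← him])
    have hlt : |m.re - a| < r := by
      have : ((m.re - a : ℝ) : ℂ) = m - a := by push_cast; rw [hmre]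
      rw [← Real.norm_eq_abs, ← Complex.norm_real, this]; exact hmlt
    obtain ⟨L, hL, hlim⟩ := hflat m.re hlt (by rwa [hmre])
    rw [HasFlatNormalDeriv, hmre] at hlim
    have hlim2 : Tendsto (fun t : ℝ => (w (m + t * I) - w m) / t + ε) (𝓝[>] 0) (𝓝 (L + ε)) :=
      hlim.add_const ε
    have hev : ∀ᶠ t : ℝ in 𝓝[>] 0, (w (m + t * I) - w m) / t + ε ≤ 0 := by
      have hco : ∀ᶠ t : ℝ in 𝓝[>] 0, ‖m + t * I - a‖ < r := by
        have : Tendsto (fun t : ℝ => ‖m + t * I - a‖) (𝓝 0) (𝓝 ‖m + (0 : ℝ) * I - a‖) :=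
          Continuous.tendsto (by fun_prop) 0
        have h2 := this.mono_left (nhdsWithin_le_nhds (s := Ioi 0))
        refine h2.eventually_lt_const (by simpa using hmlt)
      filter_upwards [hco, self_mem_nhdsWithin] with t ht ht0
      have ht0' : (0 : ℝ) < t := ht0
      have := hmax' (m + t * I) ht.le (by simp [← him, ht0'.le])
      simp [← him] at this
      have h3 : (w (m + t * I) - w m) / t + ε = (w (m + t * I) + ε * t - w m) / t := by
        field_simp; ring
      rw [h3]
      exact div_nonpos_of_nonpos_of_nonneg (by linarith) ht0'.le
    have := le_of_tendsto hlim2 hev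
    linarith
  · -- interior maximum
    have hnorm : ∀ z ∈ upperHalfDisc a r, ‖exp (W z - ε * I * z)‖ = Real.exp (w z + ε * z.im) := by
      rintro z ⟨h, h'⟩
      rw [Complex.norm_exp]; congr 1
      simp [hre z ⟨h, h'⟩]
    have hconst := Complex.norm_eqOn_of_isPreconnected_of_isMaxOn
      (f := fun z => exp (W z - ε * I * z)) (c := m) (convex_upperHalfDisc a r).isPreconnected (isOpen_upperHalfDisc a r)
      ((hW.sub (by fun_prop)).cexp) ⟨hmlt, him⟩ (by
        rintro z hz
        simp only [mem_ofPred_eq, Function.comp]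
        rw [hnorm z hz, hnorm m ⟨hmlt, him⟩]
        exact Real.exp_le_exp.2 (hmax' z hz.1.le hz.2.le))
    have hval : ∀ s : ℝ, 0 < s → s < 1 → w (a + s * r * I) + ε * (s * r) = w m + ε * m.im := by
      intro s hs hs1
      have hmem : (a + s * r * I : ℂ) ∈ upperHalfDisc a r := by
        refine ⟨?_, by simp; positivity⟩
        simp [abs_of_pos hs, abs_of_pos hr]; nlinarith
      have := hconst hmem
      simp only [Function.comp, Function.const_apply] at this
      rw [hnorm _ hmem, hnorm m ⟨hmlt, him⟩] at this
      simpa using Real.exp_injective this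
    have hend : w (a + r * I) + ε * r = w m + ε * m.im := by
      have hcw : ContinuousOn (fun s : ℝ => w (a + s * r * I) + ε * (s * r)) (Icc 0 1) := by
        refine ContinuousOn.add (hc.comp (by fun_prop) ?_) (by fun_prop)
        rintro s ⟨hs, hs1⟩
        refine ⟨?_, by simp; positivity⟩
        simp [abs_of_nonneg hs, abs_of_pos hr]; nlinarith
      have h1 : Tendsto (fun s : ℝ => w (a + s * r * I) + ε * (s * r)) (𝓝[Ioo 0 1] 1)
          (𝓝 (w (a + (1:ℝ) * r * I) + ε * (1 * r))) :=
        (hcw 1 (by simp)).mono_left (nhdsWithin_mono _ Ioo_subset_Icc_self)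
      have h2 : Tendsto (fun s : ℝ => w (a + s * r * I) + ε * (s * r)) (𝓝[Ioo 0 1] 1)
          (𝓝 (w m + ε * m.im)) := by
        refine tendsto_const_nhds.congr' ?_
        filter_upwards [self_mem_nhdsWithin] with s hs
        exact (hval s hs.1 hs.2).symm
      have : (𝓝[Ioo (0:ℝ) 1] 1).NeBot := by
        rw [← mem_closure_iff_nhdsWithin_neBot, closure_Ioo (by norm_num)]; simp
      simpa using tendsto_nhds_unique h1 h2
    have := harc (a + r * I) (by simp [abs_of_pos hr]) (by simp [hr.le])
    nlinarith

theorem norm_deriv_le_of_re_nonneg {W : ℂ → ℂ} {c : ℂ} {r : ℝ} (hr : 0 < r)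
    (hW : DifferentiableOn ℂ W (Metric.ball c r)) (h : ∀ z ∈ Metric.ball c r, 0 ≤ (W z).re) :
    ‖deriv W c‖ ≤ 2 * (W c).re / r := by
  have hcm : c ∈ Metric.ball c r := Metric.mem_ball_self hr
  have key : ∀ δ > 0, ‖deriv W c‖ ≤ 2 * ((W c).re + δ) / r := by
    intro δ hδ
    have hne : ∀ z ∈ Metric.ball c r, W z + δ + (starRingEnd ℂ (W c) + δ) ≠ 0 := by
      intro z hz h0
      have := congrArg Complex.re h0
      simp at this
      have := h z hz; have := h c hcm
      linarith
    set f : ℂ → ℂ := fun z => (W z - W c) / (W z + δ + (starRingEnd ℂ (W c) + δ)) with hf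
    have hfd : DifferentiableOn ℂ f (Metric.ball c r) :=
      (hW.sub_const _).div ((hW.add_const _).add_const _) hne
    have hfc : f c = 0 := by simp [hf]
    have hmaps : MapsTo f (Metric.ball c r) (Metric.closedBall (f c) 1) := by
      intro z hz
      rw [hfc, mem_closedBall_zero_iff, norm_div]
      refine div_le_one_of_le₀ ?_ (norm_nonneg _)
      rw [← sq_le_sq₀ (norm_nonneg _) (norm_nonneg _), ← Complex.normSq_eq_norm_sq,
        ← Complex.normSq_eq_norm_sq, Complex.normSq_apply, Complex.normSq_apply]
      simp
      have := h z hz; have := h c hcm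
      nlinarith [mul_nonneg (h z hz) (h c hcm), mul_nonneg (h z hz) hδ.le,
        mul_nonneg (h c hcm) hδ.le]
    have hs := Complex.norm_deriv_le_div_of_mapsTo_ball hfd hmaps hr
    have hWd := (hW.differentiableAt (Metric.isOpen_ball.mem_nhds hcm)).hasDerivAt
    have hd : HasDerivAt f (deriv W c / (W c + δ + (starRingEnd ℂ (W c) + δ))) c := by
      have := (hWd.sub_const (W c)).div ((hWd.add_const (δ : ℂ)).add_const
        (starRingEnd ℂ (W c) + δ)) (hne c hcm)
      rw [sub_self, zero_mul, sub_zero, pow_two, mul_div_mul_right _ _ (hne c hcm)] at this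
      exact this
    have hsum : W c + δ + (starRingEnd ℂ (W c) + δ) = ((2 * ((W c).re + δ) : ℝ) : ℂ) := by
      apply Complex.ext <;> simp; ring
    have hpos : 0 < 2 * ((W c).re + δ) := by have := h c hcm; linarith
    rw [hd.deriv, hsum, norm_div, Complex.norm_real, Real.norm_of_nonneg hpos.le] at hs
    rw [div_le_div_iff₀ hpos hr] at hs
    rw [le_div_iff₀ hr]
    linarith
  have hlim : Tendsto (fun δ : ℝ => 2 * ((W c).re + δ) / r) (𝓝[>] 0)
      (𝓝 (2 * ((W c).re + 0) / r)) :=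
    (Continuous.tendsto (by fun_prop) 0).mono_left nhdsWithin_le_nhds
  rw [add_zero] at hlim
  exact ge_of_tendsto hlim (by filter_upwards [self_mem_nhdsWithin] with δ hδ using key δ hδ)

theorem re_cpow_neg_half_pos {ζ : ℂ} (h : 0 < ζ.re) :
    1 / √2 * ‖ζ‖ ^ (-(1 / 2) : ℝ) ≤ (ζ ^ ((-(1 / 2) : ℝ) : ℂ)).re := by
  rw [Complex.cpow_ofReal_re, mul_comm]
  have h1 : |Complex.arg ζ| < Real.pi / 2 := Complex.abs_arg_lt_pi_div_two_iff.2 (Or.inl h)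
  have h2 : √2 / 2 ≤ Real.cos (Complex.arg ζ * -(1 / 2)) := by
    rw [← Real.cos_pi_div_four, ← Real.cos_abs (Complex.arg ζ * -(1 / 2))]
    refine Real.cos_le_cos_of_nonneg_of_le_pi (abs_nonneg _) (by linarith [Real.pi_pos]) ?_
    rw [abs_mul]
    norm_num
    linarith
  have h3 : 1 / √2 = √2 / 2 := by
    have := Real.sqrt_pos.2 (show (0:ℝ) < 2 by norm_num)
    field_simp; norm_num
  rw [h3]
  exact mul_le_mul_of_nonneg_left h2 (by positivity)

theorem re_cpow_neg_half_le {ζ : ℂ} :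
    (ζ ^ ((-(1 / 2) : ℝ) : ℂ)).re ≤ ‖ζ‖ ^ (-(1 / 2) : ℝ) := by
  rw [Complex.cpow_ofReal_re]
  exact mul_le_of_le_one_right (by positivity) (Real.cos_le_one _)

theorem hasFlatNormalDeriv_cpow {s ε : ℝ} {x a : ℝ} (h : 0 < s + ε * (x - a)) (p : ℝ) :
    HasFlatNormalDeriv (fun z => ((s + ε * (z - a)) ^ (p : ℂ)).re) x 0 := by
  have hb : ((s : ℂ) + ε * (x - a)) = ((s + ε * (x - a) : ℝ) : ℂ) := by push_cast; ring
  have h1 : HasDerivAt (fun z : ℂ => (s : ℂ) + ε * (z - a)) (ε * 1) x :=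
    (((hasDerivAt_id (x : ℂ)).sub_const (a : ℂ)).const_mul (ε : ℂ)).const_add (s : ℂ)
  have h2 := h1.cpow_const (c := (p : ℂ)) (by rw [hb]; exact Complex.ofReal_mem_slitPlane.2 h)
  have h3 := h2.hasFlatNormalDeriv_re
  have h4 : ((p : ℂ) * ((s : ℂ) + ε * (x - a)) ^ ((p : ℂ) - 1) * (ε * 1)).im = 0 := by
    rw [hb, show (p : ℂ) - 1 = ((p - 1 : ℝ) : ℂ) by push_cast; ring, ← Complex.ofReal_cpow h.le]
    simp [← Complex.ofReal_mul]
  rw [h4, neg_zero] at h3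
  exact h3

theorem le_of_halfDisc_barrier {a r N : ℝ} (hr : 0 < r) (hN : 0 < N) {w : ℂ → ℝ} {W : ℂ → ℂ}
    (hc : ContinuousOn w (closedUpperHalfDisc a r))
    (hW : DifferentiableOn ℂ W (upperHalfDisc a r))
    (hre : ∀ z ∈ upperHalfDisc a r, (W z).re = w z)
    (hflat : ∀ x : ℝ, |x - a| < r → 0 < w x → ∃ L ≥ 0, HasFlatNormalDeriv w x L)
    (harc : ∀ z : ℂ, ‖z - a‖ = r → 0 < z.im → w z ≤ N / √z.im) :
    ∀ z ∈ closedUpperHalfDisc a (r / 2), w z ≤ 9 * N / √r := by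
  obtain ⟨B, hB⟩ := (isCompact_closedUpperHalfDisc a r).bddAbove_image hc
  have hB' : ∀ z ∈ closedUpperHalfDisc a r, w z ≤ max B 1 := fun z hz =>
    (hB (mem_image_of_mem w hz)).trans (le_max_left _ _)
  set M := max B 1 with hM
  have hMpos : 0 < M := lt_of_lt_of_le one_pos (le_max_right _ _)
  set η : ℝ := (N / M) ^ 2 with hη
  have hη0 : 0 < η := by positivity
  set s : ℝ := r + η with hs
  set p : ℝ := -(1 / 2) with hp
  set Bf : ℂ → ℂ := fun z => 3 * N * ((s + (-1 : ℝ) * (z - a)) ^ (p : ℂ) +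
    (s + (1 : ℝ) * (z - a)) ^ (p : ℂ)) with hBf
  set b : ℂ → ℝ := fun z => 3 * N * (((s + (-1 : ℝ) * (z - a)) ^ (p : ℂ)).re +
    ((s + (1 : ℝ) * (z - a)) ^ (p : ℂ)).re) with hb
  have hBb : ∀ z, (Bf z).re = b z := by
    intro z
    have : (3 * N : ℂ) = ((3 * N : ℝ) : ℂ) := by push_cast; ring
    simp only [hBf, hb]
    rw [this, Complex.re_ofReal_mul, Complex.add_re]
  have hrep : ∀ e : ℝ, |e| ≤ 1 → ∀ z ∈ closedUpperHalfDisc a r, η ≤ ((s : ℂ) + e * (z - a)).re := by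
    rintro e he z ⟨hz, -⟩
    have h1 : ((s : ℂ) + e * (z - a)).re = s + e * (z - a).re := by simp
    have h2 : |e * (z - a).re| ≤ r := by
      rw [abs_mul]
      have := (Complex.abs_re_le_norm (z - a)).trans hz
      nlinarith [abs_nonneg e, abs_nonneg (z - a).re]
    rw [h1]; have := (abs_le.1 h2).1; linarith
  have hslit : ∀ e : ℝ, |e| ≤ 1 → ∀ z ∈ closedUpperHalfDisc a r,
      ((s : ℂ) + e * (z - a)) ∈ slitPlane := fun e he z hz =>
    Or.inl (lt_of_lt_of_le hη0 (hrep e he z hz))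
  have hBd : DifferentiableOn ℂ Bf (closedUpperHalfDisc a r) := by
    intro z hz
    refine DifferentiableAt.differentiableWithinAt ?_
    refine DifferentiableAt.const_mul (DifferentiableAt.add ?_ ?_) _
    · exact DifferentiableAt.cpow_const (by fun_prop) (hslit (-1) (by simp) z hz)
    · exact DifferentiableAt.cpow_const (by fun_prop) (hslit 1 (by simp) z hz)
  have hbpos : ∀ e : ℝ, |e| ≤ 1 → ∀ z ∈ closedUpperHalfDisc a r,
      0 ≤ (((s : ℂ) + e * (z - a)) ^ (p : ℂ)).re := fun e he z hz =>
    le_trans (by positivity) (re_cpow_neg_half_pos (lt_of_lt_of_le hη0 (hrep e he z hz)))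
  have hlow : ∀ e : ℝ, |e| = 1 → ∀ z : ℂ, ‖z - a‖ = r → 0 ≤ z.im → e * (z - a).re ≤ 0 →
      1 / √(max z.im η) ≤ 3 * (((s : ℂ) + e * (z - a)) ^ (p : ℂ)).re := by
    intro e he z hz hz' hez
    set m := max z.im η with hm
    have hm0 : 0 < m := lt_of_lt_of_le hη0 (le_max_right _ _)
    have hzm : z.im ≤ m := le_max_left _ _
    have hηm : η ≤ m := le_max_right _ _
    have hre' := hrep e he.le z ⟨hz.le, hz'⟩
    have hpos : 0 < ((s : ℂ) + e * (z - a)).re := lt_of_lt_of_le hη0 hre'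
    have hnorm : ‖(s : ℂ) + e * (z - a)‖ ≤ 3 * m := by
      refine (Complex.norm_le_abs_re_add_abs_im _).trans ?_
      have him : ((s : ℂ) + e * (z - a)).im = e * z.im := by simp
      have hre1 : ((s : ℂ) + e * (z - a)).re = s + e * (z - a).re := by simp
      rw [abs_of_pos hpos, him, abs_mul, he, abs_of_nonneg hz', one_mul, hre1]
      have hsq : (e * (z - a).re) ^ 2 + z.im ^ 2 = r ^ 2 := by
        have he2 : e ^ 2 = 1 := by rw [← sq_abs, he]; norm_num
        have : ‖z - a‖ ^ 2 = (z - a).re ^ 2 + z.im ^ 2 := by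
          rw [← Complex.normSq_eq_norm_sq, Complex.normSq_apply]; simp; ring
        rw [mul_pow, he2, one_mul, ← this, hz]
      have : r ≤ -(e * (z - a).re) + z.im := by
        refine abs_le_of_sq_le_sq' ?_ (by linarith) |>.2
        nlinarith
      linarith
    have h1 := re_cpow_neg_half_pos hpos
    have h2 : (3 * m) ^ (-(1 / 2) : ℝ) ≤ ‖(s : ℂ) + e * (z - a)‖ ^ (-(1 / 2) : ℝ) :=
      Real.rpow_le_rpow_of_nonpos (norm_pos_iff.2 fun h => by rw [h] at hpos; simp at hpos)
        hnorm (by norm_num)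
    have h3 : (3 * m) ^ (-(1 / 2) : ℝ) = 1 / √(3 * m) := by
      rw [Real.rpow_neg (by positivity), ← Real.sqrt_eq_rpow, one_div]
    have h4 : 1 / √m ≤ 3 * (1 / √2 * (1 / √(3 * m))) := by
      have h5 : √2 * √(3 * m) ≤ 3 * √m := by
        rw [← Real.sqrt_mul (by norm_num), show (3 : ℝ) = √9 by
          rw [show (9 : ℝ) = 3 ^ 2 by norm_num]; simp, ← Real.sqrt_mul (by norm_num)]
        apply Real.sqrt_le_sqrt
        rw [show √9 = (3 : ℝ) by rw [show (9 : ℝ) = 3 ^ 2 by norm_num]; simp]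
        linarith
      have : 3 * (1 / √2 * (1 / √(3 * m))) = 3 / (√2 * √(3 * m)) := by field_simp
      rw [this, div_le_div_iff₀ (by positivity) (by positivity)]
      linarith
    rw [h3] at h2
    refine h4.trans ?_
    refine mul_le_mul_of_nonneg_left (le_trans ?_ h1) (by norm_num)
    exact mul_le_mul_of_nonneg_left h2 (by positivity)
  have hwarc : ∀ z : ℂ, ‖z - a‖ = r → 0 ≤ z.im → w z ≤ N * (1 / √(max z.im η)) := by
    intro z hz hz'
    rcases le_total z.im η with h | h
    · rw [max_eq_right h, hη, Real.sqrt_sq (by positivity)]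
      have := hB' z ⟨hz.le, hz'⟩
      rw [show N * (1 / (N / M)) = M by field_simp]
      exact this
    · rw [max_eq_left h, mul_one_div]
      exact harc z hz (lt_of_lt_of_le hη0 h)
  have hmain := halfDisc_max_principle hr (w := fun z => w z - b z) (W := fun z => W z - Bf z)
    (hc.sub (by
      have := Complex.continuous_re.comp_continuousOn hBd.continuousOn
      refine this.congr fun z _ => (hBb z).symm))
    (hW.sub (hBd.mono (upperHalfDisc_subset a r)))
    (fun z hz => by rw [Complex.sub_re, hre z hz, hBb])
    (by
      intro x hx hpos
      have hxm : (x : ℂ) ∈ closedUpperHalfDisc a r := by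
        refine ⟨?_, by simp⟩
        rw [← Complex.ofReal_sub, Complex.norm_real]; exact hx.le
      have hb0 : 0 ≤ b x := by
        have := hbpos (-1) (by simp) x hxm
        have := hbpos 1 (by simp) x hxm
        simp only [hb]; positivity
      obtain ⟨L, hL, hlim⟩ := hflat x hx (by linarith)
      refine ⟨L, hL, ?_⟩
      have hx' := abs_lt.1 hx
      have h1 := hasFlatNormalDeriv_cpow (s := s) (ε := -1) (x := x) (a := a) (by linarith) p
      have h2 := hasFlatNormalDeriv_cpow (s := s) (ε := 1) (x := x) (a := a) (by linarith) p
      have h3 := hlim.sub ((h1.add h2).const_mul (3 * N))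
      rwa [show L - 3 * N * (0 + 0) = L by ring] at h3)
    (by
      intro z hz hz'
      have hzm : z ∈ closedUpperHalfDisc a r := ⟨hz.le, hz'⟩
      have h1 := hwarc z hz hz'
      have h2 := hbpos (-1) (by simp) z hzm
      have h3 := hbpos 1 (by simp) z hzm
      have h4 : 1 / √(max z.im η) ≤ 3 * ((((s : ℂ) + (-1 : ℝ) * (z - a)) ^ (p : ℂ)).re +
          (((s : ℂ) + (1 : ℝ) * (z - a)) ^ (p : ℂ)).re) := by
        rcases le_total 0 (z - a).re with h | h
        · have := hlow (-1) (by simp) z hz hz' (by linarith)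
          linarith
        · have := hlow 1 (by simp) z hz hz' (by linarith)
          linarith
      have := mul_le_mul_of_nonneg_left h4 hN.le
      simp only [hb]
      linarith)
  rintro z ⟨hz, hz'⟩
  have h1 := hmain z ⟨by linarith, hz'⟩
  have hup : ∀ e : ℝ, |e| = 1 → (((s : ℂ) + e * (z - a)) ^ (p : ℂ)).re ≤ 3 / 2 / √r := by
    intro e he
    refine re_cpow_neg_half_le.trans ?_
    have h5 : r / 2 ≤ ‖(s : ℂ) + e * (z - a)‖ := by
      have h6 := norm_sub_le ((s : ℂ) + e * (z - a)) (e * (z - a))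
      rw [add_sub_cancel_right, Complex.norm_real, norm_mul, Complex.norm_real, Real.norm_eq_abs,
        Real.norm_eq_abs, he, abs_of_pos (by positivity)] at h6
      linarith
    have h7 := Real.rpow_le_rpow_of_nonpos (z := p) (by positivity) h5 (by norm_num [hp])
    refine h7.trans ?_
    rw [hp, Real.rpow_neg (by positivity), ← Real.sqrt_eq_rpow, ← one_div,
      div_le_div_iff₀ (by positivity) (by positivity)]
    have h8 : √r = √2 * √(r / 2) := by rw [← Real.sqrt_mul (by norm_num)]; congr 1; ring
    have h9 : √2 ≤ 3 / 2 := Real.sqrt_le_iff.2 ⟨by norm_num, by norm_num⟩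
    rw [h8, one_mul]
    exact mul_le_mul_of_nonneg_right h9 (by positivity)
  have h2 := hup (-1) (by simp)
  have h3 := hup 1 (by simp)
  have h4 : b z ≤ 3 * N * (3 / 2 / √r + 3 / 2 / √r) :=
    mul_le_mul_of_nonneg_left (add_le_add h2 h3) (by positivity)
  have h5 : 3 * N * (3 / 2 / √r + 3 / 2 / √r) = 9 * N / √r := by ring
  linarith

theorem norm_sub_le_of_deriv_le {E : Type*} [NormedAddCommGroup E] [NormedSpace ℝ E]
    {f f' : ℝ → E} {B B' : ℝ → ℝ} {s r : ℝ} (hsr : s ≤ r)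
    (hf : ∀ t ∈ Icc s r, HasDerivAt f (f' t) t) (hB : ∀ t ∈ Icc s r, HasDerivAt B (B' t) t)
    (h : ∀ t ∈ Icc s r, ‖f' t‖ ≤ B' t) : ‖f r - f s‖ ≤ B r - B s := by
  refine image_norm_le_of_norm_deriv_right_le_deriv_boundary'
    (f := fun t => f t - f s) (f' := f') (B := fun t => B t - B s) (B' := B')
    (a := s) (b := r) ?_ ?_ (by simp) ?_ ?_ ?_ ⟨hsr, le_rfl⟩
  · exact fun t ht => ((hf t ht).sub_const _).continuousAt.continuousWithinAt
  · exact fun t ht => ((hf t (Ico_subset_Icc_self ht)).sub_const _).hasDerivWithinAt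
  · exact fun t ht => ((hB t ht).sub_const _).continuousAt.continuousWithinAt
  · exact fun t ht => ((hB t (Ico_subset_Icc_self ht)).sub_const _).hasDerivWithinAt
  · exact fun t ht => h t (Ico_subset_Icc_self ht)

theorem HasDerivAt.complex_re {f : ℝ → ℂ} {f' : ℂ} {t : ℝ} (h : HasDerivAt f f' t) :
    HasDerivAt (fun t => (f t).re) f'.re t :=
  Complex.reCLM.hasFDerivAt.comp_hasDerivAt t h

theorem HasDerivAt.complex_im {f : ℝ → ℂ} {f' : ℂ} {t : ℝ} (h : HasDerivAt f f' t) :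
    HasDerivAt (fun t => (f t).im) f'.im t :=
  Complex.imCLM.hasFDerivAt.comp_hasDerivAt t h

theorem norm_deriv_le_of_abs_re_le {W : ℂ → ℂ} {c : ℂ} {r B : ℝ} (hr : 0 < r)
    (hW : DifferentiableOn ℂ W (Metric.ball c r)) (h : ∀ z ∈ Metric.ball c r, |(W z).re| ≤ B) :
    ‖deriv W c‖ ≤ 4 * B / r := by
  have h1 := norm_deriv_le_of_re_nonneg (W := fun z => W z + B) hr (hW.add_const _)
    (fun z hz => by simpa using by linarith [(abs_le.1 (h z hz)).1])
  rw [deriv_add_const] at h1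
  refine h1.trans ?_
  have := (abs_le.1 (h c (Metric.mem_ball_self hr))).2
  rw [div_le_div_iff_of_pos_right hr]
  simp; linarith

/-- Solutions `u = Re 𝒰` of the two-phase thin obstacle problem on the unit half disc,
with obstacle `φ`. -/
structure ThinSolution (θ P M : ℝ) (𝒰 : ℂ → ℂ) (u : ℂ → ℝ) (φ : ℝ → ℝ) : Prop where
  cont : ContinuousOn u (closedUpperHalfDisc 0 1)
  holo : DifferentiableOn ℂ 𝒰 (upperHalfDisc 0 1)
  re_eq : ∀ z ∈ upperHalfDisc 0 1, (𝒰 z).re = u z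
  bound : ∀ z ∈ closedUpperHalfDisc 0 1, |u z| ≤ M
  flat : ∀ x : ℝ, |x| < 1 → ∃ L, HasFlatNormalDeriv u x L ∧ |L| ≤ θ ∧
    (φ x < u x → L = θ) ∧ (u x < φ x → L = -θ)
  obst_diff : ∀ x : ℝ, |x| < 1 → DifferentiableAt ℝ φ x
  obst_deriv_le : ∀ x : ℝ, |x| < 1 → |deriv φ x| ≤ P
  obst_deriv_lip : ∀ x y : ℝ, |x| < 1 → |y| < 1 → |deriv φ x - deriv φ y| ≤ P * |x - y|

namespace ThinSolution

variable {θ P M : ℝ} {𝒰 : ℂ → ℂ} {u : ℂ → ℝ} {φ : ℝ → ℝ}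

theorem bound_nonneg (h : ThinSolution θ P M 𝒰 u φ) : 0 ≤ M :=
  (abs_nonneg _).trans (h.bound 0 ⟨by simp, by simp⟩)

theorem P_nonneg (h : ThinSolution θ P M 𝒰 u φ) : 0 ≤ P :=
  (abs_nonneg _).trans (h.obst_deriv_le 0 (by simp))

theorem obst_lip (h : ThinSolution θ P M 𝒰 u φ) {x y : ℝ} (hx : |x| < 1) (hy : |y| < 1) :
    |φ x - φ y| ≤ P * |x - y| := by
  have := (convex_Ioo (-1 : ℝ) 1).norm_image_sub_le_of_norm_deriv_le (f := φ) (C := P)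
    (fun z hz => h.obst_diff z (abs_lt.2 hz)) (fun z hz => h.obst_deriv_le z (abs_lt.2 hz))
    (abs_lt.1 hy) (abs_lt.1 hx)
  simpa using this

theorem hasDerivAt (h : ThinSolution θ P M 𝒰 u φ) {z : ℂ} (hz : z ∈ upperHalfDisc 0 1) :
    HasDerivAt 𝒰 (deriv 𝒰 z) z :=
  (h.holo.differentiableAt ((isOpen_upperHalfDisc 0 1).mem_nhds hz)).hasDerivAt

/-- The normal derivative is monotone in `u - φ`. -/
theorem flat_mono {x y L K : ℝ} (hL : |L| ≤ θ) (hK : |K| ≤ θ)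
    (hL' : u x < φ x → L = -θ) (hK' : φ y < u y → K = θ) (hxy : u x - φ x < u y - φ y) :
    L ≤ K := by
  have h1 := abs_le.1 hL
  have h2 := abs_le.1 hK
  rcases lt_or_ge (φ y) (u y) with h | h
  · rw [hK' h]; exact h1.2
  · rw [hL' (by linarith)]; exact h2.1

theorem translate_mem {r τ : ℝ} {z : ℂ} (hz : z ∈ closedUpperHalfDisc 0 r) :
    z + τ ∈ closedUpperHalfDisc 0 (r + |τ|) := by
  obtain ⟨h1, h2⟩ := hz
  refine ⟨?_, by simpa using h2⟩
  have := norm_add_le z (τ : ℂ)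
  simp only [ofReal_zero, sub_zero, Complex.norm_real, Real.norm_eq_abs] at *
  linarith

theorem translate_mem' {r τ : ℝ} {z : ℂ} (hz : z ∈ upperHalfDisc 0 r) :
    z + τ ∈ upperHalfDisc 0 (r + |τ|) := by
  obtain ⟨h1, h2⟩ := hz
  refine ⟨?_, by simpa using h2⟩
  have := norm_add_le z (τ : ℂ)
  simp only [ofReal_zero, sub_zero, Complex.norm_real, Real.norm_eq_abs] at *
  linarith

theorem upperHalfDisc_mono {r s : ℝ} (h : r ≤ s) : upperHalfDisc 0 r ⊆ upperHalfDisc 0 s :=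
  upperHalfDisc_subset_upperHalfDisc (by simpa using h)

theorem closedUpperHalfDisc_mono {r s : ℝ} (h : r ≤ s) :
    closedUpperHalfDisc 0 r ⊆ closedUpperHalfDisc 0 s :=
  closedUpperHalfDisc_subset_closedUpperHalfDisc (by simpa using h)

theorem abs_translate_sub_le (h : ThinSolution θ P M 𝒰 u φ) {r τ K : ℝ}
    (hr : 0 < r) (hτ : r + |τ| ≤ 1) (hK : 0 < K)
    (harc : ∀ z : ℂ, ‖z‖ = r → 0 < z.im → |u (z + τ) - u z| ≤ K / √z.im) :
    ∀ z ∈ closedUpperHalfDisc 0 (r / 2), |u (z + τ) - u z| ≤ P * |τ| + 9 * K / √r := by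
  have hr1 : r ≤ 1 := by linarith [abs_nonneg τ]
  have hPτ : 0 ≤ P * |τ| := mul_nonneg h.P_nonneg (abs_nonneg _)
  have hcu := h.cont.mono (closedUpperHalfDisc_mono hr1)
  have hcτ : ContinuousOn (fun z : ℂ => u (z + τ)) (closedUpperHalfDisc 0 r) :=
    h.cont.comp (by fun_prop) fun z hz => closedUpperHalfDisc_mono hτ (translate_mem hz)
  have hhu := h.holo.mono (upperHalfDisc_mono hr1)
  have hhτ : DifferentiableOn ℂ (fun z : ℂ => 𝒰 (z + τ)) (upperHalfDisc 0 r) :=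
    h.holo.comp (by fun_prop) fun z hz => upperHalfDisc_mono hτ (translate_mem' hz)
  have hreτ : ∀ z ∈ upperHalfDisc 0 r, (𝒰 (z + τ)).re = u (z + τ) := fun z hz =>
    h.re_eq _ (upperHalfDisc_mono hτ (translate_mem' hz))
  have hreu : ∀ z ∈ upperHalfDisc 0 r, (𝒰 z).re = u z := fun z hz =>
    h.re_eq _ (upperHalfDisc_mono hr1 hz)
  have hx1 : ∀ x : ℝ, |x - 0| < r → |x| < 1 := fun x hx => by simp at hx; linarith
  have hxτ : ∀ x : ℝ, |x - 0| < r → |x + τ| < 1 := fun x hx => by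
    simp at hx; linarith [abs_add_le x τ]
  have hpos := le_of_halfDisc_barrier (a := 0) hr hK
    (w := fun z => u (z + τ) - u z - P * |τ|)
    (W := fun z => 𝒰 (z + τ) - 𝒰 z - (P * |τ| : ℝ))
    ((hcτ.sub hcu).sub continuousOn_const) ((hhτ.sub hhu).sub_const _)
    (fun z hz => by
      rw [Complex.sub_re, Complex.sub_re, Complex.ofReal_re, hreτ z hz, hreu z hz])
    (by
      intro x hx hw
      obtain ⟨L, hL1, hL2, hL3, hL4⟩ := h.flat x (hx1 x hx)
      obtain ⟨K, hK1, hK2, hK3, hK4⟩ := h.flat (x + τ) (hxτ x hx)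
      refine ⟨K - L, ?_, by
        simpa using (hK1.comp_add.sub hL1).sub (hasFlatNormalDeriv_const (P * |τ|) x)⟩
      have hφ := (abs_le.1 (h.obst_lip (hxτ x hx) (hx1 x hx))).2
      rw [add_sub_cancel_left] at hφ
      refine sub_nonneg.2 (flat_mono (u := u) hL2 hK2 hL4 hK3 ?_)
      push_cast
      linarith)
    (fun z hz hz' => by
      have := (abs_le.1 (harc z (by simpa using hz) hz')).2
      linarith)
  have hneg := le_of_halfDisc_barrier (a := 0) hr hK
    (w := fun z => u z - u (z + τ) - P * |τ|)
    (W := fun z => 𝒰 z - 𝒰 (z + τ) - (P * |τ| : ℝ))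
    ((hcu.sub hcτ).sub continuousOn_const) ((hhu.sub hhτ).sub_const _)
    (fun z hz => by
      rw [Complex.sub_re, Complex.sub_re, Complex.ofReal_re, hreτ z hz, hreu z hz])
    (by
      intro x hx hw
      obtain ⟨L, hL1, hL2, hL3, hL4⟩ := h.flat x (hx1 x hx)
      obtain ⟨K, hK1, hK2, hK3, hK4⟩ := h.flat (x + τ) (hxτ x hx)
      refine ⟨L - K, ?_, by
        simpa using (hL1.sub hK1.comp_add).sub (hasFlatNormalDeriv_const (P * |τ|) x)⟩
      have hφ := (abs_le.1 (h.obst_lip (hxτ x hx) (hx1 x hx))).1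
      rw [add_sub_cancel_left] at hφ
      refine sub_nonneg.2 (flat_mono (u := u) hK2 hL2 hK4 hL3 ?_)
      push_cast
      linarith)
    (fun z hz hz' => by
      have := (abs_le.1 (harc z (by simpa using hz) hz')).1
      linarith)
  intro z hz
  have h1 := hpos z hz
  have h2 := hneg z hz
  rw [abs_le]
  constructor <;> linarith

theorem ball_subset {z : ℂ} {r s : ℝ} (h1 : ‖z‖ + r ≤ s) (h2 : r ≤ z.im) :
    Metric.ball z r ⊆ upperHalfDisc 0 s := by
  intro w hw
  rw [Metric.mem_ball, dist_eq_norm] at hw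
  have h3 : ‖w‖ ≤ ‖z‖ + ‖w - z‖ := by simpa using norm_add_le z (w - z)
  have h4 := (abs_le.1 (Complex.abs_im_le_norm (w - z))).1
  rw [Complex.sub_im] at h4
  exact ⟨by simp; linarith, by linarith⟩

/-- Horizontal differences are controlled by horizontal derivatives. -/
theorem abs_translate_sub_le_of_deriv (h : ThinSolution θ P M 𝒰 u φ) {z : ℂ} {r τ K : ℝ}
    (hz : ‖z‖ ≤ r) (him : 0 < z.im) (hr : r + |τ| < 1)
    (hK : ∀ w : ℂ, ‖w‖ ≤ r + |τ| → w.im = z.im → |(deriv 𝒰 w).re| ≤ K) :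
    |u (z + τ) - u z| ≤ K * |τ| := by
  have hmem : ∀ t ∈ uIcc 0 τ, ‖z + t‖ ≤ r + |τ| := by
    intro t ht
    have h1 : |t| ≤ |τ| := by simpa using abs_sub_left_of_mem_uIcc ht
    have h2 := norm_add_le z (t : ℂ)
    rw [Complex.norm_real, Real.norm_eq_abs] at h2
    linarith
  have hd : ∀ t ∈ uIcc 0 τ, HasDerivWithinAt (fun t : ℝ => (𝒰 (z + t)).re)
      (deriv 𝒰 (z + t)).re (uIcc 0 τ) t := by
    intro t ht
    have hm : z + t ∈ upperHalfDisc 0 1 :=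
      ⟨by simp only [ofReal_zero, sub_zero]; linarith [hmem t ht], by simpa using him⟩
    have h1 : HasDerivAt (fun t : ℝ => z + (t : ℂ)) 1 t := by
      simpa using ((hasDerivAt_id t).ofReal_comp).const_add z
    have h2 := (h.hasDerivAt hm).comp t h1
    rw [mul_one] at h2
    exact h2.complex_re.hasDerivWithinAt
  have := (convex_uIcc 0 τ).norm_image_sub_le_of_norm_hasDerivWithin_le (C := K) hd
    (fun t ht => hK _ (hmem t ht) (by simp)) left_mem_uIcc right_mem_uIcc
  have e1 : (𝒰 (z + τ)).re = u (z + τ) := h.re_eq _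
    ⟨by simp only [ofReal_zero, sub_zero]; linarith [hmem τ right_mem_uIcc], by simpa using him⟩
  have e2 : (𝒰 z).re = u z := h.re_eq _
    ⟨by simp only [ofReal_zero, sub_zero]; linarith [abs_nonneg τ], him⟩
  simpa [e1, e2] using this

theorem norm_deriv_le_div_im (h : ThinSolution θ P M 𝒰 u φ) {z : ℂ} (hz : ‖z‖ ≤ 7 / 8)
    (him : 0 < z.im) : ‖deriv 𝒰 z‖ ≤ 32 * M / z.im := by
  have hle : z.im ≤ ‖z‖ := (le_abs_self _).trans (Complex.abs_im_le_norm z)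
  have hsub : Metric.ball z (z.im / 8) ⊆ upperHalfDisc 0 1 :=
    ball_subset (by linarith) (by linarith)
  have := norm_deriv_le_of_abs_re_le (B := M) (by positivity) (h.holo.mono hsub) (fun w hw => by
    rw [h.re_eq w (hsub hw)]
    exact h.bound w (upperHalfDisc_subset 0 1 (hsub hw)))
  refine this.trans (le_of_eq ?_)
  field_simp; ring

theorem abs_translate_sub_le_sqrt_div (h : ThinSolution θ P M 𝒰 u φ) {z : ℂ} {τ : ℝ}
    (hz : ‖z‖ ≤ 3 / 4) (him : 0 < z.im) (hτ : |τ| ≤ 1 / 8) :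
    |u (z + τ) - u z| ≤ 8 * M * √|τ| / √z.im := by
  have hM := h.bound_nonneg
  have hmem : z + τ ∈ closedUpperHalfDisc 0 1 := by
    refine closedUpperHalfDisc_mono (r := 3 / 4 + |τ|) (by linarith)
      (translate_mem ⟨by simpa using hz, him.le⟩)
  have h1 : |u (z + τ) - u z| ≤ 2 * M := by
    have h2 := h.bound _ hmem
    have h3 := h.bound z ⟨by simp; linarith, him.le⟩
    have := abs_sub (u (z + τ)) (u z)
    linarith
  have h2 : |u (z + τ) - u z| ≤ 32 * M / z.im * |τ| :=
    h.abs_translate_sub_le_of_deriv hz him (by linarith) fun w hw hw' => by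
      rw [← hw']
      exact (Complex.abs_re_le_norm _).trans
        (h.norm_deriv_le_div_im (by linarith) (by rw [hw']; exact him))
  refine abs_le_of_sq_le_sq ?_ (by positivity)
  rw [div_pow, mul_pow, Real.sq_sqrt (abs_nonneg _), Real.sq_sqrt him.le]
  calc (u (z + τ) - u z) ^ 2 = |u (z + τ) - u z| * |u (z + τ) - u z| := by
        rw [← sq_abs, sq]
    _ ≤ 2 * M * (32 * M / z.im * |τ|) :=
        mul_le_mul h1 h2 (abs_nonneg _) (by positivity)
    _ = (8 * M) ^ 2 * |τ| / z.im := by field_simp; ring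

theorem abs_translate_sub_le_sqrt (h : ThinSolution θ P M 𝒰 u φ) {τ : ℝ} (hτ : |τ| ≤ 1 / 8) :
    ∀ z ∈ closedUpperHalfDisc 0 (3 / 8), |u (z + τ) - u z| ≤ (P + 84 * (M + 1)) * √|τ| := by
  intro z hz
  have hM := h.bound_nonneg
  rcases eq_or_ne τ 0 with rfl | hτ0
  · simp
  have hτpos : 0 < |τ| := abs_pos.2 hτ0
  have := h.abs_translate_sub_le (r := 3 / 4) (τ := τ) (K := 8 * (M + 1) * √|τ|) (by norm_num)
    (by linarith) (by positivity) (fun z hz hz' => by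
      refine (h.abs_translate_sub_le_sqrt_div hz.le hz' hτ).trans ?_
      gcongr; linarith) z (by norm_num; exact hz)
  refine this.trans ?_
  have h1 : |τ| ≤ √|τ| := Real.le_sqrt_of_sq_le (by nlinarith)
  have h2 : (6 / 7 : ℝ) ≤ √(3 / 4) := Real.le_sqrt_of_sq_le (by norm_num)
  have h3 : 9 * (8 * (M + 1) * √|τ|) / √(3 / 4) ≤ 9 * (8 * (M + 1) * √|τ|) / (6 / 7) := by
    gcongr
  have h4 := mul_le_mul_of_nonneg_left h1 h.P_nonneg
  linarith

theorem abs_re_deriv_le_div_sqrt (h : ThinSolution θ P M 𝒰 u φ) {z : ℂ}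
    (hz : ‖z‖ ≤ 1 / 4) (him : 0 < z.im) :
    |(deriv 𝒰 z).re| ≤ 8 * (P + 84 * (M + 1)) / √z.im := by
  set C := P + 84 * (M + 1) with hC
  have hC0 : 0 ≤ C := by have := h.bound_nonneg; have := h.P_nonneg; positivity
  have hle : z.im ≤ ‖z‖ := (le_abs_self _).trans (Complex.abs_im_le_norm z)
  set τ := z.im / 2 with hτ
  have hτ0 : 0 < τ := by positivity
  have hsub : Metric.ball z τ ⊆ upperHalfDisc 0 (3 / 8) := ball_subset (by linarith) (by linarith)
  -- the derivative varies little along horizontal segments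
  have hosc : ∀ ξ : ℝ, 0 ≤ ξ → ξ ≤ τ → ‖deriv 𝒰 (z + ξ) - deriv 𝒰 z‖ ≤ 4 * (C * √τ) / τ := by
    intro ξ hξ0 hξ
    have hd : ∀ w ∈ upperHalfDisc 0 (3 / 8),
        HasDerivAt (fun w : ℂ => 𝒰 (w + ξ) - 𝒰 w) (deriv 𝒰 (w + ξ) - deriv 𝒰 w) w := by
      intro w hw
      have h1 := h.hasDerivAt (upperHalfDisc_mono (r := 3 / 8 + |ξ|) (s := 1)
        (by rw [abs_of_nonneg hξ0]; linarith) (translate_mem' (τ := ξ) hw))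
      exact (HasDerivAt.comp_add_const w (ξ : ℂ) h1).sub
        (h.hasDerivAt (upperHalfDisc_mono (by norm_num) hw))
    have := norm_deriv_le_of_abs_re_le (W := fun w : ℂ => 𝒰 (w + ξ) - 𝒰 w) (c := z)
      (B := C * √τ) hτ0
      (fun w hw => (hd w (hsub hw)).differentiableAt.differentiableWithinAt) (fun w hw => by
        have hw' := hsub hw
        have h2 := h.re_eq _ (upperHalfDisc_mono (r := 3 / 8 + |ξ|) (s := 1)
          (by rw [abs_of_nonneg hξ0]; linarith) (translate_mem' (τ := ξ) hw'))
        have h3 := h.re_eq _ (upperHalfDisc_mono (r := 3 / 8) (s := 1) (by norm_num) hw')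
        rw [Complex.sub_re, h2, h3]
        refine (h.abs_translate_sub_le_sqrt (by rw [abs_of_nonneg hξ0]; linarith) w
          (upperHalfDisc_subset _ _ hw')).trans ?_
        rw [abs_of_nonneg hξ0]
        gcongr)
    rwa [(hd z (hsub (Metric.mem_ball_self hτ0))).deriv] at this
  have hmv : ∃ ξ ∈ Ioo 0 τ, (deriv 𝒰 (z + ξ)).re = (u (z + τ) - u z) / τ := by
    have hmem : ∀ t ∈ Icc 0 τ, z + (t : ℂ) ∈ upperHalfDisc 0 1 := fun t ht =>
      upperHalfDisc_mono (r := 3 / 8 + |t|) (s := 1)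
        (by rw [abs_of_nonneg ht.1]; linarith [ht.2])
        (translate_mem' (τ := t) (hsub (Metric.mem_ball_self hτ0)))
    have hd : ∀ t ∈ Icc 0 τ, HasDerivAt (fun t : ℝ => (𝒰 (z + t)).re) (deriv 𝒰 (z + t)).re t := by
      intro t ht
      have h1 : HasDerivAt (fun t : ℝ => z + (t : ℂ)) 1 t := by
        simpa using ((hasDerivAt_id t).ofReal_comp).const_add z
      have h2 := (h.hasDerivAt (hmem t ht)).comp t h1
      rw [mul_one] at h2
      exact h2.complex_re
    obtain ⟨ξ, hξ, hξ'⟩ := exists_hasDerivAt_eq_slope (fun t : ℝ => (𝒰 (z + t)).re)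
      (fun t => (deriv 𝒰 (z + t)).re) hτ0
      (fun t ht => (hd t ht).continuousAt.continuousWithinAt)
      (fun t ht => hd t (Ioo_subset_Icc_self ht))
    refine ⟨ξ, hξ, ?_⟩
    rw [hξ', h.re_eq _ (hmem τ ⟨hτ0.le, le_rfl⟩), h.re_eq _ (hmem 0 ⟨le_rfl, hτ0.le⟩)]
    simp
  obtain ⟨ξ, hξ, hξ'⟩ := hmv
  have h1 := (Complex.abs_re_le_norm _).trans (hosc ξ hξ.1.le hξ.2.le)
  have h2 : |(deriv 𝒰 (z + ξ)).re| ≤ C * √τ / τ := by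
    rw [hξ', abs_div, abs_of_pos hτ0]
    gcongr
    have := h.abs_translate_sub_le_sqrt (τ := τ) (by rw [abs_of_pos hτ0]; linarith) z
      (upperHalfDisc_subset _ _ (hsub (Metric.mem_ball_self hτ0)))
    rwa [abs_of_pos hτ0] at this
  have h3 : |(deriv 𝒰 z).re| ≤ 5 * C * (√τ / τ) := by
    rw [Complex.sub_re] at h1
    have := abs_sub_abs_le_abs_sub (deriv 𝒰 z).re (deriv 𝒰 (z + ξ)).re
    rw [abs_sub_comm] at h1
    have e : 5 * C * (√τ / τ) = C * √τ / τ + 4 * (C * √τ) / τ := by ring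
    linarith
  refine h3.trans ?_
  have h4 : √τ / τ ≤ 3 / 2 / √z.im := by
    rw [Real.sqrt_div_self', div_le_div_iff₀ (by positivity) (by positivity)]
    have h8 : √z.im = √2 * √τ := by rw [← Real.sqrt_mul (by norm_num)]; congr 1; rw [hτ]; ring
    have h9 : √2 ≤ 3 / 2 := Real.sqrt_le_iff.2 ⟨by norm_num, by norm_num⟩
    rw [h8, one_mul]
    exact mul_le_mul_of_nonneg_right h9 (by positivity)
  calc 5 * C * (√τ / τ) ≤ 5 * C * (3 / 2 / √z.im) := by gcongr
    _ ≤ 8 * C / √z.im := by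
      rw [show 5 * C * (3 / 2 / √z.im) = (15 / 2) * C / √z.im by ring]
      gcongr; norm_num

theorem abs_translate_sub_le_mul (h : ThinSolution θ P M 𝒰 u φ) {τ : ℝ} (hτ : |τ| ≤ 1 / 16) :
    ∀ z ∈ closedUpperHalfDisc 0 (3 / 32),
      |u (z + τ) - u z| ≤ (P + 168 * (P + 84 * (M + 1))) * |τ| := by
  intro z hz
  set C := P + 84 * (M + 1) with hC
  have hC0 : 0 < C := by have := h.bound_nonneg; have := h.P_nonneg; positivity
  rcases eq_or_ne τ 0 with rfl | hτ0
  · simp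
  have hτpos : 0 < |τ| := abs_pos.2 hτ0
  have := h.abs_translate_sub_le (r := 3 / 16) (τ := τ) (K := 8 * C * |τ|) (by norm_num)
    (by linarith) (by positivity) (fun z hz hz' => by
      have := h.abs_translate_sub_le_of_deriv (K := 8 * C / √z.im) (τ := τ) hz.le hz'
        (by linarith) (fun w hw hw' => by
          have := h.abs_re_deriv_le_div_sqrt (z := w) (by linarith) (by rw [hw']; exact hz')
          rwa [hw'] at this)
      refine this.trans (le_of_eq (by ring))) z (by norm_num; exact hz)
  refine this.trans ?_
  have h2 : (3 / 7 : ℝ) ≤ √(3 / 16) := Real.le_sqrt_of_sq_le (by norm_num)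
  have h3 : 9 * (8 * C * |τ|) / √(3 / 16) ≤ 9 * (8 * C * |τ|) / (3 / 7) := by
    gcongr
  linarith

theorem abs_re_deriv_le (h : ThinSolution θ P M 𝒰 u φ) {z : ℂ}
    (hz : z ∈ upperHalfDisc 0 (3 / 32)) :
    |(deriv 𝒰 z).re| ≤ P + 168 * (P + 84 * (M + 1)) := by
  have hd : HasDerivAt (fun t : ℝ => (𝒰 (z + t)).re) (deriv 𝒰 z).re 0 := by
    have h1 : HasDerivAt (fun t : ℝ => z + (t : ℂ)) 1 0 := by
      simpa using ((hasDerivAt_id (0 : ℝ)).ofReal_comp).const_add z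
    have h0 : HasDerivAt 𝒰 (deriv 𝒰 z) (z + ((0 : ℝ) : ℂ)) := by
      simpa using h.hasDerivAt (upperHalfDisc_mono (by norm_num) hz)
    have h2 := h0.comp (0 : ℝ) h1
    rw [mul_one] at h2
    exact h2.complex_re
  refine le_of_tendsto hd.tendsto_slope_zero.abs ?_
  have hev : ∀ᶠ t : ℝ in 𝓝[≠] 0, |t| ≤ 1 / 16 := by
    refine nhdsWithin_le_nhds ?_
    filter_upwards [Metric.ball_mem_nhds (0 : ℝ) (show (0 : ℝ) < 1 / 16 by norm_num)] with t ht
    simpa using (mem_ball_zero_iff.1 ht).le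
  filter_upwards [hev, self_mem_nhdsWithin] with t ht ht0
  have ht0' : t ≠ 0 := ht0
  have := h.abs_translate_sub_le_mul ht z (upperHalfDisc_subset _ _ hz)
  rw [zero_add, h.re_eq _ (upperHalfDisc_mono (r := 3 / 32 + |t|) (s := 1) (by linarith)
    (translate_mem' hz)), ofReal_zero, add_zero, h.re_eq _ (upperHalfDisc_mono (by norm_num) hz),
    smul_eq_mul, abs_mul, abs_inv, inv_mul_le_iff₀ (abs_pos.2 ht0')]
  linarith

theorem norm_deriv_deriv_le (h : ThinSolution θ P M 𝒰 u φ) {z : ℂ} (hz : ‖z‖ ≤ 1 / 16)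
    (him : 0 < z.im) :
    ‖deriv (deriv 𝒰) z‖ ≤ 8 * (P + 168 * (P + 84 * (M + 1))) / z.im := by
  have hle : z.im ≤ ‖z‖ := (le_abs_self _).trans (Complex.abs_im_le_norm z)
  have hsub : Metric.ball z (z.im / 2) ⊆ upperHalfDisc 0 (3 / 32) :=
    ball_subset (by linarith) (by linarith)
  have hd : DifferentiableOn ℂ (deriv 𝒰) (upperHalfDisc 0 1) :=
    h.holo.deriv (isOpen_upperHalfDisc 0 1)
  have := norm_deriv_le_of_abs_re_le (by positivity)
    (hd.mono (hsub.trans (upperHalfDisc_mono (by norm_num))))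
    (fun w hw => h.abs_re_deriv_le (hsub hw))
  refine this.trans (le_of_eq ?_)
  field_simp; ring

end ThinSolution

namespace ThinSolution

variable {θ P M : ℝ} {𝒰 : ℂ → ℂ} {u : ℂ → ℝ} {φ : ℝ → ℝ}

theorem vertical_mem {x t : ℝ} (hx : |x| ≤ 1 / 64) (ht0 : 0 < t) (ht : t ≤ 1 / 64) :
    ‖(x + t * I : ℂ)‖ ≤ 1 / 32 ∧ (x + t * I : ℂ).im = t ∧
      (x + t * I : ℂ) ∈ upperHalfDisc 0 1 := by
  have h1 : ‖(x + t * I : ℂ)‖ ≤ 1 / 32 := by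
    have := norm_add_le (x : ℂ) (t * I)
    rw [norm_mul, Complex.norm_I, mul_one, Complex.norm_real, Complex.norm_real, Real.norm_eq_abs,
      Real.norm_eq_abs, abs_of_pos ht0] at this
    linarith
  exact ⟨h1, by simp, by simp; linarith, by simpa using ht0⟩

theorem hasDerivAt_vertical {W : ℂ → ℂ} {W' : ℂ} {x t : ℝ} (h : HasDerivAt W W' (x + t * I)) :
    HasDerivAt (fun t : ℝ => W (x + t * I)) (W' * I) t := by
  have h1 : HasDerivAt (fun t : ℝ => (x : ℂ) + t * I) I t := by
    simpa using ((hasDerivAt_id t).ofReal_comp.mul_const I).const_add (x : ℂ)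
  exact h.comp t h1

theorem hasDerivAt_deriv (h : ThinSolution θ P M 𝒰 u φ) {z : ℂ} (hz : z ∈ upperHalfDisc 0 1) :
    HasDerivAt (deriv 𝒰) (deriv (deriv 𝒰) z) z :=
  ((h.holo.deriv (isOpen_upperHalfDisc 0 1)).differentiableAt
    ((isOpen_upperHalfDisc 0 1).mem_nhds hz)).hasDerivAt

/-- `u` is almost affine in the normal direction, with slope the normal derivative at height `r`. -/
theorem abs_vertical_sub_le (h : ThinSolution θ P M 𝒰 u φ) {x r s : ℝ} (hx : |x| ≤ 1 / 64)
    (hr0 : 0 < r) (hr : r ≤ 1 / 64) (hs0 : 0 ≤ s) (hs : s ≤ r) :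
    |u (x + s * I) - u x + (deriv 𝒰 (x + r * I)).im * s| ≤
      16 * (P + 168 * (P + 84 * (M + 1))) * r := by
  set C := P + 168 * (P + 84 * (M + 1)) with hC
  have hC0 : 0 ≤ C := by have := h.bound_nonneg; have := h.P_nonneg; positivity
  set l := (deriv 𝒰 (x + r * I)).im with hl
  have hk : ∀ t, 0 < t → t ≤ r → |(deriv 𝒰 (x + t * I)).im - l| ≤
      8 * C * (Real.log r - Real.log t) := by
    intro t ht0 htr
    have := norm_sub_le_of_deriv_le (f := fun t : ℝ => (deriv 𝒰 (x + t * I)).im)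
      (f' := fun t => (deriv (deriv 𝒰) (x + t * I) * I).im) (B := fun t => 8 * C * Real.log t)
      (B' := fun t => 8 * C * t⁻¹) htr
      (fun v hv => (hasDerivAt_vertical (h.hasDerivAt_deriv
        (vertical_mem hx (by linarith [hv.1]) (by linarith [hv.2])).2.2)).complex_im)
      (fun v hv => (Real.hasDerivAt_log (by linarith [hv.1])).const_mul _)
      (fun v hv => by
        obtain ⟨h1, h2, -⟩ := vertical_mem (t := v) hx (by linarith [hv.1]) (by linarith [hv.2])
        have := h.norm_deriv_deriv_le (z := x + v * I) (by linarith)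
          (by rw [h2]; linarith [hv.1])
        rw [h2] at this
        refine (Complex.abs_im_le_norm _).trans ?_
        rw [norm_mul, Complex.norm_I, mul_one]
        exact this)
    rw [abs_sub_comm, mul_sub]
    exact this
  have hosc : ∀ t, 0 < t → t ≤ r → |(u (x + r * I) + l * r) - (u (x + t * I) + l * t)| ≤
      8 * C * r := by
    intro t ht0 htr
    have := norm_sub_le_of_deriv_le (f := fun t : ℝ => (𝒰 (x + t * I)).re + l * t)
      (f' := fun t => (deriv 𝒰 (x + t * I) * I).re + l * 1)
      (B := fun t => 8 * C * (t * Real.log r - t * Real.log t + t))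
      (B' := fun t => 8 * C * (1 * Real.log r - (1 * Real.log t + t * t⁻¹) + 1)) htr
      (fun v hv => ((hasDerivAt_vertical (h.hasDerivAt
        (vertical_mem hx (by linarith [hv.1]) (by linarith [hv.2])).2.2)).complex_re).add
        ((hasDerivAt_id v).const_mul l))
      (fun v hv => ((((hasDerivAt_id v).mul_const _).sub ((hasDerivAt_id v).mul
        (Real.hasDerivAt_log (by linarith [hv.1])))).add (hasDerivAt_id v)).const_mul _)
      (fun v hv => by
        have hv0 : v ≠ 0 := by linarith [hv.1]
        have := hk v (by linarith [hv.1]) hv.2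
        rw [mul_inv_cancel₀ hv0, Real.norm_eq_abs]
        rw [abs_sub_comm] at this
        refine le_trans (le_of_eq ?_) (this.trans (le_of_eq (by ring)))
        congr 1
        simp
        ring)
    have e : ∀ v, 0 < v → v ≤ r → (𝒰 (x + v * I)).re = u (x + v * I) := fun v hv hvr =>
      h.re_eq _ (vertical_mem hx hv (by linarith)).2.2
    rw [e r hr0 le_rfl, e t ht0 htr, Real.norm_eq_abs] at this
    refine this.trans ?_
    have hlog : Real.log t ≤ Real.log r := Real.log_le_log ht0 htr
    nlinarith [mul_nonneg (mul_nonneg hC0 ht0.le) (sub_nonneg.2 hlog), mul_nonneg hC0 ht0.le]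
  have hlim : |(u (x + r * I) + l * r) - (u x + l * 0)| ≤ 8 * C * r := by
    have hcont : ContinuousOn (fun t : ℝ => |(u (x + r * I) + l * r) - (u (x + t * I) + l * t)|)
        (Icc 0 r) := by
      refine (continuousOn_const.sub (ContinuousOn.add ?_ (by fun_prop))).abs
      refine h.cont.comp (by fun_prop) ?_
      intro t ht
      rcases ht.1.eq_or_lt with h0 | h0
      · rw [← h0]; exact ⟨by simp; linarith, by simp⟩
      · exact upperHalfDisc_subset _ _ (vertical_mem hx h0 (by linarith [ht.2])).2.2
    have h1 := (hcont 0 ⟨le_rfl, hr0.le⟩).mono_left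
      (nhdsWithin_mono _ (Ioo_subset_Icc_self (a := 0) (b := r)))
    simp only [ofReal_zero, zero_mul, add_zero] at h1
    have : (𝓝[Ioo (0:ℝ) r] 0).NeBot := by
      rw [← mem_closure_iff_nhdsWithin_neBot, closure_Ioo hr0.ne]; exact ⟨le_rfl, hr0.le⟩
    exact le_of_tendsto h1 (by
      filter_upwards [self_mem_nhdsWithin] with t ht using hosc t ht.1 ht.2.le)
  rcases hs0.eq_or_lt with h0 | h0
  · rw [← h0]; simp; positivity
  · have h1 := hosc s h0 hs
    have h2 := abs_le.1 h1
    have h3 := abs_le.1 hlim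
    rw [abs_le]
    constructor <;> linarith

theorem abs_im_deriv_le (h : ThinSolution θ P M 𝒰 u φ) (hθ : 0 < θ) {x r : ℝ}
    (hx : |x| ≤ 1 / 64) (hr0 : 0 < r) (hr : r ≤ 1 / 64) :
    |(deriv 𝒰 (x + r * I)).im| ≤ 4 * (17 * (P + 168 * (P + 84 * (M + 1))) + θ) := by
  set C := P + 168 * (P + 84 * (M + 1)) with hC
  have hC0 : 0 ≤ C := by have := h.bound_nonneg; have := h.P_nonneg; positivity
  set l := (deriv 𝒰 (x + r * I)).im with hl
  set K := 17 * C + θ with hK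
  have hK0 : 0 < K := by positivity
  have hsub : closedUpperHalfDisc x r ⊆ closedUpperHalfDisc 0 1 :=
    closedUpperHalfDisc_subset_closedUpperHalfDisc (by rw [sub_zero]; linarith)
  have hsub' : upperHalfDisc x r ⊆ upperHalfDisc 0 1 :=
    upperHalfDisc_subset_upperHalfDisc (by rw [sub_zero]; linarith)
  have harc : ∀ z : ℂ, ‖z - x‖ = r → 0 ≤ z.im → |u z - u x + l * z.im| ≤ 17 * C * r := by
    intro z hz hz'
    have hzr : z.im ≤ r := by
      have := (Complex.abs_im_le_norm (z - x)).trans hz.le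
      simp only [Complex.sub_im, Complex.ofReal_im, sub_zero] at this
      exact (abs_le.1 this).2
    have hzx : |z.re - x| ≤ r := by
      have := (Complex.abs_re_le_norm (z - x)).trans hz.le
      simpa using this
    have h1 := h.abs_vertical_sub_le hx hr0 hr hz' hzr
    have h2 := h.abs_translate_sub_le_mul (τ := z.re - x) (by linarith) (x + z.im * I) (by
      rcases hz'.eq_or_lt with h0 | h0
      · rw [← h0]; exact ⟨by simp; linarith, by simp⟩
      · exact ⟨by rw [ofReal_zero, sub_zero]; linarith [(vertical_mem hx h0 (hzr.trans hr)).1],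
          by simpa using hz'⟩)
    have e : (x + z.im * I : ℂ) + ((z.re - x : ℝ) : ℂ) = z := by
      apply Complex.ext <;> simp
    rw [e] at h2
    have h3 : C * |z.re - x| ≤ C * r := mul_le_mul_of_nonneg_left hzx hC0
    have h4 := abs_le.1 (h2.trans h3)
    have h5 := abs_le.1 h1
    rw [abs_le]
    constructor <;> linarith
  -- comparison with a quadratic harmonic polynomial
  have key : ∀ σ : ℝ, |σ| = 1 → σ * l ≤ 4 * K := by
    intro σ hσ
    by_contra! hlt
    have hσ2 : |σ| ≤ 1 := hσ.le
    have hmp := halfDisc_max_principle (a := x) hr0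
      (w := fun z => σ * (u z - u x) + (θ * z.im + (-(2 * K / r)) * ((z - x) ^ 2).re) + K * r)
      (W := fun z => (σ : ℂ) * (𝒰 z - u x) + ((-(θ : ℂ) * I) * z +
        ((-(2 * K / r) : ℝ) : ℂ) * (z - x) ^ 2) + (K * r : ℝ))
      (by
        have := h.cont.mono hsub
        refine ((continuousOn_const.mul (this.sub continuousOn_const)).add ?_).add
          continuousOn_const
        refine Continuous.continuousOn ?_
        have : Continuous fun z : ℂ => ((z - x) ^ 2).re :=
          Complex.continuous_re.comp (by fun_prop)
        have := Complex.continuous_im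
        fun_prop)
      (by
        have := h.holo.mono hsub'
        refine (((this.sub_const _).const_mul _).add ?_).add_const _
        fun_prop)
      (fun z hz => by
        have e := h.re_eq z (hsub' hz)
        rw [Complex.add_re, Complex.add_re, Complex.add_re, Complex.re_ofReal_mul,
          Complex.re_ofReal_mul, Complex.sub_re, e]
        simp)
      (by
        intro y hy _
        obtain ⟨L, hL1, hL2, -⟩ := h.flat y (by
          have := abs_sub_abs_le_abs_sub y x; linarith)
        refine ⟨σ * L + θ, ?_, ?_⟩
        · have := neg_abs_le (σ * L)
          rw [abs_mul, hσ, one_mul] at this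
          linarith
        · have h1 := (hL1.sub (hasFlatNormalDeriv_const (u x) y)).const_mul σ
          have h2 : HasFlatNormalDeriv (fun z => z.im) y 1 := by
            have : HasDerivAt (fun z : ℂ => -I * z) (-I * 1) (y : ℂ) :=
              (hasDerivAt_id (y : ℂ)).const_mul _
            simpa using this.hasFlatNormalDeriv_re
          have h3 : HasFlatNormalDeriv (fun z => ((z - x) ^ 2).re) y 0 := by
            have : HasDerivAt (fun z : ℂ => (z - x) ^ 2)
                (((2 : ℕ) : ℂ) * ((y : ℂ) - x) ^ (2 - 1) * 1) (y : ℂ) :=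
              ((hasDerivAt_id (y : ℂ)).sub_const (x : ℂ)).pow 2
            simpa using this.hasFlatNormalDeriv_re
          have h4 := (h1.add ((h2.const_mul θ).add (h3.const_mul (-(2 * K / r))))).add
            (hasFlatNormalDeriv_const (K * r) y)
          simpa using h4)
      (by
        intro z hz hz'
        have h1 := harc z hz hz'
        have hzr : z.im ≤ r := by
          have := (Complex.abs_im_le_norm (z - x)).trans hz.le
          simp only [Complex.sub_im, Complex.ofReal_im, sub_zero] at this
          exact (abs_le.1 this).2
        have hsq : ((z - x) ^ 2).re = r ^ 2 - 2 * z.im ^ 2 := by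
          have : ‖z - x‖ ^ 2 = (z - x).re ^ 2 + z.im ^ 2 := by
            rw [← Complex.normSq_eq_norm_sq, Complex.normSq_apply]; simp; ring
          rw [hz] at this
          rw [sq (z - (x : ℂ)), Complex.mul_re]
          simp at this ⊢
          linarith
        have h2 : σ * (u z - u x + l * z.im) ≤ 17 * C * r := by
          refine (le_abs_self _).trans ?_
          rw [abs_mul, hσ, one_mul]; exact h1
        have h3 : 2 * K / r * (r ^ 2 - 2 * z.im ^ 2) = 2 * K * r - 4 * K * (z.im ^ 2 / r) := by
          field_simp; ring
        have h4 : z.im ^ 2 / r ≤ z.im := by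
          rw [div_le_iff₀ hr0]; nlinarith
        have h5 : 4 * K * (z.im ^ 2 / r) ≤ 4 * K * z.im := by gcongr
        have h6 : 4 * K * z.im ≤ σ * l * z.im := by gcongr
        have h7 : θ * z.im ≤ θ * r := by gcongr
        rw [hsq, neg_mul, h3]
        have e : 17 * C * r = K * r - θ * r := by rw [hK]; ring
        linarith)
    have := hmp x ⟨by simpa using hr0.le, by simp⟩
    simp at this
    nlinarith
  rw [abs_le]
  have h1 := key 1 (by simp)
  have h2 := key (-1) (by simp)
  constructor <;> linarith

/-- Interior Lipschitz estimate. -/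
theorem norm_deriv_le (h : ThinSolution θ P M 𝒰 u φ) (hθ : 0 < θ) {z : ℂ}
    (hx : |z.re| ≤ 1 / 64) (hr0 : 0 < z.im) (hr : z.im ≤ 1 / 64) :
    ‖deriv 𝒰 z‖ ≤ 70 * (P + 168 * (P + 84 * (M + 1))) + 4 * θ := by
  have h0 : z ∈ upperHalfDisc 0 (3 / 32) := by
    have := (vertical_mem hx hr0 hr).1
    rw [Complex.re_add_im] at this
    exact ⟨by rw [ofReal_zero, sub_zero]; linarith, hr0⟩
  have h1 := h.abs_re_deriv_le h0
  have h2 := h.abs_im_deriv_le hθ hx hr0 hr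
  rw [Complex.re_add_im] at h2
  have := h.bound_nonneg; have := h.P_nonneg
  have h3 := Complex.norm_le_abs_re_add_abs_im (deriv 𝒰 z)
  linarith

end ThinSolution

/-- The open rectangle of width `2 * R` and height `R` sitting on the real axis. -/
def upperRect (R : ℝ) : Set ℂ := {z | |z.re| < R ∧ 0 < z.im ∧ z.im < R}

/-- A Lipschitz extension `V` of a holomorphic function on the rectangle, whose real part solves
the two-phase thin obstacle problem with obstacle `φ`. -/
structure LipschitzThinSolution (R θ P L : ℝ) (V : ℂ → ℂ) (φ : ℝ → ℝ) : Prop where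
  R_pos : 0 < R
  R_le : R ≤ 1
  θ_pos : 0 < θ
  L_nonneg : 0 ≤ L
  lip : ∀ z w, ‖V z - V w‖ ≤ L * ‖z - w‖
  holo : DifferentiableOn ℂ V (upperRect R)
  flat : ∀ x : ℝ, |x| < R → ∃ K, HasFlatNormalDeriv (fun z => (V z).re) x K ∧ |K| ≤ θ ∧
    (φ x < (V x).re → K = θ) ∧ ((V x).re < φ x → K = -θ)
  obst_diff : ∀ x : ℝ, |x| < R → DifferentiableAt ℝ φ x
  obst_deriv_le : ∀ x : ℝ, |x| < R → |deriv φ x| ≤ P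
  obst_deriv_lip : ∀ x y : ℝ, |x| < R → |y| < R → |deriv φ x - deriv φ y| ≤ P * |x - y|

theorem isOpen_upperRect (R : ℝ) : IsOpen (upperRect R) :=
  (isOpen_lt (f := fun z : ℂ => |z.re|) (Complex.continuous_re.abs) continuous_const).and
    ((isOpen_lt continuous_const Complex.continuous_im).and
      (isOpen_lt Complex.continuous_im continuous_const))

theorem convex_upperRect (R : ℝ) : Convex ℝ (upperRect R) := by
  have : upperRect R = (Complex.reLm ⁻¹' Ioo (-R) R) ∩ (Complex.imLm ⁻¹' Ioo 0 R) := by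
    ext z
    simp [upperRect, abs_lt]
  rw [this]
  exact ((convex_Ioo _ _).linear_preimage _).inter ((convex_Ioo _ _).linear_preimage _)

theorem ThinSolution.exists_lipschitzThinSolution {θ P M : ℝ} (hθ : 0 < θ) :
    ∃ L : ℝ, ∀ 𝒰 u φ, ThinSolution θ P M 𝒰 u φ →
      ∃ V, LipschitzThinSolution (1 / 64) θ P L V φ ∧
        EqOn 𝒰 V (upperRect (1 / 64)) ∧ ∀ x : ℝ, |x| < 1 / 64 → (V x).re = u x := by
  set K : ℝ := 70 * (P + 168 * (P + 84 * (M + 1))) + 4 * θ with hK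
  refine ⟨lipschitzExtensionConstant ℂ * K.toNNReal, fun 𝒰 u φ h => ?_⟩
  have hsub : upperRect (1 / 64) ⊆ upperHalfDisc 0 1 := by
    rintro z ⟨h1, h2, h3⟩
    have := (ThinSolution.vertical_mem h1.le h2 h3.le).2.2
    rwa [Complex.re_add_im] at this
  have hlip : LipschitzOnWith K.toNNReal 𝒰 (upperRect (1 / 64)) := by
    refine Convex.lipschitzOnWith_of_nnnorm_deriv_le (𝕜 := ℂ)
      (fun z hz => (h.hasDerivAt (hsub hz)).differentiableAt) (fun z hz => ?_) (convex_upperRect _)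
    have := h.norm_deriv_le hθ hz.1.le hz.2.1 hz.2.2.le
    rw [← NNReal.coe_le_coe, coe_nnnorm]
    exact this.trans (Real.le_coe_toNNReal _)
  obtain ⟨V, hV, hVe⟩ := hlip.extend_finite_dimension
  have hVc : Continuous V := hV.continuous
  have hre : ∀ x : ℝ, |x| < 1 / 64 → (V x).re = u x := by
    intro x hx
    have h1 : Tendsto (fun t : ℝ => (V (x + t * I)).re) (𝓝[Ioo 0 (1 / 64)] 0)
        (𝓝 (V (x + (0 : ℝ) * I)).re) :=
      (Continuous.tendsto (by fun_prop) 0).mono_left nhdsWithin_le_nhds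
    have h2 : Tendsto (fun t : ℝ => u (x + t * I)) (𝓝[Ioo 0 (1 / 64)] 0)
        (𝓝 (u (x + (0 : ℝ) * I))) := by
      have : ContinuousOn (fun t : ℝ => u (x + t * I)) (Icc 0 (1 / 64)) := by
        refine h.cont.comp (by fun_prop) ?_
        intro t ht
        rcases ht.1.eq_or_lt with h0 | h0
        · rw [← h0]; exact ⟨by simp; linarith, by simp⟩
        · exact upperHalfDisc_subset _ _ (ThinSolution.vertical_mem hx.le h0 ht.2).2.2
      exact (this 0 ⟨le_rfl, by norm_num⟩).mono_left (nhdsWithin_mono _ Ioo_subset_Icc_self)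
    have : (𝓝[Ioo (0:ℝ) (1 / 64)] 0).NeBot := by
      rw [← mem_closure_iff_nhdsWithin_neBot, closure_Ioo (by norm_num)]
      exact ⟨le_rfl, by norm_num⟩
    have h3 := tendsto_nhds_unique (h1.congr' (by
      filter_upwards [self_mem_nhdsWithin] with t ht
      have hm : (x + t * I : ℂ) ∈ upperRect (1 / 64) :=
        ⟨by simpa using hx, by simpa using ht.1, by simpa using ht.2⟩
      rw [← hVe hm, h.re_eq _ (hsub hm)])) h2
    simpa using h3
  refine ⟨V, ⟨by norm_num, by norm_num, hθ, by positivity, fun z w => ?_, ?_, ?_,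
    fun x hx => h.obst_diff x (by linarith), fun x hx => h.obst_deriv_le x (by linarith),
    fun x y hx hy => h.obst_deriv_lip x y (by linarith) (by linarith)⟩, hVe, hre⟩
  · have := hV.dist_le_mul z w
    rwa [dist_eq_norm, dist_eq_norm] at this
  · exact (h.holo.mono hsub).congr fun z hz => (hVe hz).symm
  · intro x hx
    obtain ⟨K, hK1, hK2, hK3, hK4⟩ := h.flat x (by linarith)
    refine ⟨K, hK1.congr' ?_, hK2, ?_, ?_⟩
    · have : Ioo (0 : ℝ) (1 / 64) ∈ 𝓝[>] 0 := Ioo_mem_nhdsGT (by norm_num)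
      filter_upwards [this] with t ht
      have hm : (x + t * I : ℂ) ∈ upperRect (1 / 64) :=
        ⟨by simpa using hx, by simpa using ht.1, by simpa using ht.2⟩
      rw [hre x hx, ← hVe hm, h.re_eq _ (hsub hm)]
    · rwa [hre x hx]
    · rwa [hre x hx]

namespace LipschitzThinSolution

variable {R θ P L : ℝ} {V : ℂ → ℂ} {φ : ℝ → ℝ}

theorem continuous (h : LipschitzThinSolution R θ P L V φ) : Continuous V := by
  have : LipschitzWith L.toNNReal V := LipschitzWith.of_dist_le_mul fun z w => by
    rw [dist_eq_norm, dist_eq_norm, Real.coe_toNNReal _ h.L_nonneg]; exact h.lip z w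
  exact this.continuous

theorem P_nonneg (h : LipschitzThinSolution R θ P L V φ) : 0 ≤ P :=
  (abs_nonneg _).trans (h.obst_deriv_le 0 (by simpa using h.R_pos))

theorem hasDerivAt (h : LipschitzThinSolution R θ P L V φ) {z : ℂ} (hz : z ∈ upperRect R) :
    HasDerivAt V (deriv V z) z :=
  (h.holo.differentiableAt ((isOpen_upperRect R).mem_nhds hz)).hasDerivAt

theorem hasDerivAt_deriv (h : LipschitzThinSolution R θ P L V φ) {z : ℂ} (hz : z ∈ upperRect R) :
    HasDerivAt (deriv V) (deriv (deriv V) z) z :=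
  ((h.holo.deriv (isOpen_upperRect R)).differentiableAt
    ((isOpen_upperRect R).mem_nhds hz)).hasDerivAt

/-- The normal derivative of `Re V` integrates to the increment of `-Im V`. -/
theorem exists_integral_eq (h : LipschitzThinSolution R θ P L V φ) {a b : ℝ} (ha : -R < a)
    (hab : a ≤ b) (hb : b < R) :
    ∃ g : ℝ → ℝ, (∀ x : ℝ, x ∈ Icc a b → |g x| ≤ θ ∧ (φ x < (V x).re → g x = θ) ∧
      ((V x).re < φ x → g x = -θ)) ∧ ∫ x in a..b, g x = (V a).im - (V b).im := by
  have hx : ∀ x ∈ Icc a b, |x| < R := fun x hx =>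
    abs_lt.2 ⟨by linarith [hx.1], by linarith [hx.2]⟩
  have hflat : ∀ x : ℝ, ∃ K, x ∈ Icc a b → HasFlatNormalDeriv (fun z => (V z).re) x K ∧ |K| ≤ θ ∧
    (φ x < (V x).re → K = θ) ∧ ((V x).re < φ x → K = -θ) := by
    intro x
    by_cases hm : x ∈ Icc a b
    · obtain ⟨K, hK⟩ := h.flat x (hx x hm)
      exact ⟨K, fun _ => hK⟩
    · exact ⟨0, fun h => absurd h hm⟩
  choose g hg using hflat
  refine ⟨g, fun x hx => (hg x hx).2, ?_⟩
  have hVc := h.continuous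
  have h1 : Tendsto (fun t : ℝ => ∫ x in a..b, ((V (x + t * I)).re - (V x).re) / t) (𝓝[>] 0)
      (𝓝 (∫ x in a..b, g x)) := by
    refine intervalIntegral.tendsto_integral_filter_of_dominated_convergence (fun _ => L) ?_ ?_
      intervalIntegrable_const ?_
    · refine Eventually.of_forall fun t => Continuous.aestronglyMeasurable ?_
      fun_prop
    · filter_upwards [self_mem_nhdsWithin] with t ht
      have ht0 : (0 : ℝ) < t := ht
      refine Eventually.of_forall fun x _ => ?_
      rw [norm_div, Real.norm_of_nonneg ht0.le, div_le_iff₀ ht0, ← Complex.sub_re]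
      refine (Complex.abs_re_le_norm _).trans ((h.lip _ _).trans ?_)
      simp [abs_of_pos ht0]
    · refine Eventually.of_forall fun x hx' => ?_
      rw [uIoc_of_le hab] at hx'
      exact (hg x (Ioc_subset_Icc_self hx')).1
  have h2 : Tendsto (fun t : ℝ => ∫ x in a..b, ((V (x + t * I)).re - (V x).re) / t) (𝓝[>] 0)
      (𝓝 ((V a).im - (V b).im)) := by
    rw [tendsto_iff_norm_sub_tendsto_zero]
    have hlim : Tendsto (fun t : ℝ => 2 * L * t) (𝓝[>] 0) (𝓝 (2 * L * 0)) :=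
      (Continuous.tendsto (by fun_prop) 0).mono_left nhdsWithin_le_nhds
    rw [mul_zero] at hlim
    refine tendsto_of_tendsto_of_tendsto_of_le_of_le' tendsto_const_nhds hlim
      (Eventually.of_forall fun _ => norm_nonneg _) ?_
    filter_upwards [Ioo_mem_nhdsGT h.R_pos] with t ht
    have ht0 : 0 < t := ht.1
    have hc := Complex.integral_boundary_rect_eq_zero_of_continuousOn_of_differentiableOn V
      (a : ℂ) (b + t * I) hVc.continuousOn (h.holo.mono (by
        intro z hz
        simp only [Complex.mem_reProdIm] at hz
        simp [min_eq_left hab, max_eq_right hab, min_eq_left ht0.le, max_eq_right ht0.le] at hz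
        exact ⟨hx _ ⟨hz.1.1.le, hz.1.2.le⟩, hz.2.1, hz.2.2.trans ht.2⟩))
    simp only [ofReal_re, ofReal_im, add_re, mul_re, I_re, mul_zero, I_im, mul_one, sub_self,
      add_zero, add_im, mul_im, zero_add, ofReal_zero, zero_mul, smul_eq_mul] at hc
    have hii : ∀ f : ℝ → ℂ, Continuous f → ∀ c d : ℝ, IntervalIntegrable f volume c d :=
      fun f hf c d => hf.intervalIntegrable c d
    have hre := congrArg Complex.re hc
    have eR : ∀ (f : ℝ → ℂ) (c d : ℝ), Continuous f →
        (∫ x in c..d, f x).re = ∫ x in c..d, (f x).re := fun f c d hf =>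
      (intervalIntegral.intervalIntegral_re (hii f hf c d)).symm
    have eI : ∀ (f : ℝ → ℂ) (c d : ℝ), Continuous f →
        (∫ x in c..d, f x).im = ∫ x in c..d, (f x).im := fun f c d hf =>
      (intervalIntegral.intervalIntegral_im (hii f hf c d)).symm
    rw [sub_re, add_re, sub_re, mul_re, mul_re, I_re, I_im, zero_mul, one_mul, zero_mul, one_mul,
      zero_sub, zero_sub, eR _ _ _ (by fun_prop), eR _ _ _ (by fun_prop), eI _ _ _ (by fun_prop),
      eI _ _ _ (by fun_prop), zero_re] at hre
    have hri : ∀ f : ℝ → ℝ, Continuous f → ∀ c d : ℝ, IntervalIntegrable f volume c d :=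
      fun f hf c d => hf.intervalIntegrable c d
    have hIm : Continuous fun z => (V z).im := Complex.continuous_im.comp hVc
    have hRe : Continuous fun z => (V z).re := Complex.continuous_re.comp hVc
    have e1 : (∫ x in a..b, ((V (x + t * I)).re - (V x).re) / t) - ((V a).im - (V b).im) =
        (∫ y in (0 : ℝ)..t, (((V (a + y * I)).im - (V a).im) -
          ((V (b + y * I)).im - (V b).im))) / t := by
      rw [intervalIntegral.integral_div, intervalIntegral.integral_sub (hri _ (by fun_prop) _ _)
        (hri _ (by fun_prop) _ _), intervalIntegral.integral_sub (hri _ (by fun_prop) _ _)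
        (hri _ (by fun_prop) _ _), intervalIntegral.integral_sub (hri _ (by fun_prop) _ _)
        (hri _ (by fun_prop) _ _), intervalIntegral.integral_sub (hri _ (by fun_prop) _ _)
        (hri _ (by fun_prop) _ _), intervalIntegral.integral_const,
        intervalIntegral.integral_const, smul_eq_mul, smul_eq_mul, sub_zero]
      rw [eq_div_iff ht0.ne', sub_mul, div_mul_cancel₀ _ ht0.ne']
      linarith
    rw [e1, norm_div, Real.norm_of_nonneg ht0.le, div_le_iff₀ ht0]
    have hle : ∀ c y : ℝ, y ∈ Set.uIoc 0 t → |(V (c + y * I)).im - (V c).im| ≤ L * t := by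
      intro c y hy
      rw [uIoc_of_le ht0.le] at hy
      rw [← sub_im]
      refine (Complex.abs_im_le_norm _).trans ((h.lip _ _).trans ?_)
      simp only [add_sub_cancel_left, norm_mul, norm_real, norm_I, mul_one, Real.norm_eq_abs,
        abs_of_pos hy.1]
      exact mul_le_mul_of_nonneg_left hy.2 h.L_nonneg
    refine (intervalIntegral.norm_integral_le_of_norm_le_const (C := 2 * L * t)
      fun y hy => ?_).trans ?_
    · have := norm_sub_le ((V (a + y * I)).im - (V a).im) ((V (b + y * I)).im - (V b).im)
      rw [Real.norm_eq_abs, Real.norm_eq_abs, Real.norm_eq_abs] at this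
      rw [Real.norm_eq_abs]
      have := hle a y hy; have := hle b y hy
      linarith
    · rw [sub_zero, abs_of_pos ht0]
  exact tendsto_nhds_unique h1 h2

theorem abs_im_sub_le (h : LipschitzThinSolution R θ P L V φ) {a b : ℝ} (ha : |a| < R)
    (hb : |b| < R) : |(V a).im - (V b).im| ≤ θ * |a - b| := by
  wlog hab : a ≤ b generalizing a b
  · rw [abs_sub_comm, abs_sub_comm a b]; exact this hb ha (le_of_not_ge hab)
  obtain ⟨g, hg, hi⟩ := h.exists_integral_eq (abs_lt.1 ha).1 hab (abs_lt.1 hb).2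
  rw [← hi, abs_sub_comm, ← Real.norm_eq_abs]
  refine intervalIntegral.norm_integral_le_of_norm_le_const fun x hx => ?_
  rw [uIoc_of_le hab] at hx
  exact (hg x (Ioc_subset_Icc_self hx)).1

theorem im_sub_eq (h : LipschitzThinSolution R θ P L V φ) {a b : ℝ} (ha : -R < a) (hab : a ≤ b)
    (hb : b < R) :
    ((∀ x : ℝ, x ∈ Icc a b → φ x < (V x).re) → (V a).im - (V b).im = θ * (b - a)) ∧
    ((∀ x : ℝ, x ∈ Icc a b → (V x).re < φ x) → (V a).im - (V b).im = -θ * (b - a)) := by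
  obtain ⟨g, hg, hi⟩ := h.exists_integral_eq ha hab hb
  constructor
  · intro hx
    have : ∫ x in a..b, g x = ∫ _ in a..b, θ := intervalIntegral.integral_congr fun x hx' => by
      rw [uIcc_of_le hab] at hx'
      exact (hg x hx').2.1 (hx x hx')
    rw [← hi, this, intervalIntegral.integral_const, smul_eq_mul, mul_comm]
  · intro hx
    have : ∫ x in a..b, g x = ∫ _ in a..b, -θ := intervalIntegral.integral_congr fun x hx' => by
      rw [uIcc_of_le hab] at hx'
      exact (hg x hx').2.2 (hx x hx')
    rw [← hi, this, intervalIntegral.integral_const, smul_eq_mul, mul_comm]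

/-- Boundary values of `V'` at almost every point: either the normal derivative is extremal, or
the tangential derivative is that of the obstacle. -/
theorem ae_trace (h : LipschitzThinSolution R θ P L V φ) :
    ∀ᵐ x : ℝ, |x| < R → ∃ f : ℂ, HasDerivAt (fun x : ℝ => V x) f x ∧
      (|f.im| = θ ∨ f.re = deriv φ x) := by
  have hlip : LipschitzWith L.toNNReal (fun x : ℝ => V x) := LipschitzWith.of_dist_le_mul
    fun z w => by
      rw [dist_eq_norm, dist_eq_norm, Real.coe_toNNReal _ h.L_nonneg]
      refine (h.lip z w).trans (le_of_eq ?_)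
      rw [← ofReal_sub, Complex.norm_real]
  set Z : Set ℝ := {x : ℝ | |x| < R ∧ (V x).re = φ x} with hZ
  have hcount : {x | x ∈ Z ∧ 𝓝[Z ∩ Ioi x] x = ⊥}.Countable :=
    countable_setOfPred_isolated_right_within
  filter_upwards [hlip.ae_differentiableAt_real, hcount.ae_notMem volume] with x hx1 hx2 hxR
  refine ⟨_, hx1.hasDerivAt, ?_⟩
  set f := deriv (fun x : ℝ => V x) x with hf
  have hd := hx1.hasDerivAt
  have hcr : Continuous fun x : ℝ => (V x).re :=
    Complex.continuous_re.comp (h.continuous.comp Complex.continuous_ofReal)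
  have hcφ : ContinuousAt φ x := (h.obst_diff x hxR).continuousAt
  have hIoo : Ioo (-R) R ∈ 𝓝 x := Ioo_mem_nhds (abs_lt.1 hxR).1 (abs_lt.1 hxR).2
  have hgen : ∀ c : ℝ, (∀ᶠ y : ℝ in 𝓝[>] x, (V x).im - (V y).im = c * (y - x)) → f.im = -c := by
    intro c hc
    have h1 := hd.complex_im.hasDerivWithinAt (s := Ioi x)
    rw [hasDerivWithinAt_iff_tendsto_slope' (by simp)] at h1
    refine tendsto_nhds_unique h1 (tendsto_const_nhds.congr' ?_)
    filter_upwards [hc, self_mem_nhdsWithin] with y hy hxy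
    have hxy' : y - x ≠ 0 := (sub_pos.2 hxy).ne'
    rw [slope_def_field, eq_div_iff hxy']
    linarith
  rcases lt_trichotomy (φ x) (V x).re with hlt | heq | hgt
  · left
    have hev : ∀ᶠ y : ℝ in 𝓝 x, φ y < (V y).re := hcφ.eventually_lt hcr.continuousAt hlt
    obtain ⟨ε, hε, hball⟩ := Metric.eventually_nhds_iff.1 (hev.and hIoo)
    rw [hgen θ, abs_neg, abs_of_pos h.θ_pos]
    filter_upwards [Ioo_mem_nhdsGT (show x < x + ε by linarith)] with y hy
    have hb : ∀ v : ℝ, v ∈ Icc x y → φ v < (V v).re ∧ v ∈ Ioo (-R) R := fun v hv => hball (by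
      rw [Real.dist_eq, abs_of_nonneg (by linarith [hv.1])]; linarith [hv.2, hy.2])
    exact (h.im_sub_eq (abs_lt.1 hxR).1 hy.1.le (hb y ⟨hy.1.le, le_rfl⟩).2.2).1
      fun v hv => (hb v hv).1
  · right
    have hxZ : x ∈ Z := ⟨hxR, heq.symm⟩
    have hne : (𝓝[Z ∩ Ioi x] x).NeBot := ⟨fun hbot => hx2 ⟨hxZ, hbot⟩⟩
    have h1 := (hd.complex_re.sub (h.obst_diff x hxR).hasDerivAt).hasDerivWithinAt
      (s := Z ∩ Ioi x)
    rw [hasDerivWithinAt_iff_tendsto_slope' (by simp)] at h1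
    have h2 := tendsto_nhds_unique h1 ((tendsto_const_nhds (x := (0 : ℝ))).congr' (by
      filter_upwards [self_mem_nhdsWithin] with y hy
      rw [slope_def_field]
      simp only [Pi.sub_apply, hy.1.2, hxZ.2, sub_self, zero_div]))
    linarith
  · left
    have hev : ∀ᶠ y : ℝ in 𝓝 x, (V y).re < φ y := hcr.continuousAt.eventually_lt hcφ hgt
    obtain ⟨ε, hε, hball⟩ := Metric.eventually_nhds_iff.1 (hev.and hIoo)
    rw [hgen (-θ), neg_neg, abs_of_pos h.θ_pos]
    filter_upwards [Ioo_mem_nhdsGT (show x < x + ε by linarith)] with y hy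
    have hb : ∀ v : ℝ, v ∈ Icc x y → (V v).re < φ v ∧ v ∈ Ioo (-R) R := fun v hv => hball (by
      rw [Real.dist_eq, abs_of_nonneg (by linarith [hv.1])]; linarith [hv.2, hy.2])
    exact (h.im_sub_eq (abs_lt.1 hxR).1 hy.1.le (hb y ⟨hy.1.le, le_rfl⟩).2.2).2
      fun v hv => (hb v hv).1

end LipschitzThinSolution

namespace LipschitzThinSolution

variable {R θ P L : ℝ} {V : ℂ → ℂ} {φ : ℝ → ℝ}

theorem norm_slope_le (h : LipschitzThinSolution R θ P L V φ) {τ : ℝ} (hτ : τ ≠ 0) (z : ℂ) :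
    ‖(V (z + τ) - V z) / τ‖ ≤ L := by
  rw [norm_div, Complex.norm_real, div_le_iff₀ (norm_pos_iff.2 hτ)]
  refine (h.lip _ _).trans (le_of_eq ?_)
  simp

theorem differentiableOn_slope (h : LipschitzThinSolution R θ P L V φ) {τ : ℝ} {U : Set ℂ}
    (hU : U ⊆ upperRect R) (hU' : ∀ z ∈ U, z + τ ∈ upperRect R) :
    DifferentiableOn ℂ (fun z => (V (z + τ) - V z) / τ) U :=
  (DifferentiableOn.sub (h.holo.comp (by fun_prop) hU') (h.holo.mono hU)).div_const _

theorem tendsto_slope (h : LipschitzThinSolution R θ P L V φ) {z : ℂ} (hz : z ∈ upperRect R) :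
    Tendsto (fun τ : ℝ => (V (z + τ) - V z) / τ) (𝓝[≠] 0) (𝓝 (deriv V z)) := by
  have h1 := (h.hasDerivAt hz).tendsto_slope_zero
  have h2 : Tendsto (fun τ : ℝ => (τ : ℂ)) (𝓝[≠] 0) (𝓝[≠] 0) := by
    refine tendsto_nhdsWithin_iff.2 ⟨?_, ?_⟩
    · exact (Complex.continuous_ofReal.tendsto' 0 0 (by simp)).mono_left nhdsWithin_le_nhds
    · filter_upwards [self_mem_nhdsWithin] with τ hτ
      simpa using hτ
  refine (h1.comp h2).congr fun τ => ?_
  simp [div_eq_inv_mul]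

theorem abs_im_slope_le (h : LipschitzThinSolution R θ P L V φ) {x τ : ℝ} (hτ : τ ≠ 0)
    (hx : |x| < R) (hx' : |x + τ| < R) : |((V (x + τ) - V x) / τ).im| ≤ θ := by
  have h1 := h.abs_im_sub_le hx' hx
  rw [Complex.div_ofReal_im, sub_im, abs_div, div_le_iff₀ (abs_pos.2 hτ)]
  simpa using h1

/-- The bound `|∂₂u| ≤ θ` persists up to a linear error above the flat boundary. -/
theorem abs_im_deriv_le (h : LipschitzThinSolution R θ P L V φ) {z : ℂ} (hz : |z.re| ≤ R / 2)
    (hz0 : 0 < z.im) (hz1 : z.im ≤ R / 4) : |(deriv V z).im| ≤ θ + 8 * L / R * z.im := by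
  have hR := h.R_pos
  have hL := h.L_nonneg
  have hzR : z ∈ upperRect R := ⟨by linarith, hz0, by linarith⟩
  have key : ∀ τ : ℝ, τ ≠ 0 → |τ| ≤ R / 8 → ∀ σ : ℝ, |σ| = 1 →
      σ * ((V (z + τ) - V z) / τ).im ≤ θ + 8 * L / R * z.im := by
    intro τ hτ hτR σ hσ
    have hmem : ∀ w ∈ upperHalfDisc z.re (R / 4), |w.re| < 3 * R / 4 ∧ 0 < w.im ∧
        w.im < R / 4 := by
      intro w hw
      have h1 := (Complex.abs_re_le_norm _).trans_lt hw.1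
      have h2 := (Complex.abs_im_le_norm _).trans_lt hw.1
      simp only [sub_re, ofReal_re, sub_im, ofReal_im, sub_zero] at h1 h2
      rw [abs_lt] at h1 h2 ⊢
      rw [abs_le] at hz
      exact ⟨⟨by linarith, by linarith⟩, hw.2, h2.2⟩
    have hc := h.continuous
    have hmp := halfDisc_max_principle (a := z.re) (r := R / 4) (by positivity)
      (w := fun w => σ * ((V (w + τ) - V w) / τ).im - θ
        - L / (R / 4) ^ 2 * ((w.re - z.re) ^ 2 - w.im ^ 2 + 2 * (R / 4) * w.im))
      (W := fun w => -I * σ * ((V (w + τ) - V w) / τ) - θ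
        - L / (R / 4) ^ 2 * ((w - z.re) ^ 2 - 2 * (R / 4) * I * w)) ?_ ?_ ?_ ?_ ?_
      z ⟨?_, hz0.le⟩
    · simp only [sub_self] at hmp
      have e : L / (R / 4) ^ 2 * (0 ^ 2 - z.im ^ 2 + 2 * (R / 4) * z.im) =
        8 * L / R * z.im - 16 * L / R ^ 2 * z.im ^ 2 := by field_simp; ring
      rw [e] at hmp
      have : 0 ≤ 16 * L / R ^ 2 * z.im ^ 2 := by positivity
      linarith
    · refine Continuous.continuousOn ?_
      have : Continuous fun w => ((V (w + τ) - V w) / τ).im :=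
        Complex.continuous_im.comp (by fun_prop)
      have h1 := Complex.continuous_re
      have h2 := Complex.continuous_im
      fun_prop
    · have := h.differentiableOn_slope (τ := τ) (U := upperHalfDisc z.re (R / 4))
        (fun w hw => ⟨by linarith [(hmem w hw).1], (hmem w hw).2.1, by linarith [(hmem w hw).2.2]⟩)
        (fun w hw => ⟨by
          rw [add_re, ofReal_re]
          linarith [(hmem w hw).1, abs_add_le w.re τ], by simpa using (hmem w hw).2.1, by
          simpa using (hmem w hw).2.2.trans (by linarith)⟩)
      refine ((this.const_mul _).sub_const _).sub ?_
      fun_prop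
    · intro w _
      have e1 : (L / (R / 4) ^ 2 * ((w - z.re) ^ 2 - 2 * (R / 4) * I * w) : ℂ) =
        ((L / (R / 4) ^ 2 : ℝ) : ℂ) * ((w - z.re) ^ 2 - 2 * ((R / 4 : ℝ) : ℂ) * I * w) := by
        push_cast; ring
      have e2 : (-I * σ * ((V (w + τ) - V w) / τ)).re = σ * ((V (w + τ) - V w) / τ).im := by
        rw [mul_assoc, mul_comm (σ : ℂ), ← mul_assoc, re_mul_ofReal]
        simp [mul_re, mul_comm]
      rw [e1, sub_re, sub_re, e2, re_ofReal_mul]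
      simp [pow_two]
    · intro x hx hpos
      exfalso
      have h1 : |x| < 3 * R / 4 := by
        rw [abs_lt] at hx ⊢; rw [abs_le] at hz
        exact ⟨by linarith, by linarith⟩
      have h2 := h.abs_im_slope_le hτ (x := x) (by linarith) (by linarith [abs_add_le x τ])
      have h3 : σ * ((V (x + τ) - V x) / τ).im ≤ θ := by
        refine (le_abs_self _).trans ?_
        rw [abs_mul, hσ, one_mul]; exact h2
      simp only [ofReal_re, ofReal_im] at hpos
      have : 0 ≤ L / (R / 4) ^ 2 * ((x - z.re) ^ 2 - 0 ^ 2 + 2 * (R / 4) * 0) := by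
        simp; positivity
      linarith
    · intro w hw hw0
      have h1 : σ * ((V (w + τ) - V w) / τ).im ≤ L := by
        refine (le_abs_self _).trans ?_
        rw [abs_mul, hσ, one_mul]
        exact (Complex.abs_im_le_norm _).trans (h.norm_slope_le hτ w)
      have h2 : (R / 4) ^ 2 = (w.re - z.re) ^ 2 + w.im ^ 2 := by
        rw [← hw, ← Complex.normSq_eq_norm_sq, Complex.normSq_apply]
        simp; ring
      have h3 : w.im ≤ R / 4 := by
        have := Complex.im_le_norm (w - z.re)
        simp only [sub_im, ofReal_im, sub_zero] at this
        linarith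
      have h4 : L ≤ L / (R / 4) ^ 2 * ((w.re - z.re) ^ 2 - w.im ^ 2 + 2 * (R / 4) * w.im) := by
        rw [div_mul_eq_mul_div, le_div_iff₀ (by positivity)]
        refine mul_le_mul_of_nonneg_left ?_ hL
        rw [h2]; nlinarith
      have := h.θ_pos
      linarith
    · have e : z - z.re = z.im * I := by
        apply Complex.ext <;> simp
      rw [e]; simpa [abs_of_pos hz0] using hz1
  have hlim := h.tendsto_slope hzR
  have hlim' : Tendsto (fun τ : ℝ => ((V (z + τ) - V z) / τ).im) (𝓝[≠] 0)
      (𝓝 (deriv V z).im) := (Complex.continuous_im.tendsto _).comp hlim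
  have hsmall : ∀ᶠ τ : ℝ in 𝓝[≠] 0, τ ≠ 0 ∧ |τ| ≤ R / 8 := by
    refine eventually_nhdsWithin_iff.2 ?_
    filter_upwards [Metric.closedBall_mem_nhds (0 : ℝ) (by positivity : 0 < R / 8)] with τ h1 h2
    exact ⟨h2, by simpa using h1⟩
  have hge : ∀ σ : ℝ, |σ| = 1 → σ * (deriv V z).im ≤ θ + 8 * L / R * z.im := fun σ hσ =>
    le_of_tendsto (hlim'.const_mul σ) (hsmall.mono fun τ hτ => key τ hτ.1 hτ.2 σ hσ)
  have h1 := hge 1 (by simp)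
  have h2 := hge (-1) (by simp)
  exact abs_le.2 ⟨by linarith, by linarith⟩

theorem norm_deriv_deriv_le (h : LipschitzThinSolution R θ P L V φ) {z : ℂ}
    (hz : |z.re| ≤ R / 4) (hz0 : 0 < z.im) (hz1 : z.im ≤ R / 8) :
    ‖deriv (deriv V) z‖ ≤
      4 * θ * |Real.cos (Real.pi / (2 * θ) * (deriv V z).im)| / z.im + 5 * (8 * L / R) := by
  have hR := h.R_pos
  have hθ := h.θ_pos
  have hL := h.L_nonneg
  set C := 8 * L / R with hC
  have hC0 : 0 ≤ C := by positivity
  have hball : ∀ w ∈ Metric.ball z (z.im / 2), |w.re| ≤ R / 2 ∧ 0 < w.im ∧ w.im ≤ R / 4 := by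
    intro w hw
    rw [Metric.mem_ball, dist_eq_norm] at hw
    have h1 := (Complex.abs_re_le_norm _).trans_lt hw
    have h2 := (Complex.abs_im_le_norm _).trans_lt hw
    simp only [sub_re, sub_im] at h1 h2
    rw [abs_lt] at h1 h2
    rw [abs_le] at hz ⊢
    exact ⟨⟨by linarith, by linarith⟩, by linarith, by linarith⟩
  have hzR : z ∈ upperRect R := ⟨by linarith, hz0, by linarith⟩
  have key : ∀ σ : ℝ, |σ| = 1 →
      ‖deriv (deriv V) z‖ ≤ 4 * (θ - σ * (deriv V z).im) / z.im + 5 * C := by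
    intro σ hσ
    have hre : ∀ w, (θ + I * σ * deriv V w - I * C * w : ℂ).re =
        θ - σ * (deriv V w).im + C * w.im := by
      intro w
      have e1 : (I * σ * deriv V w).re = -(σ * (deriv V w).im) := by
        rw [mul_comm I, mul_assoc, re_ofReal_mul]; simp
      have e2 : (I * C * w).re = -(C * w.im) := by
        rw [mul_comm I, mul_assoc, re_ofReal_mul]; simp
      rw [sub_re, add_re, e1, e2, ofReal_re]; ring
    have hd : HasDerivAt (fun w => (θ + I * σ * deriv V w - I * C * w : ℂ))
        (I * σ * deriv (deriv V) z - I * C) z := by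
      have := (((h.hasDerivAt_deriv hzR).const_mul (I * σ)).const_add (θ : ℂ)).sub
        ((hasDerivAt_id z).const_mul (I * (C : ℂ)))
      rw [mul_one] at this
      exact this
    have hL1 := norm_deriv_le_of_re_nonneg (W := fun w => (θ + I * σ * deriv V w - I * C * w : ℂ))
      (c := z) (r := z.im / 2) (by positivity) (fun w hw => by
        obtain ⟨h1, h2, h3⟩ := hball w hw
        have := (h.hasDerivAt_deriv (z := w) ⟨by linarith, h2, by linarith⟩).differentiableAt
        exact DifferentiableAt.differentiableWithinAt (by fun_prop)) (fun w hw => by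
        obtain ⟨h1, h2, h3⟩ := hball w hw
        rw [hre]
        have h4 := h.abs_im_deriv_le h1 h2 h3
        have h5 : σ * (deriv V w).im ≤ |(deriv V w).im| := by
          refine (le_abs_self _).trans ?_
          rw [abs_mul, hσ, one_mul]
        linarith)
    rw [hd.deriv, hre] at hL1
    have h6 : ‖deriv (deriv V) z‖ ≤ ‖I * σ * deriv (deriv V) z - I * C‖ + C := by
      have := norm_sub_norm_le (I * σ * deriv (deriv V) z) (I * C)
      rw [norm_mul, norm_mul, norm_mul, norm_I, one_mul, one_mul, norm_real, norm_real,
        Real.norm_eq_abs, Real.norm_eq_abs, hσ, one_mul, abs_of_nonneg hC0] at this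
      linarith
    have e : 2 * (θ - σ * (deriv V z).im + C * z.im) / (z.im / 2) =
      4 * (θ - σ * (deriv V z).im) / z.im + 4 * C := by field_simp; ring
    linarith
  have h1 : ‖deriv (deriv V) z‖ ≤ 4 * (θ - |(deriv V z).im|) / z.im + 5 * C := by
    rcases abs_cases (deriv V z).im with ⟨h2, _⟩ | ⟨h2, _⟩
    · rw [h2]; simpa using key 1 (by simp)
    · rw [h2]; simpa using key (-1) (by simp)
  have h2 : θ - |(deriv V z).im| ≤ θ * |Real.cos (Real.pi / (2 * θ) * (deriv V z).im)| := by
    rcases le_or_gt |(deriv V z).im| θ with hle | hgt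
    · have e : |Real.pi / (2 * θ) * (deriv V z).im| = Real.pi / (2 * θ) * |(deriv V z).im| := by
        rw [abs_mul, abs_of_pos (by positivity)]
      have h3 : Real.pi / (2 * θ) * |(deriv V z).im| ≤ Real.pi / 2 := by
        rw [div_mul_eq_mul_div, div_le_div_iff₀ (by positivity) (by positivity)]
        nlinarith [Real.pi_pos]
      have h4 := Real.one_sub_mul_le_cos (x := Real.pi / (2 * θ) * |(deriv V z).im|)
        (by positivity) h3
      rw [← e, Real.cos_abs] at h4
      have h5 := h4.trans (le_abs_self _)
      have h6 := mul_le_mul_of_nonneg_left h5 hθ.le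
      refine le_trans (le_of_eq ?_) h6
      rw [e]
      have := Real.pi_pos
      field_simp
    · have : 0 ≤ θ * |Real.cos (Real.pi / (2 * θ) * (deriv V z).im)| := by positivity
      linarith
  refine h1.trans (add_le_add_left (div_le_div_of_nonneg_right ?_ hz0.le) _)
  linarith

end LipschitzThinSolution

theorem norm_integral_le_of_rect {f : ℂ → ℂ} {r K : ℝ} (hr : 0 < r)
    (hc : ContinuousOn f (Icc (-r) r ×ℂ Icc 0 r)) (hd : DifferentiableOn ℂ f (Ioo (-r) r ×ℂ Ioo 0 r))
    (htop : ∀ x ∈ Icc (-r) r, ‖f (x + r * I)‖ ≤ K)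
    (hleft : ∀ y ∈ Icc 0 r, ‖f (-r + y * I)‖ ≤ K) (hright : ∀ y ∈ Icc 0 r, ‖f (r + y * I)‖ ≤ K) :
    ‖∫ x in (-r)..r, f x‖ ≤ 4 * r * K := by
  have hrr : -r ≤ r := by linarith
  have h := Complex.integral_boundary_rect_eq_zero_of_continuousOn_of_differentiableOn f
    ((-r : ℝ) : ℂ) (r + r * I) (by simpa [uIcc_of_le hrr, uIcc_of_le hr.le] using hc)
    (by simpa [min_eq_left hrr, max_eq_right hrr, min_eq_left hr.le, max_eq_right hr.le] using hd)
  simp only [ofReal_re, ofReal_im, add_re, mul_re, I_re, mul_zero, I_im, mul_one, sub_self,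
    add_zero, add_im, mul_im, zero_add, ofReal_zero, zero_mul, smul_eq_mul] at h
  have h1 : ‖∫ x in (-r)..r, f (x + r * I)‖ ≤ K * (2 * r) := by
    refine (intervalIntegral.norm_integral_le_of_norm_le_const (C := K) fun x hx => ?_).trans ?_
    · rw [uIoc_of_le hrr] at hx; exact htop x (Ioc_subset_Icc_self hx)
    · rw [abs_of_nonneg (by linarith)]; linarith
  have h2 : ‖∫ y in (0 : ℝ)..r, f (r + y * I)‖ ≤ K * r := by
    refine (intervalIntegral.norm_integral_le_of_norm_le_const (C := K) fun x hx => ?_).trans ?_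
    · rw [uIoc_of_le hr.le] at hx; exact hright x (Ioc_subset_Icc_self hx)
    · rw [sub_zero, abs_of_pos hr]
  have h3 : ‖∫ y in (0 : ℝ)..r, f ((-r : ℝ) + y * I)‖ ≤ K * r := by
    refine (intervalIntegral.norm_integral_le_of_norm_le_const (C := K) fun x hx => ?_).trans ?_
    · rw [uIoc_of_le hr.le] at hx
      push_cast; exact hleft x (Ioc_subset_Icc_self hx)
    · rw [sub_zero, abs_of_pos hr]
  have e : ∫ x in (-r)..r, f x = (∫ x in (-r)..r, f (x + r * I)) -
      I * (∫ y in (0 : ℝ)..r, f (r + y * I)) + I * ∫ y in (0 : ℝ)..r, f ((-r : ℝ) + y * I) := by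
    linear_combination h
  rw [e]
  refine (norm_add_le _ _).trans ?_
  have := norm_sub_le (∫ x in (-r)..r, f (x + r * I)) (I * (∫ y in (0 : ℝ)..r, f (r + y * I)))
  rw [norm_mul, norm_I, one_mul] at this ⊢
  linarith

theorem two_le_integral_poisson {r y : ℝ} (hy : 0 < y) (hyr : y ≤ r) :
    2 ≤ ∫ s in (-r)..r, 2 * y / (s ^ 2 + y ^ 2) := by
  have hpos : ∀ s : ℝ, 0 < s ^ 2 + y ^ 2 := fun s => by positivity
  have hc : Continuous fun s : ℝ => 2 * y / (s ^ 2 + y ^ 2) :=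
    Continuous.div (by fun_prop) (by fun_prop) fun s => (hpos s).ne'
  have h1 : (∫ s in (-y)..y, 2 * y / (s ^ 2 + y ^ 2)) ≤ ∫ s in (-r)..r, 2 * y / (s ^ 2 + y ^ 2) :=
    intervalIntegral.integral_mono_interval (by linarith) (by linarith) hyr
      (Eventually.of_forall fun s => by have := hpos s; simp only [Pi.zero_apply]; positivity)
      (hc.intervalIntegrable _ _)
  have h2 : ∫ s in (-y)..y, 1 / y ≤ ∫ s in (-y)..y, 2 * y / (s ^ 2 + y ^ 2) := by
    refine intervalIntegral.integral_mono_on (by linarith) (by simp) (hc.intervalIntegrable _ _)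
      fun s hs => ?_
    rw [div_le_div_iff₀ hy (hpos s)]
    nlinarith [abs_le.2 hs, sq_le_sq' hs.1 hs.2]
  rw [intervalIntegral.integral_const, smul_eq_mul] at h2
  have : (y - -y) * (1 / y) = 2 := by field_simp; ring
  linarith

/-- An interior derivative estimate for a bounded holomorphic function through the boundary values
of its real part. -/
theorem norm_deriv_le_integral_re {G : ℂ → ℂ} {r B y : ℝ} (hy : 0 < y) (hyr : y ≤ r / 64)
    (hc : ContinuousOn G (Icc (-r) r ×ℂ Icc 0 r))
    (hd : DifferentiableOn ℂ G (Ioo (-r) r ×ℂ Ioo 0 r))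
    (hB : ∀ w ∈ Icc (-r) r ×ℂ Icc 0 r, ‖G w‖ ≤ B) :
    ‖deriv G (y * I)‖ ≤ 2 * (∫ s in (-r)..r, |(G s).re| / (s ^ 2 + y ^ 2)) + 64 * B / r := by
  have hr : 0 < r := by linarith
  have hrr : -r ≤ r := by linarith
  set z : ℂ := y * I with hz
  set D := deriv G z with hD
  set zb : ℂ := -(y * I) with hzb
  have hconjz : (starRingEnd ℂ) z = zb := by simp [hz, hzb]
  have hzint : z ∈ Ioo (-r) r ×ℂ Ioo 0 r := by
    rw [Complex.mem_reProdIm]; simp [hz]; exact ⟨hr, hy, by linarith⟩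
  have hsub : Ioo (-r) r ×ℂ Ioo 0 r ⊆ Icc (-r) r ×ℂ Icc 0 r := fun w hw =>
    ⟨Ioo_subset_Icc_self hw.1, Ioo_subset_Icc_self hw.2⟩
  have hopen : IsOpen (Ioo (-r) r ×ℂ Ioo 0 r) := isOpen_Ioo.reProdIm isOpen_Ioo
  have hnhds : Ioo (-r) r ×ℂ Ioo 0 r ∈ 𝓝 z := hopen.mem_nhds hzint
  have hnhds' : Icc (-r) r ×ℂ Icc 0 r ∈ 𝓝 z := mem_of_superset hnhds hsub
  have hB0 : 0 ≤ B := (norm_nonneg _).trans (hB z (hsub hzint))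
  have hne : ∀ w ∈ Icc (-r) r ×ℂ Icc 0 r, w - zb ≠ 0 := by
    intro w hw h0
    have := congrArg Complex.im h0
    simp [hzb] at this
    linarith [hw.2.1]
  have hGz : ‖G z‖ ≤ B := hB z (hsub hzint)
  have hds : DifferentiableOn ℂ (dslope G z) (Ioo (-r) r ×ℂ Ioo 0 r) :=
    (Complex.differentiableOn_dslope hnhds).2 hd
  have hcs : ContinuousOn (dslope G z) (Icc (-r) r ×ℂ Icc 0 r) :=
    (continuousOn_dslope hnhds').2 ⟨hc, hd.differentiableAt hnhds⟩
  set E₂ : ℂ → ℂ := fun w => dslope (dslope G z) z w + D / (w - zb) with hE₂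
  set E₃ : ℂ → ℂ := fun w => (G w + (starRingEnd ℂ) (G z)) / (w - zb) ^ 2 with hE₃
  have hc₂ : ContinuousOn E₂ (Icc (-r) r ×ℂ Icc 0 r) :=
    ((continuousOn_dslope hnhds').2 ⟨hcs, hds.differentiableAt hnhds⟩).add
      (continuousOn_const.div (by fun_prop) hne)
  have hd₂ : DifferentiableOn ℂ E₂ (Ioo (-r) r ×ℂ Ioo 0 r) :=
    ((Complex.differentiableOn_dslope hnhds).2 hds).add
      ((differentiableOn_const _).div (by fun_prop) fun w hw => hne w (hsub hw))
  have hc₃ : ContinuousOn E₃ (Icc (-r) r ×ℂ Icc 0 r) :=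
    (hc.add continuousOn_const).div (by fun_prop) fun w hw => pow_ne_zero 2 (hne w hw)
  have hd₃ : DifferentiableOn ℂ E₃ (Ioo (-r) r ×ℂ Ioo 0 r) :=
    (hd.add (differentiableOn_const _)).div (by fun_prop) fun w hw => pow_ne_zero 2 (hne w (hsub hw))
  have hE₂' : ∀ w, w - z ≠ 0 → w - zb ≠ 0 →
      E₂ w = (G w - G z) / (w - z) ^ 2 - D * (2 * y * I) / ((w - z) * (w - zb)) := by
    intro w h1 h2
    have hwz : w ≠ z := sub_ne_zero.1 h1
    simp only [hE₂]
    rw [dslope_of_ne _ hwz, slope_def_field, dslope_of_ne _ hwz, slope_def_field, dslope_same]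
    have e : (2 * y * I : ℂ) = z - zb := by rw [hz, hzb]; ring
    rw [e]
    field_simp
    ring
  have hside : ∀ w ∈ Icc (-r) r ×ℂ Icc 0 r, r / 2 ≤ ‖w - z‖ → r / 2 ≤ ‖w - zb‖ →
      ‖E₂ w‖ ≤ 8 * B / r ^ 2 + ‖D‖ / (8 * r) ∧ ‖E₃ w‖ ≤ 8 * B / r ^ 2 := by
    intro w hw h1 h2
    have h1' : w - z ≠ 0 := norm_pos_iff.1 (by linarith)
    have hGw := hB w hw
    have hn1 : ‖(2 * y * I : ℂ)‖ = 2 * y := by simp [abs_of_pos hy]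
    have hden : ∀ a b : ℝ, r / 2 ≤ a → r / 2 ≤ b → r ^ 2 / 4 ≤ a * b := fun a b ha hb => by
      nlinarith
    constructor
    · rw [hE₂' w h1' (hne w hw)]
      refine (norm_sub_le _ _).trans (add_le_add ?_ ?_)
      · rw [norm_div, norm_pow, div_le_div_iff₀ (by positivity) (by positivity)]
        have := hden _ _ h1 h1
        have h3 : ‖G w - G z‖ ≤ 2 * B := (norm_sub_le _ _).trans (by linarith)
        calc ‖G w - G z‖ * r ^ 2 ≤ 2 * B * (4 * (‖w - z‖ * ‖w - z‖)) := by gcongr; linarith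
          _ = _ := by ring
      · rw [norm_div, norm_mul D, norm_mul (w - z), hn1,
          div_le_div_iff₀ (mul_pos (by linarith) (by linarith)) (by positivity)]
        have := hden _ _ h1 h2
        have h4 : 2 * y * (8 * r) ≤ ‖w - z‖ * ‖w - zb‖ := by nlinarith
        have := mul_le_mul_of_nonneg_left h4 (norm_nonneg D)
        linarith
    · simp only [hE₃]
      rw [norm_div, norm_pow, div_le_div_iff₀ (by have : 0 < ‖w - zb‖ := by linarith
                                                  positivity) (by positivity)]
      have := hden _ _ h2 h2
      have h3 : ‖G w + (starRingEnd ℂ) (G z)‖ ≤ 2 * B :=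
        (norm_add_le _ _).trans (by rw [Complex.norm_conj]; linarith)
      calc ‖G w + (starRingEnd ℂ) (G z)‖ * r ^ 2 ≤ 2 * B * (4 * (‖w - zb‖ * ‖w - zb‖)) := by
            gcongr; linarith
        _ = _ := by ring
  have htop : ∀ x ∈ Icc (-r) r, (x + r * I : ℂ) ∈ Icc (-r) r ×ℂ Icc 0 r ∧
      r / 2 ≤ ‖(x + r * I : ℂ) - z‖ ∧ r / 2 ≤ ‖(x + r * I : ℂ) - zb‖ := by
    intro x hx
    refine ⟨by rw [Complex.mem_reProdIm]; simp [hx.1, hx.2, hr.le],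
      le_trans ?_ (Complex.abs_im_le_norm _), le_trans ?_ (Complex.abs_im_le_norm _)⟩
    · simp [hz]; rw [abs_of_nonneg (by linarith)]; linarith
    · simp [hzb]; rw [abs_of_nonneg (by linarith)]; linarith
  have hlr : ∀ σ : ℝ, |σ| = r → ∀ t ∈ Icc 0 r, (σ + t * I : ℂ) ∈ Icc (-r) r ×ℂ Icc 0 r ∧
      r / 2 ≤ ‖(σ + t * I : ℂ) - z‖ ∧ r / 2 ≤ ‖(σ + t * I : ℂ) - zb‖ := by
    intro σ hσ t ht
    have := abs_le.1 hσ.le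
    refine ⟨by rw [Complex.mem_reProdIm]; simpa [ht.1, ht.2] using this,
      le_trans ?_ (Complex.abs_re_le_norm _), le_trans ?_ (Complex.abs_re_le_norm _)⟩
    · simp [hz, hσ]; linarith
    · simp [hzb, hσ]; linarith
  have hright := hlr r (abs_of_pos hr)
  have hleft := hlr (-r) (by rw [abs_neg, abs_of_pos hr])
  push_cast at hleft
  have hI₂ := norm_integral_le_of_rect hr hc₂ hd₂
    (fun x hx => (hside _ (htop x hx).1 (htop x hx).2.1 (htop x hx).2.2).1)
    (fun x hx => (hside _ (hleft x hx).1 (hleft x hx).2.1 (hleft x hx).2.2).1)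
    (fun x hx => (hside _ (hright x hx).1 (hright x hx).2.1 (hright x hx).2.2).1)
  have hI₃ := norm_integral_le_of_rect hr hc₃ hd₃
    (fun x hx => (hside _ (htop x hx).1 (htop x hx).2.1 (htop x hx).2.2).2)
    (fun x hx => (hside _ (hleft x hx).1 (hleft x hx).2.1 (hleft x hx).2.2).2)
    (fun x hx => (hside _ (hright x hx).1 (hright x hx).2.1 (hright x hx).2.2).2)
  have hreal : ∀ s ∈ Icc (-r) r, (s : ℂ) ∈ Icc (-r) r ×ℂ Icc 0 r := fun s hs => by
    rw [Complex.mem_reProdIm]; simpa [hr.le] using hs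
  have hcomp : ∀ f : ℂ → ℂ, ContinuousOn f (Icc (-r) r ×ℂ Icc 0 r) →
      ContinuousOn (fun s : ℝ => f s) (uIcc (-r) r) := fun f hf => by
    rw [uIcc_of_le hrr]
    exact hf.comp Complex.continuous_ofReal.continuousOn fun s hs => hreal s hs
  have hpos : ∀ s : ℝ, 0 < s ^ 2 + y ^ 2 := fun s => by positivity
  have hszn : ∀ s : ℝ, (s : ℂ) - z ≠ 0 ∧ (s : ℂ) - zb ≠ 0 := fun s => by
    constructor <;> intro h0 <;> have := congrArg Complex.im h0 <;> simp [hz, hzb] at this <;>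
      exact hy.ne' this
  have hprod : ∀ s : ℝ, ((s : ℂ) - z) * (s - zb) = ((s ^ 2 + y ^ 2 : ℝ) : ℂ) := fun s => by
    rw [hz, hzb]; push_cast
    linear_combination (-(y : ℂ) ^ 2) * I_sq
  have hbot : ∀ s : ℝ, E₂ s + (starRingEnd ℂ) (E₃ s) =
      2 * ((G s).re : ℂ) / ((s : ℂ) - z) ^ 2 - D * I * ((2 * y / (s ^ 2 + y ^ 2) : ℝ) : ℂ) := by
    intro s
    have hcj : (starRingEnd ℂ) ((s : ℂ) - zb) = s - z := by simp [hzb, hz, sub_eq_add_neg]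
    have h2 : (2 * ((G s).re : ℂ)) = G s + (starRingEnd ℂ) (G s) := (Complex.add_conj _).symm ▸ by
      push_cast; ring
    have h3 : ((s ^ 2 + y ^ 2 : ℝ) : ℂ) ≠ 0 := by exact_mod_cast (hpos s).ne'
    rw [hE₂' _ (hszn s).1 (hszn s).2, hprod, h2]
    simp only [hE₃]
    rw [map_div₀, map_pow, hcj, map_add, Complex.conj_conj]
    have := (hszn s).1
    rw [Complex.ofReal_div]
    push_cast at h3 ⊢
    field_simp
    ring
  have hi₂ := (hcomp _ hc₂).intervalIntegrable (μ := volume)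
  have hi₃ : IntervalIntegrable (fun s : ℝ => (starRingEnd ℂ) (E₃ s)) volume (-r) r :=
    (Complex.continuous_conj.comp_continuousOn (hcomp _ hc₃)).intervalIntegrable
  have hcp : Continuous fun s : ℝ => 2 * y / (s ^ 2 + y ^ 2) :=
    Continuous.div (by fun_prop) (by fun_prop) fun s => (hpos s).ne'
  have hiq : IntervalIntegrable (fun s : ℝ => D * I * ((2 * y / (s ^ 2 + y ^ 2) : ℝ) : ℂ))
      volume (-r) r :=
    (continuous_const.mul (Complex.continuous_ofReal.comp hcp)).intervalIntegrable _ _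
  have hip : IntervalIntegrable (fun s : ℝ => 2 * ((G s).re : ℂ) / ((s : ℂ) - z) ^ 2)
      volume (-r) r := by
    refine ContinuousOn.intervalIntegrable (ContinuousOn.div ?_ ?_ fun s _ =>
      pow_ne_zero 2 (hszn s).1)
    · exact continuousOn_const.mul (Complex.continuous_ofReal.comp_continuousOn
        (Complex.continuous_re.comp_continuousOn (hcomp _ hc)))
    · fun_prop
  have hsum : (∫ s in (-r)..r, E₂ s) + (starRingEnd ℂ) (∫ s in (-r)..r, E₃ s) =
      (∫ s in (-r)..r, 2 * ((G s).re : ℂ) / ((s : ℂ) - z) ^ 2) -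
        D * I * ((∫ s in (-r)..r, 2 * y / (s ^ 2 + y ^ 2) : ℝ) : ℂ) := by
    have e1 : (starRingEnd ℂ) (∫ s in (-r)..r, E₃ s) =
        ∫ s in (-r)..r, (starRingEnd ℂ) (E₃ s) := by
      rw [intervalIntegral.integral_of_le hrr, intervalIntegral.integral_of_le hrr, integral_conj]
    rw [e1, ← intervalIntegral.integral_add hi₂ hi₃, ← intervalIntegral.integral_ofReal,
      ← intervalIntegral.integral_const_mul, ← intervalIntegral.integral_sub hip hiq]
    exact intervalIntegral.integral_congr fun s _ => hbot s
  have hJ : ‖∫ s in (-r)..r, 2 * ((G s).re : ℂ) / ((s : ℂ) - z) ^ 2‖ ≤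
      2 * ∫ s in (-r)..r, |(G s).re| / (s ^ 2 + y ^ 2) := by
    rw [← intervalIntegral.integral_const_mul]
    refine (intervalIntegral.norm_integral_le_integral_norm hrr).trans (le_of_eq ?_)
    refine intervalIntegral.integral_congr fun s _ => ?_
    have hsz : ‖(s : ℂ) - z‖ ^ 2 = s ^ 2 + y ^ 2 := by
      rw [← Complex.normSq_eq_norm_sq, Complex.normSq_apply]; simp [hz]; ring
    simp only [norm_div, norm_mul, norm_pow, hsz, Complex.norm_real, Real.norm_eq_abs]
    rw [Complex.norm_ofNat]; ring
  set Q := ∫ s in (-r)..r, 2 * y / (s ^ 2 + y ^ 2) with hQ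
  have hQ2 : 2 ≤ Q := two_le_integral_poisson hy (by linarith)
  have hfin : ‖D‖ * Q ≤ 2 * (∫ s in (-r)..r, |(G s).re| / (s ^ 2 + y ^ 2)) +
      (4 * r * (8 * B / r ^ 2 + ‖D‖ / (8 * r)) + 4 * r * (8 * B / r ^ 2)) := by
    have e : D * I * (Q : ℂ) = (∫ s in (-r)..r, 2 * ((G s).re : ℂ) / ((s : ℂ) - z) ^ 2) -
        ((∫ s in (-r)..r, E₂ s) + (starRingEnd ℂ) (∫ s in (-r)..r, E₃ s)) := by
      rw [hsum]; ring
    have e' : ‖D‖ * Q = ‖D * I * (Q : ℂ)‖ := by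
      rw [norm_mul, norm_mul, norm_I, mul_one, Complex.norm_real, Real.norm_of_nonneg (by linarith)]
    rw [e', e]
    refine (norm_sub_le _ _).trans (add_le_add hJ ((norm_add_le _ _).trans (add_le_add hI₂ ?_)))
    rwa [Complex.norm_conj]
  have e1 : 4 * r * (8 * B / r ^ 2 + ‖D‖ / (8 * r)) + 4 * r * (8 * B / r ^ 2) =
      64 * B / r + ‖D‖ / 2 := by field_simp; ring
  rw [e1] at hfin
  nlinarith [norm_nonneg D]

theorem Complex.re_sinh (z : ℂ) : (Complex.sinh z).re = Real.sinh z.re * Real.cos z.im := by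
  rw [Complex.sinh, Complex.div_ofNat_re, sub_re, exp_re, exp_re, Real.sinh_eq]
  simp
  ring

theorem Complex.re_cosh (z : ℂ) : (Complex.cosh z).re = Real.cosh z.re * Real.cos z.im := by
  rw [Complex.cosh, Complex.div_ofNat_re, add_re, exp_re, exp_re, Real.cosh_eq]
  simp
  ring

theorem Complex.abs_cos_im_le_norm_cosh (z : ℂ) : |Real.cos z.im| ≤ ‖Complex.cosh z‖ := by
  refine le_trans ?_ (Complex.abs_re_le_norm _)
  rw [Complex.re_cosh, abs_mul, abs_of_pos (Real.cosh_pos _)]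
  exact le_mul_of_one_le_left (abs_nonneg _) (Real.one_le_cosh _)

theorem Complex.norm_sinh_le_exp_norm (z : ℂ) : ‖Complex.sinh z‖ ≤ Real.exp ‖z‖ := by
  rw [Complex.sinh, norm_div, Complex.norm_ofNat]
  have h1 := Complex.norm_exp_le_exp_norm z
  have h2 := Complex.norm_exp_le_exp_norm (-z)
  rw [norm_neg] at h2
  have := norm_sub_le (Complex.exp z) (Complex.exp (-z))
  linarith

theorem Real.abs_sinh_le (t : ℝ) : |Real.sinh t| ≤ |t| * Real.exp |t| := by
  have key : ∀ s : ℝ, 0 ≤ s → Real.sinh s ≤ s * Real.exp s := by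
    intro s hs
    have h1 := Real.add_one_le_exp (-(2 * s))
    have h2 : Real.exp (-s) = Real.exp s * Real.exp (-(2 * s)) := by
      rw [← Real.exp_add]; ring_nf
    rw [Real.sinh_eq, h2]
    nlinarith [Real.exp_pos s]
  rw [Real.abs_sinh]
  exact key _ (abs_nonneg _)

namespace LipschitzThinSolution

variable {R θ P L : ℝ} {V : ℂ → ℂ} {φ : ℝ → ℝ}

theorem norm_trace_deriv_le (h : LipschitzThinSolution R θ P L V φ) (x : ℝ) :
    ‖deriv (fun x : ℝ => V x) x‖ ≤ L := by
  have hlip : LipschitzWith L.toNNReal (fun x : ℝ => V x) := LipschitzWith.of_dist_le_mul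
    fun z w => by
      rw [dist_eq_norm, dist_eq_norm, Real.coe_toNNReal _ h.L_nonneg]
      refine (h.lip z w).trans (le_of_eq ?_)
      rw [← ofReal_sub, Complex.norm_real]
  have := norm_deriv_le_of_lipschitz (x₀ := x) hlip
  rwa [Real.coe_toNNReal _ h.L_nonneg] at this

theorem abs_re_sinh_trace_le (h : LipschitzThinSolution R θ P L V φ) {x s : ℝ} (hx : |x| < R)
    (hs : |x + s| < R) (hs1 : |s| ≤ 1) {f : ℂ} (hf : |f.im| = θ ∨ f.re = deriv φ (x + s)) :
    |(Complex.sinh (((Real.pi / (2 * θ) : ℝ) : ℂ) * (f - deriv φ x))).re| ≤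
      Real.pi / (2 * θ) * P * Real.exp (Real.pi / (2 * θ) * P) *
        (|s| * |Real.cos (Real.pi / (2 * θ) * f.im)|) := by
  have hθ := h.θ_pos
  have hP := h.P_nonneg
  have hpi := Real.pi_pos
  set κ := Real.pi / (2 * θ) with hκ
  have hκ0 : 0 < κ := by positivity
  rw [Complex.re_sinh, re_ofReal_mul, im_ofReal_mul, sub_re, sub_im, ofReal_re, ofReal_im, sub_zero,
    abs_mul]
  rcases hf with hf | hf
  · have : Real.cos (κ * f.im) = 0 := by
      rw [← Real.cos_abs, abs_mul, hf, abs_of_pos hκ0]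
      have : κ * θ = Real.pi / 2 := by rw [hκ]; field_simp
      rw [this, Real.cos_pi_div_two]
    rw [this]; simp
  · rw [← mul_assoc]
    refine mul_le_mul_of_nonneg_right ((Real.abs_sinh_le _).trans ?_) (abs_nonneg _)
    have h1 := h.obst_deriv_lip (x + s) x hs hx
    rw [add_sub_cancel_left] at h1
    rw [abs_mul, abs_of_pos hκ0, hf]
    have h2 : P * |s| ≤ P := mul_le_of_le_one_right hP hs1
    calc κ * |deriv φ (x + s) - deriv φ x| * Real.exp (κ * |deriv φ (x + s) - deriv φ x|)
        ≤ κ * (P * |s|) * Real.exp (κ * P) := by gcongr; linarith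
      _ = _ := by ring

/-- The Cauchy estimate for `sinh (κ (V' - c))`, whose real part vanishes to first order on the
flat boundary when `c` is the slope of the obstacle. -/
theorem norm_deriv_deriv_mul_cos_le (h : LipschitzThinSolution R θ P L V φ) {x₀ y r : ℝ}
    (hx₀ : |x₀| ≤ R / 4) (hr : 0 < r) (hrR : r ≤ R / 4) (hy : 0 < y) (hyr : y ≤ r / 64) :
    Real.pi / (2 * θ) * (‖deriv (deriv V) (x₀ + y * I)‖ *
      |Real.cos (Real.pi / (2 * θ) * (deriv V (x₀ + y * I)).im)|) ≤
    2 * (Real.pi / (2 * θ) * P * Real.exp (Real.pi / (2 * θ) * P) * ∫ s in (-r)..r,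
      |s| * |Real.cos (Real.pi / (2 * θ) * (deriv (fun x : ℝ => V x) (x₀ + s)).im)| /
        (s ^ 2 + y ^ 2)) + 64 * Real.exp (Real.pi / (2 * θ) * (L + P)) / r := by
  have hθ := h.θ_pos
  have hP := h.P_nonneg
  have hL := h.L_nonneg
  have hR := h.R_pos
  have hR1 := h.R_le
  have hpi := Real.pi_pos
  have hVc := h.continuous
  set κ := Real.pi / (2 * θ) with hκ
  have hκ0 : 0 < κ := by positivity
  set c := deriv φ x₀ with hc
  set f : ℝ → ℂ := deriv (fun x : ℝ => V x) with hf
  set B := Real.exp (κ * (L + P)) with hB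
  have hcP : |c| ≤ P := h.obst_deriv_le x₀ (by linarith)
  have hrr : -r ≤ r := by linarith
  have hpos : ∀ s : ℝ, 0 < s ^ 2 + y ^ 2 := fun s => by positivity
  have hden : ∀ s : ℝ, y ^ 2 ≤ s ^ 2 + y ^ 2 := fun s => by nlinarith [sq_nonneg s]
  have hsinh : ∀ g : ℂ, ‖g‖ ≤ L → ‖Complex.sinh ((κ : ℂ) * (g - c))‖ ≤ B := by
    intro g hg
    refine (Complex.norm_sinh_le_exp_norm _).trans (Real.exp_le_exp.2 ?_)
    rw [norm_mul, Complex.norm_real, Real.norm_of_nonneg hκ0.le]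
    refine mul_le_mul_of_nonneg_left ((norm_sub_le _ _).trans (add_le_add hg ?_)) hκ0.le
    rwa [Complex.norm_real]
  set z : ℂ := x₀ + y * I with hz
  have hzR : z ∈ upperRect R := ⟨by simp [hz]; linarith, by simpa [hz] using hy, by
    simp [hz]; linarith⟩
  set S : ℝ → ℂ → ℂ := fun τ w => (V (w + τ) - V w) / τ with hS
  set G : ℝ → ℂ → ℂ := fun τ w => Complex.sinh (κ * (S τ (x₀ + w) - c)) with hG
  have hsmall : ∀ᶠ τ : ℝ in 𝓝[≠] 0, τ ≠ 0 ∧ |τ| ≤ R / 4 := by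
    refine eventually_nhdsWithin_iff.2 ?_
    filter_upwards [Metric.closedBall_mem_nhds (0 : ℝ) (by positivity : 0 < R / 4)] with τ h1 h2
    exact ⟨h2, by simpa using h1⟩
  have hGc : ∀ τ : ℝ, Continuous (G τ) := fun τ => by
    simp only [hG, hS]
    exact Complex.continuous_sinh.comp (by fun_prop)
  have hGB : ∀ τ : ℝ, τ ≠ 0 → ∀ w, ‖G τ w‖ ≤ B := fun τ hτ w => hsinh _ (h.norm_slope_le hτ _)
  have hmem : ∀ w ∈ Ioo (-r) r ×ℂ Ioo 0 r, ∀ τ : ℝ, |τ| ≤ R / 4 →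
      (x₀ + w + τ : ℂ) ∈ upperRect R := by
    intro w hw τ hτ
    have h1 := abs_lt.2 hw.1
    refine ⟨?_, by simpa using hw.2.1, by simpa using hw.2.2.trans (by linarith)⟩
    simp only [add_re, ofReal_re]
    have h2 := abs_add_le (x₀ + w.re) τ
    have h3 := abs_add_le x₀ w.re
    linarith
  have hcauchy : ∀ᶠ τ : ℝ in 𝓝[≠] 0, ‖deriv (G τ) (y * I)‖ ≤
      2 * (∫ s in (-r)..r, |(G τ s).re| / (s ^ 2 + y ^ 2)) + 64 * B / r := by
    filter_upwards [hsmall] with τ hτ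
    refine norm_deriv_le_integral_re hy hyr (hGc τ).continuousOn ?_ fun w _ => hGB τ hτ.1 w
    have hSd : DifferentiableOn ℂ (fun w => S τ (x₀ + w)) (Ioo (-r) r ×ℂ Ioo 0 r) := by
      refine (h.differentiableOn_slope (τ := τ) (U := (fun w : ℂ => (x₀ : ℂ) + w) ''
        (Ioo (-r) r ×ℂ Ioo 0 r)) ?_ ?_).comp (by fun_prop) (mapsTo_image _ _)
      · rintro _ ⟨w, hw, rfl⟩
        simpa using hmem w hw 0 (by rw [abs_zero]; positivity)
      · rintro _ ⟨w, hw, rfl⟩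
        exact hmem w hw τ hτ.2
    exact Complex.differentiable_sinh.comp_differentiableOn
      (DifferentiableOn.const_mul (hSd.sub_const _) _)
  have hlimL : Tendsto (fun τ : ℝ => deriv (G τ) (y * I)) (𝓝[≠] 0)
      (𝓝 (Complex.cosh (κ * (deriv V z - c)) * (κ * deriv (deriv V) z))) := by
    have hS1 : Tendsto (fun τ : ℝ => S τ z) (𝓝[≠] 0) (𝓝 (deriv V z)) := h.tendsto_slope hzR
    have hS2 : Tendsto (fun τ : ℝ => (deriv V (z + τ) - deriv V z) / τ) (𝓝[≠] 0)
        (𝓝 (deriv (deriv V) z)) := by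
      have h2 : Tendsto (fun τ : ℝ => (τ : ℂ)) (𝓝[≠] 0) (𝓝[≠] 0) := by
        refine tendsto_nhdsWithin_iff.2 ⟨?_, ?_⟩
        · exact (Complex.continuous_ofReal.tendsto' 0 0 (by simp)).mono_left nhdsWithin_le_nhds
        · filter_upwards [self_mem_nhdsWithin] with τ hτ
          simpa using hτ
      refine ((h.hasDerivAt_deriv hzR).tendsto_slope_zero.comp h2).congr fun τ => ?_
      simp [div_eq_inv_mul]
    have hmain : Tendsto (fun τ : ℝ => Complex.cosh (κ * (S τ z - c)) *
        (κ * ((deriv V (z + τ) - deriv V z) / τ))) (𝓝[≠] 0)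
        (𝓝 (Complex.cosh (κ * (deriv V z - c)) * (κ * deriv (deriv V) z))) :=
      ((Complex.continuous_cosh.tendsto _).comp ((hS1.sub_const _).const_mul _)).mul
        (hS2.const_mul _)
    refine hmain.congr' ?_
    filter_upwards [hsmall] with τ hτ
    have hyI : (y * I : ℂ) ∈ Ioo (-r) r ×ℂ Ioo 0 r := by
      rw [Complex.mem_reProdIm]; simp; exact ⟨hr, hy, by linarith⟩
    have hzτ : z + τ ∈ upperRect R := hmem _ hyI τ hτ.2
    have d1 : HasDerivAt (fun w : ℂ => V (x₀ + w + τ)) (deriv V (z + τ)) (y * I) := by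
      have := (h.hasDerivAt hzτ).comp (y * I : ℂ)
        (((hasDerivAt_id (y * I : ℂ)).const_add (x₀ : ℂ)).add_const (τ : ℂ))
      rw [mul_one] at this
      exact this
    have d2 : HasDerivAt (fun w : ℂ => V (x₀ + w)) (deriv V z) (y * I) := by
      have := (h.hasDerivAt hzR).comp (y * I : ℂ) ((hasDerivAt_id (y * I : ℂ)).const_add (x₀ : ℂ))
      rw [mul_one] at this
      exact this
    exact ((((d1.sub d2).div_const (τ : ℂ)).sub_const (c : ℂ)).const_mul (κ : ℂ)).csinh.deriv.symm
  have hae : ∀ᵐ s : ℝ, |x₀ + s| < R → HasDerivAt (fun x : ℝ => V x) (f (x₀ + s)) (x₀ + s) ∧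
      (|(f (x₀ + s)).im| = θ ∨ (f (x₀ + s)).re = deriv φ (x₀ + s)) := by
    filter_upwards [(quasiMeasurePreserving_add_left volume x₀).ae h.ae_trace] with s hs hsR
    obtain ⟨g, hg, hg'⟩ := hs hsR
    have : f (x₀ + s) = g := hg.deriv
    rw [this]
    exact ⟨hg, hg'⟩
  have hin : ∀ s ∈ uIoc (-r) r, |s| ≤ R / 4 ∧ |x₀ + s| < R := by
    intro s hs
    rw [uIoc_of_le hrr] at hs
    have h1 : |s| ≤ R / 4 := (abs_le.2 ⟨hs.1.le, hs.2⟩).trans hrR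
    exact ⟨h1, by linarith [abs_add_le x₀ s]⟩
  have hlimR : Tendsto (fun τ : ℝ => ∫ s in (-r)..r, |(G τ s).re| / (s ^ 2 + y ^ 2)) (𝓝[≠] 0)
      (𝓝 (∫ s in (-r)..r, |(Complex.sinh (κ * (f (x₀ + s) - c))).re| / (s ^ 2 + y ^ 2))) := by
    refine intervalIntegral.tendsto_integral_filter_of_dominated_convergence
      (fun _ => B / y ^ 2) ?_ ?_ intervalIntegrable_const ?_
    · refine Eventually.of_forall fun τ => Continuous.aestronglyMeasurable ?_
      refine Continuous.div ?_ (by fun_prop) fun s => (hpos s).ne'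
      exact (Complex.continuous_re.comp ((hGc τ).comp Complex.continuous_ofReal)).abs
    · filter_upwards [hsmall] with τ hτ
      refine Eventually.of_forall fun s _ => ?_
      rw [norm_div, Real.norm_eq_abs, abs_abs, Real.norm_of_nonneg (hpos s).le]
      have := (Complex.abs_re_le_norm _).trans (hGB τ hτ.1 s)
      exact div_le_div₀ (Real.exp_pos _).le this (by positivity) (hden s)
    · filter_upwards [hae] with s hs hs'
      have h1 := (hs (hin s hs').2).1.tendsto_slope_zero
      have h2 : Tendsto (fun τ : ℝ => S τ (x₀ + s)) (𝓝[≠] 0) (𝓝 (f (x₀ + s))) := by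
        refine h1.congr fun τ => ?_
        simp [hS, div_eq_inv_mul]
      have h3 : Tendsto (fun τ : ℝ => G τ s) (𝓝[≠] 0)
          (𝓝 (Complex.sinh (κ * (f (x₀ + s) - c)))) :=
        (Complex.continuous_sinh.tendsto _).comp ((h2.sub_const _).const_mul _)
      exact (((Complex.continuous_re.tendsto _).comp h3).abs).div_const _
  have hlim := le_of_tendsto_of_tendsto hlimL.norm ((hlimR.const_mul 2).add_const (64 * B / r))
    hcauchy
  have hfm : Measurable fun s : ℝ => f (x₀ + s) :=
    (measurable_deriv _).comp (measurable_const_add x₀)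
  have hu_int : ∀ g : ℝ → ℝ, Measurable g → (∀ s, |s| ≤ r → |g s| ≤ B + 1) →
      IntervalIntegrable (fun s => g s / (s ^ 2 + y ^ 2)) volume (-r) r := by
    intro g hg hgB
    rw [intervalIntegrable_iff, uIoc_of_le hrr]
    refine IntegrableOn.of_bound measure_Ioc_lt_top ?_ ((B + 1) / y ^ 2) ?_
    · exact (hg.div (by fun_prop)).aestronglyMeasurable
    · refine (ae_restrict_iff' measurableSet_Ioc).2 (Eventually.of_forall fun s hs => ?_)
      rw [norm_div, Real.norm_of_nonneg (hpos s).le, Real.norm_eq_abs]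
      have := Real.exp_pos (κ * (L + P))
      exact div_le_div₀ (by linarith) (hgB s (abs_le.2 ⟨hs.1.le, hs.2⟩)) (by positivity) (hden s)
  have hB0 : 0 < B := Real.exp_pos _
  have hi1 := hu_int (fun s => |(Complex.sinh (κ * (f (x₀ + s) - c))).re|) (by
    have : Measurable fun s : ℝ => (Complex.sinh (κ * (f (x₀ + s) - c))).re :=
      Complex.measurable_re.comp (Complex.continuous_sinh.measurable.comp
        ((hfm.sub_const _).const_mul _))
    exact this.norm) (fun s _ => by
      rw [abs_abs]
      have := (Complex.abs_re_le_norm _).trans (hsinh _ (h.norm_trace_deriv_le (x₀ + s)))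
      linarith)
  have hi2 := hu_int (fun s => |s| * |Real.cos (κ * (f (x₀ + s)).im)|) (by
    have : Measurable fun s : ℝ => Real.cos (κ * (f (x₀ + s)).im) :=
      Real.measurable_cos.comp ((Complex.measurable_im.comp hfm).const_mul _)
    exact measurable_id.norm.mul this.norm) (fun s hs => by
      rw [abs_mul, abs_abs, abs_abs]
      have h1 := Real.abs_cos_le_one (κ * (f (x₀ + s)).im)
      have h2 : |s| ≤ 1 := by linarith
      nlinarith [abs_nonneg s, abs_nonneg (Real.cos (κ * (f (x₀ + s)).im))])
  have hmono : (∫ s in (-r)..r, |(Complex.sinh (κ * (f (x₀ + s) - c))).re| / (s ^ 2 + y ^ 2)) ≤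
      κ * P * Real.exp (κ * P) * ∫ s in (-r)..r,
        |s| * |Real.cos (κ * (f (x₀ + s)).im)| / (s ^ 2 + y ^ 2) := by
    rw [← intervalIntegral.integral_const_mul]
    refine intervalIntegral.integral_mono_ae_restrict hrr hi1 (hi2.const_mul _) ?_
    refine (ae_restrict_iff' measurableSet_Icc).2 ?_
    filter_upwards [hae] with s hs hs'
    have h1 : |s| ≤ R / 4 := (abs_le.2 hs').trans hrR
    have h2 : |x₀ + s| < R := by linarith [abs_add_le x₀ s]
    rw [← mul_div_assoc]
    exact div_le_div_of_nonneg_right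
      (h.abs_re_sinh_trace_le (by linarith) h2 (by linarith) (hs h2).2) (hpos s).le
  have hcos := Complex.abs_cos_im_le_norm_cosh (κ * (deriv V z - c))
  rw [im_ofReal_mul, sub_im, ofReal_im, sub_zero] at hcos
  rw [norm_mul, norm_mul, Complex.norm_real, Real.norm_of_nonneg hκ0.le] at hlim
  have : κ * (‖deriv (deriv V) z‖ * |Real.cos (κ * (deriv V z).im)|) ≤
      ‖Complex.cosh (κ * (deriv V z - c))‖ * (κ * ‖deriv (deriv V) z‖) := by
    have := mul_le_mul_of_nonneg_right hcos
      (mul_nonneg hκ0.le (norm_nonneg (deriv (deriv V) z)))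
    linarith
  linarith

end LipschitzThinSolution

namespace LipschitzThinSolution

variable {R θ P L : ℝ} {V : ℂ → ℂ} {φ : ℝ → ℝ}

/-- Hardy–Littlewood: growth of `V''` controls the oscillation of `V'`. -/
theorem norm_deriv_sub_le (h : LipschitzThinSolution R θ P L V φ) {γ C ρ : ℝ} (hγ : 0 < γ)
    (hC : 0 ≤ C) (hρR : ρ < R)
    (hV : ∀ z : ℂ, |z.re| ≤ ρ → 0 < z.im → z.im ≤ ρ → ‖deriv (deriv V) z‖ ≤ C * z.im ^ (γ - 1))
    {z w : ℂ} {η : ℝ} (hη : η ≤ ρ) (hz : |z.re| ≤ ρ) (hw : |w.re| ≤ ρ) (hz0 : 0 < z.im)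
    (hw0 : 0 < w.im) (hzη : z.im ≤ η) (hwη : w.im ≤ η) (hzw : |z.re - w.re| ≤ η) :
    ‖deriv V z - deriv V w‖ ≤ (2 / γ + 1) * C * η ^ γ := by
  have hη0 : 0 < η := by linarith
  have hvert : ∀ x t : ℝ, |x| ≤ ρ → 0 < t → t ≤ η →
      ‖deriv V (x + η * I) - deriv V (x + t * I)‖ ≤ C / γ * η ^ γ := by
    intro x t hx ht htη
    have hmem : ∀ s ∈ Icc t η, (x + s * I : ℂ) ∈ upperRect R := fun s hs =>
      ⟨by simp; linarith, by simp; linarith [hs.1], by simp; linarith [hs.2]⟩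
    have := norm_sub_le_of_deriv_le (f := fun s : ℝ => deriv V (x + s * I))
      (f' := fun s => deriv (deriv V) (x + s * I) * I) (B := fun s => C / γ * s ^ γ)
      (B' := fun s => C / γ * (γ * s ^ (γ - 1))) htη
      (fun s hs => ThinSolution.hasDerivAt_vertical (h.hasDerivAt_deriv (hmem s hs)))
      (fun s hs => (Real.hasDerivAt_rpow_const (Or.inl (ht.trans_le hs.1).ne')).const_mul _)
      (fun s hs => by
        have := hV (x + s * I) (by simpa using hx) (by simpa using ht.trans_le hs.1)
          (by simpa using hs.2.trans hη)
        rw [norm_mul, norm_I, mul_one]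
        refine this.trans (le_of_eq ?_)
        simp
        field_simp)
    refine this.trans ?_
    have : 0 ≤ C / γ * t ^ γ := by positivity
    linarith
  have hhor : ‖deriv V (z.re + η * I) - deriv V (w.re + η * I)‖ ≤ C * η ^ γ := by
    have hsub : ∀ x ∈ Icc (-ρ) ρ, (x + η * I : ℂ) ∈ upperRect R := fun x hx =>
      ⟨by simp; linarith [abs_le.2 hx], by simpa using hη0, by simp; linarith⟩
    have := (convex_Icc (-ρ) ρ).norm_image_sub_le_of_norm_hasDerivWithin_le
      (f := fun x : ℝ => deriv V (x + η * I)) (f' := fun x => deriv (deriv V) (x + η * I))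
      (C := C * η ^ (γ - 1)) (fun x hx => by
        have h1 : HasDerivAt (fun v : ℂ => deriv V (v + η * I))
            (deriv (deriv V) (x + η * I)) (x : ℂ) := by
          have := (h.hasDerivAt_deriv (hsub x hx)).comp (x : ℂ)
            ((hasDerivAt_id (x : ℂ)).add_const (η * I : ℂ))
          rw [mul_one] at this
          exact this
        exact h1.comp_ofReal.hasDerivWithinAt)
      (fun x hx => by
        have := hV (x + η * I) (by simpa using abs_le.2 hx) (by simpa using hη0) (by simpa using hη)
        simpa using this) (abs_le.1 hw) (abs_le.1 hz)
    refine this.trans ?_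
    have e : η ^ γ = η ^ (γ - 1) * η := by
      rw [← Real.rpow_add_one hη0.ne']; ring_nf
    rw [e, ← mul_assoc, Real.norm_eq_abs]
    exact mul_le_mul_of_nonneg_left hzw (by positivity)
  have h1 := hvert z.re z.im hz hz0 hzη
  have h2 := hvert w.re w.im hw hw0 hwη
  rw [re_add_im] at h1 h2
  have e : deriv V z - deriv V w = -(deriv V (z.re + η * I) - deriv V z) +
      (deriv V (z.re + η * I) - deriv V (w.re + η * I)) +
      (deriv V (w.re + η * I) - deriv V w) := by ring
  rw [e]
  refine (norm_add₃_le).trans ?_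
  rw [norm_neg]
  calc _ ≤ C / γ * η ^ γ + C * η ^ γ + C / γ * η ^ γ := by linarith
    _ = _ := by field_simp; ring

theorem norm_sub_sub_le (h : LipschitzThinSolution R θ P L V φ) {γ C ρ : ℝ} (hγ : 0 < γ)
    (hC : 0 ≤ C) (hρR : ρ < R)
    (hV : ∀ z : ℂ, |z.re| ≤ ρ → 0 < z.im → z.im ≤ ρ → ‖deriv (deriv V) z‖ ≤ C * z.im ^ (γ - 1))
    {w : ℂ} {η x y : ℝ} (hη : η ≤ ρ) (hx : |x| ≤ ρ) (hy : |y| ≤ ρ) (hw : |w.re| ≤ ρ)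
    (hw0 : 0 < w.im) (hwη : w.im ≤ η) (hxw : |x - w.re| ≤ η) (hyw : |y - w.re| ≤ η) :
    ‖V x - V y - (x - y) * deriv V w‖ ≤ (2 / γ + 1) * C * η ^ γ * |x - y| := by
  have hη0 : 0 < η := by linarith
  have hVc := h.continuous
  have key : ∀ t : ℝ, 0 < t → t ≤ η → ‖V (x + t * I) - V (y + t * I) - (x - y) * deriv V w‖ ≤
      (2 / γ + 1) * C * η ^ γ * |x - y| := by
    intro t ht htη
    set s := Icc (-ρ) ρ ∩ Icc (w.re - η) (w.re + η) with hs
    have hxs : ∀ v : ℝ, |v| ≤ ρ → |v - w.re| ≤ η → v ∈ s := fun v h1 h2 =>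
      ⟨abs_le.1 h1, by rw [abs_le] at h2; constructor <;> linarith⟩
    have := ((convex_Icc (-ρ) ρ).inter (convex_Icc (w.re - η)
        (w.re + η))).norm_image_sub_le_of_norm_hasDerivWithin_le
      (f := fun v : ℝ => V (v + t * I) - (v : ℂ) * deriv V w)
      (f' := fun v => deriv V (v + t * I) - deriv V w)
      (C := (2 / γ + 1) * C * η ^ γ) (fun v hv => by
        have hm : (v + t * I : ℂ) ∈ upperRect R :=
          ⟨by simp; linarith [abs_le.2 hv.1], by simpa using ht, by simp; linarith⟩
        have h1 : HasDerivAt (fun a : ℂ => V (a + t * I) - a * deriv V w)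
            (deriv V (v + t * I) - deriv V w) (v : ℂ) := by
          have := ((h.hasDerivAt hm).comp (v : ℂ)
            ((hasDerivAt_id (v : ℂ)).add_const (t * I : ℂ))).sub
            ((hasDerivAt_id (v : ℂ)).mul_const (deriv V w))
          rw [mul_one, one_mul] at this
          exact this
        exact h1.comp_ofReal.hasDerivWithinAt)
      (fun v hv => by
        refine h.norm_deriv_sub_le hγ hC hρR hV hη ?_ hw ?_ hw0 ?_ hwη ?_
        · simpa using abs_le.2 hv.1
        · simpa using ht
        · simpa using htη
        · have := hv.2
          simp only [add_re, ofReal_re, mul_re, I_re, mul_zero, ofReal_im, I_im, mul_one, sub_self,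
            add_zero]
          exact abs_le.2 ⟨by linarith [this.1], by linarith [this.2]⟩)
      (hxs y hy hyw) (hxs x hx hxw)
    rw [Real.norm_eq_abs] at this
    refine le_trans (le_of_eq ?_) this
    congr 1
    ring
  have hlim : Tendsto (fun t : ℝ => ‖V (x + t * I) - V (y + t * I) - (x - y) * deriv V w‖)
      (𝓝[>] 0) (𝓝 ‖V x - V y - (x - y) * deriv V w‖) := by
    have : Continuous fun t : ℝ => ‖V (x + t * I) - V (y + t * I) - (x - y) * deriv V w‖ := by
      fun_prop
    refine (this.tendsto' 0 _ ?_).mono_left nhdsWithin_le_nhds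
    simp
  refine le_of_tendsto hlim ?_
  filter_upwards [Ioo_mem_nhdsGT hη0] with t ht
  exact key t ht.1 ht.2.le

/-- `V'` extends continuously to the real axis, with values the derivative of the trace of `V`. -/
theorem exists_hasDerivAt_trace (h : LipschitzThinSolution R θ P L V φ) {γ C ρ : ℝ} (hγ : 0 < γ)
    (hC : 0 ≤ C) (hρ : 0 < ρ) (hρR : ρ < R)
    (hV : ∀ z : ℂ, |z.re| ≤ ρ → 0 < z.im → z.im ≤ ρ → ‖deriv (deriv V) z‖ ≤ C * z.im ^ (γ - 1))
    {x : ℝ} (hx : |x| < ρ) :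
    DifferentiableAt ℝ (fun x : ℝ => V x) x ∧ ∀ (w : ℂ) (η : ℝ), η ≤ ρ → |w.re| ≤ ρ → 0 < w.im →
      w.im ≤ η → |x - w.re| ≤ η →
      ‖deriv (fun x : ℝ => V x) x - deriv V w‖ ≤ (2 / γ + 1) * C * η ^ γ := by
  have hA : 0 ≤ (2 / γ + 1) * C := by positivity
  set A := (2 / γ + 1) * C with hAdef
  have hosc : ∀ (w : ℂ) (η : ℝ), η ≤ ρ → |w.re| ≤ ρ → 0 < w.im → w.im ≤ η → |x - w.re| ≤ η →
      ∀ t : ℝ, 0 < t → t ≤ η → ‖deriv V (x + t * I) - deriv V w‖ ≤ A * η ^ γ := by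
    intro w η hη hw hw0 hwη hxw t ht htη
    exact h.norm_deriv_sub_le hγ hC hρR hV hη (by simpa using hx.le) hw (by simpa using ht) hw0
      (by simpa using htη) hwη (by simpa using hxw)
  have hpow0 : Tendsto (fun t : ℝ => A * t ^ γ) (𝓝 0) (𝓝 0) := by
    have := (Real.continuousAt_rpow_const 0 γ (Or.inr hγ.le)).tendsto.const_mul A
    rwa [Real.zero_rpow hγ.ne', mul_zero] at this
  have hcauchy : Cauchy (map (fun t : ℝ => deriv V (x + t * I)) (𝓝[>] 0)) := by
    refine Metric.cauchy_iff.2 ⟨inferInstance, fun ε hε => ?_⟩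
    have h1 : ∀ᶠ t : ℝ in 𝓝[>] 0, A * t ^ γ < ε :=
      (hpow0.mono_left nhdsWithin_le_nhds).eventually (gt_mem_nhds hε)
    obtain ⟨η, hη1, hη2⟩ := (h1.and (Ioo_mem_nhdsGT hρ)).exists
    refine ⟨_, image_mem_map (Ioo_mem_nhdsGT hη2.1), ?_⟩
    rintro _ ⟨t, ht, rfl⟩ _ ⟨s, hs, rfl⟩
    rw [dist_eq_norm]
    refine (hosc (x + s * I) η hη2.2.le (by simpa using hx.le) (by simpa using hs.1)
      (by simpa using hs.2.le) (by simpa using hη2.1.le) t ht.1 ht.2.le).trans_lt hη1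
  obtain ⟨F, hF⟩ := CompleteSpace.complete hcauchy
  have hF : Tendsto (fun t : ℝ => deriv V (x + t * I)) (𝓝[>] 0) (𝓝 F) := hF
  have hFw : ∀ (w : ℂ) (η : ℝ), η ≤ ρ → |w.re| ≤ ρ → 0 < w.im → w.im ≤ η → |x - w.re| ≤ η →
      ‖F - deriv V w‖ ≤ A * η ^ γ := by
    intro w η hη hw hw0 hwη hxw
    refine le_of_tendsto (hF.sub_const _).norm ?_
    filter_upwards [Ioo_mem_nhdsGT (hw0.trans_le hwη)] with t ht
    exact hosc w η hη hw hw0 hwη hxw t ht.1 ht.2.le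
  have hderiv : HasDerivAt (fun x : ℝ => V x) F x := by
    rw [hasDerivAt_iff_isLittleO, Asymptotics.isLittleO_iff]
    intro c hc
    have h1 : Tendsto (fun y : ℝ => 2 * (A * |y - x| ^ γ)) (𝓝 x) (𝓝 (2 * 0)) := by
      refine Tendsto.const_mul 2 (hpow0.comp ?_)
      exact Continuous.tendsto' (by fun_prop) _ _ (by simp)
    rw [mul_zero] at h1
    have h2 : ∀ᶠ y in 𝓝 x, |y| < ρ := continuous_abs.continuousAt.eventually (gt_mem_nhds hx)
    have h3 : ∀ᶠ y in 𝓝 x, |y - x| < ρ :=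
      ((continuous_id.sub continuous_const).abs).continuousAt.eventually
        (gt_mem_nhds (by simpa using hρ))
    filter_upwards [h1.eventually (gt_mem_nhds hc), h2, h3] with y hy1 hy2 hy3
    rcases eq_or_ne y x with rfl | hne
    · simp
    have hη0 : 0 < |y - x| := abs_pos.2 (sub_ne_zero.2 hne)
    set η := |y - x| with hη
    have hw : (x + η * I : ℂ).re = x ∧ (x + η * I : ℂ).im = η := by simp
    have e1 := h.norm_sub_sub_le hγ hC hρR hV (w := x + η * I) (η := η) (x := y) (y := x)
      hy3.le hy2.le hx.le (by rw [hw.1]; exact hx.le) (by rw [hw.2]; exact hη0) (by rw [hw.2])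
      (by rw [hw.1]) (by rw [hw.1]; simpa using hη0.le)
    have e2 := hFw (x + η * I) η hy3.le (by rw [hw.1]; exact hx.le) (by rw [hw.2]; exact hη0)
      (by rw [hw.2]) (by rw [hw.1]; simpa using hη0.le)
    have e : V y - V x - (y - x) • F = (V y - V x - (y - x) * deriv V (x + η * I)) -
        (y - x) * (F - deriv V (x + η * I)) := by
      rw [Complex.real_smul]; push_cast; ring
    rw [e, Real.norm_eq_abs]
    refine (norm_sub_le _ _).trans ?_
    rw [norm_mul ((y : ℂ) - x), ← ofReal_sub, Complex.norm_real, Real.norm_eq_abs, ← hη]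
    have e3 := mul_le_mul_of_nonneg_left e2 hη0.le
    rw [ofReal_sub]
    have e4 := mul_le_mul_of_nonneg_right hy1.le hη0.le
    linarith
  rw [hderiv.deriv]
  exact ⟨hderiv.differentiableAt, hFw⟩

end LipschitzThinSolution

theorem intervalIntegrable_abs_rpow {p : ℝ} (hp : -1 < p) {r : ℝ} (hr : 0 ≤ r) :
    IntervalIntegrable (fun s : ℝ => |s| ^ p) volume (-r) r := by
  have h1 : IntervalIntegrable (fun s : ℝ => |s| ^ p) volume 0 r := by
    refine (intervalIntegral.intervalIntegrable_rpow' (a := 0) (b := r) hp).congr ?_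
    intro s hs
    rw [uIoc_of_le hr] at hs
    simp only [abs_of_pos hs.1]
  refine IntervalIntegrable.trans (b := 0) ?_ h1
  have h3 := ((IntervalIntegrable.iff_comp_neg (by simp)).1 h1).symm
  simpa using h3

theorem integral_weight_le {g : ℝ → ℝ} {r y a b : ℝ} (hr : 0 < r) (hy : 0 < y) (ha : 0 ≤ a)
    (hb : 0 ≤ b) (hg0 : ∀ s, 0 ≤ g s) (hg : ∀ s, |s| ≤ r → g s ≤ a + b * (|s| + y) ^ (1 / 4 : ℝ)) :
    ∫ s in (-r)..r, |s| * g s / (s ^ 2 + y ^ 2) ≤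
      2 * (a * y ^ (-(1 / 2) : ℝ) * (∫ s in (-r)..r, |s| ^ (-(1 / 2) : ℝ)) +
        b * ∫ s in (-r)..r, |s| ^ (-(3 / 4) : ℝ)) := by
  have hrr : -r ≤ r := by linarith
  have i1 := intervalIntegrable_abs_rpow (p := -(1 / 2)) (by norm_num) hr.le
  have i2 := intervalIntegrable_abs_rpow (p := -(3 / 4)) (by norm_num) hr.le
  have hi := ((i1.const_mul (a * y ^ (-(1 / 2) : ℝ))).add (i2.const_mul b)).const_mul 2
  rw [← intervalIntegral.integral_const_mul, ← intervalIntegral.integral_const_mul,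
    ← intervalIntegral.integral_add (i1.const_mul _) (i2.const_mul _),
    ← intervalIntegral.integral_const_mul, intervalIntegral.integral_of_le hrr,
    intervalIntegral.integral_of_le hrr]
  rw [intervalIntegrable_iff_integrableOn_Ioc_of_le hrr] at hi
  refine integral_mono_of_nonneg (Eventually.of_forall fun s => ?_) hi ?_
  · have := hg0 s
    simp only [Pi.zero_apply]
    positivity
  · refine (ae_restrict_iff' measurableSet_Ioc).2 (Eventually.of_forall fun s hs => ?_)
    have hs' : |s| ≤ r := abs_le.2 ⟨hs.1.le, hs.2⟩
    simp only
    rcases eq_or_ne s 0 with rfl | hs0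
    · simp only [abs_zero, zero_mul, zero_div]
      positivity
    have hsp : 0 < |s| := abs_pos.2 hs0
    set t := |s| with ht
    have hst : s ^ 2 = t ^ 2 := (sq_abs s).symm
    rw [hst]
    have hσ : 0 < t + y := by positivity
    have h1 : t / (t ^ 2 + y ^ 2) ≤ 2 * (t + y) ^ (-1 : ℝ) := by
      rw [Real.rpow_neg_one, ← div_eq_mul_inv, div_le_div_iff₀ (by positivity) hσ]
      nlinarith [sq_nonneg (t - y)]
    have h2 : (t + y) ^ (-1 : ℝ) ≤ y ^ (-(1 / 2) : ℝ) * t ^ (-(1 / 2) : ℝ) := by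
      have e : (t + y) ^ (-1 : ℝ) = (t + y) ^ (-(1 / 2) : ℝ) * (t + y) ^ (-(1 / 2) : ℝ) := by
        rw [← Real.rpow_add hσ]; norm_num
      rw [e]
      have e1 := Real.rpow_le_rpow_of_nonpos hy (by linarith : y ≤ t + y)
        (by norm_num : (-(1 / 2) : ℝ) ≤ 0)
      have e2 := Real.rpow_le_rpow_of_nonpos hsp (by linarith : t ≤ t + y)
        (by norm_num : (-(1 / 2) : ℝ) ≤ 0)
      gcongr
    have h3 : (t + y) ^ (-1 : ℝ) * (t + y) ^ (1 / 4 : ℝ) ≤ t ^ (-(3 / 4) : ℝ) := by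
      rw [← Real.rpow_add hσ]
      norm_num
      exact Real.rpow_le_rpow_of_nonpos hsp (by linarith : t ≤ t + y)
        (by norm_num : (-(3 / 4) : ℝ) ≤ 0)
    have hgs := hg s hs'
    calc t * g s / (t ^ 2 + y ^ 2) = t / (t ^ 2 + y ^ 2) * g s := by ring
      _ ≤ 2 * (t + y) ^ (-1 : ℝ) * (a + b * (t + y) ^ (1 / 4 : ℝ)) :=
          mul_le_mul h1 hgs (hg0 s) (by positivity)
      _ = 2 * (a * (t + y) ^ (-1 : ℝ) + b * ((t + y) ^ (-1 : ℝ) * (t + y) ^ (1 / 4 : ℝ))) := by ring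
      _ ≤ 2 * (a * (y ^ (-(1 / 2) : ℝ) * t ^ (-(1 / 2) : ℝ)) + b * t ^ (-(3 / 4) : ℝ)) := by
          gcongr
      _ = _ := by ring

theorem le_of_sq_le_add_mul {N A b p : ℝ} (hA : 0 ≤ A) (hb : 0 ≤ b) (hp : 1 ≤ p)
    (h : N * N ≤ A * (p * p) + b * N) : N ≤ (A + b + 1) * p := by
  by_contra! hlt
  have h1 : (A + 1) * p ≤ N - b := by nlinarith
  have h2 : p ≤ N := by nlinarith [mul_nonneg (add_nonneg hA hb) (zero_le_one.trans hp)]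
  have h3 : (A + 1) * p * p ≤ (N - b) * N := by
    have : 0 ≤ (A + 1) * p := by positivity
    exact mul_le_mul h1 h2 (by linarith) (by linarith)
  nlinarith

/-- The constant in the Cauchy estimate on an interval of radius `r`. -/
noncomputable def cauchyConst (θ P L r : ℝ) : ℝ :=
  (4 * (Real.pi / (2 * θ) * P * Real.exp (Real.pi / (2 * θ) * P)) *
    ((∫ s in (-r)..r, |s| ^ (-(1 / 2) : ℝ)) + ∫ s in (-r)..r, |s| ^ (-(3 / 4) : ℝ)) +
    64 * Real.exp (Real.pi / (2 * θ) * (L + P)) / r) / (Real.pi / (2 * θ))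

theorem integral_abs_rpow_nonneg (p : ℝ) {r : ℝ} (hr : 0 < r) :
    0 ≤ ∫ s in (-r)..r, |s| ^ p :=
  intervalIntegral.integral_nonneg (by linarith) fun s _ => by positivity

theorem cauchyConst_nonneg {θ P L r : ℝ} (hθ : 0 < θ) (hP : 0 ≤ P) (hr : 0 < r) :
    0 ≤ cauchyConst θ P L r := by
  have h1 := integral_abs_rpow_nonneg (-(1 / 2)) hr
  have h2 := integral_abs_rpow_nonneg (-(3 / 4)) hr
  have := Real.pi_pos
  unfold cauchyConst
  positivity

namespace LipschitzThinSolution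

variable {R θ P L : ℝ} {V : ℂ → ℂ} {φ : ℝ → ℝ}

theorem norm_deriv_deriv_mul_cos_le_of_trace (h : LipschitzThinSolution R θ P L V φ)
    {x₀ y r a b : ℝ} (hx₀ : |x₀| ≤ R / 4) (hr : 0 < r) (hrR : r ≤ R / 4) (hy : 0 < y)
    (hyr : y ≤ r / 64) (ha : 0 ≤ a) (hb : 0 ≤ b)
    (htr : ∀ s : ℝ, |s| ≤ r →
      |Real.cos (Real.pi / (2 * θ) * (deriv (fun x : ℝ => V x) (x₀ + s)).im)| ≤
        a + b * (|s| + y) ^ (1 / 4 : ℝ)) :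
    ‖deriv (deriv V) (x₀ + y * I)‖ * |Real.cos (Real.pi / (2 * θ) * (deriv V (x₀ + y * I)).im)| ≤
      cauchyConst θ P L r * (a * y ^ (-(1 / 2) : ℝ) + b + 1) := by
  have hθ := h.θ_pos
  have hP := h.P_nonneg
  have hpi := Real.pi_pos
  have h1 := h.norm_deriv_deriv_mul_cos_le hx₀ hr hrR hy hyr
  have h2 := integral_weight_le hr hy ha hb (fun s => abs_nonneg _) htr
  unfold cauchyConst
  have j1 := integral_abs_rpow_nonneg (-(1 / 2)) hr
  have j2 := integral_abs_rpow_nonneg (-(3 / 4)) hr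
  set J₁ := ∫ s in (-r)..r, |s| ^ (-(1 / 2) : ℝ)
  set J₂ := ∫ s in (-r)..r, |s| ^ (-(3 / 4) : ℝ)
  have hκ : 0 < Real.pi / (2 * θ) := by positivity
  have hH : 0 ≤ Real.pi / (2 * θ) * P * Real.exp (Real.pi / (2 * θ) * P) := by positivity
  have hB : 0 ≤ 64 * Real.exp (Real.pi / (2 * θ) * (L + P)) / r := by positivity
  set κ := Real.pi / (2 * θ)
  set H := κ * P * Real.exp (κ * P)
  set B := 64 * Real.exp (κ * (L + P)) / r
  have hq : 0 ≤ y ^ (-(1 / 2) : ℝ) := by positivity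
  set q := y ^ (-(1 / 2) : ℝ)
  rw [show (4 * H * (J₁ + J₂) + B) / κ * (a * q + b + 1) =
    ((4 * H * (J₁ + J₂) + B) * (a * q + b + 1)) / κ by ring, le_div_iff₀ hκ, mul_comm _ κ]
  refine h1.trans ?_
  have h3 := mul_le_mul_of_nonneg_left h2 hH
  have haq : 0 ≤ a * q := by positivity
  have h4 : 0 ≤ 4 * (H * (a * q) * J₂ + H * b * J₁ + H * J₁ + H * J₂) + B * (a * q) + B * b := by
    positivity
  have h5 : (4 * H * (J₁ + J₂) + B) * (a * q + b + 1) = 2 * (H * (2 * (a * q * J₁ + b * J₂))) + B +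
    (4 * (H * (a * q) * J₂ + H * b * J₁ + H * J₁ + H * J₂) + B * (a * q) + B * b) := by ring
  linarith

theorem norm_deriv_deriv_le_quarter (h : LipschitzThinSolution R θ P L V φ) {z : ℂ}
    (hz : |z.re| ≤ R / 256) (hz0 : 0 < z.im) (hz1 : z.im ≤ R / 256) :
    ‖deriv (deriv V) z‖ ≤
      (8 * θ * cauchyConst θ P L (R / 4) + 5 * (8 * L / R) + 1) * z.im ^ ((1 / 4 : ℝ) - 1) := by
  have hR := h.R_pos
  have hR1 := h.R_le
  have hθ := h.θ_pos
  have hL := h.L_nonneg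
  have hK := cauchyConst_nonneg (L := L) hθ h.P_nonneg (by positivity : 0 < R / 4)
  set K := cauchyConst θ P L (R / 4)
  have hE1 := h.norm_deriv_deriv_le (z := z) (by linarith) hz0 (by linarith)
  have hE2 := h.norm_deriv_deriv_mul_cos_le_of_trace (x₀ := z.re) (y := z.im) (r := R / 4) (a := 1)
    (b := 0) (by linarith) (by linarith) le_rfl hz0 (by linarith) zero_le_one le_rfl
    (fun s _ => by simpa using Real.abs_cos_le_one _)
  rw [re_add_im] at hE2
  set N := ‖deriv (deriv V) z‖ with hN
  have hN0 : 0 ≤ N := norm_nonneg _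
  set cc := |Real.cos (Real.pi / (2 * θ) * (deriv V z).im)|
  have hy1 : z.im ≤ 1 := by linarith
  have hq1 : 1 ≤ z.im ^ (-(1 / 2) : ℝ) := Real.one_le_rpow_of_pos_of_le_one_of_nonpos hz0 hy1
    (by norm_num)
  have hp1 : 1 ≤ z.im ^ ((1 / 4 : ℝ) - 1) := Real.one_le_rpow_of_pos_of_le_one_of_nonpos hz0 hy1
    (by norm_num)
  refine le_of_sq_le_add_mul (by positivity) (by positivity) hp1 ?_
  have e : z.im ^ ((1 / 4 : ℝ) - 1) * z.im ^ ((1 / 4 : ℝ) - 1) = z.im ^ (-(1 / 2) : ℝ) / z.im := by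
    rw [← Real.rpow_add hz0, div_eq_mul_inv (z.im ^ _), ← Real.rpow_neg_one z.im,
      ← Real.rpow_add hz0]
    norm_num
  rw [e]
  set q := z.im ^ (-(1 / 2) : ℝ)
  have h1 : N * cc ≤ 2 * K * q := by nlinarith
  have h2 := mul_le_mul_of_nonneg_right hE1 hN0
  have h3 : 4 * θ * (N * cc) / z.im ≤ 4 * θ * (2 * K * q) / z.im := by gcongr
  calc N * N ≤ 4 * θ * (N * cc) / z.im + 5 * (8 * L / R) * N := by
        refine h2.trans (le_of_eq ?_); ring
    _ ≤ _ := by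
        have : 4 * θ * (2 * K * q) / z.im = 8 * θ * K * (q / z.im) := by ring
        linarith

theorem exists_norm_deriv_deriv_le_half {R θ P L : ℝ} (hR : 0 < R) (hθ : 0 < θ) (hP : 0 ≤ P)
    (hL : 0 ≤ L) : ∃ C, 0 ≤ C ∧ ∀ V φ, LipschitzThinSolution R θ P L V φ → ∀ z : ℂ,
      |z.re| ≤ R / 65536 → 0 < z.im → z.im ≤ R / 65536 →
      ‖deriv (deriv V) z‖ ≤ C * z.im ^ ((1 / 2 : ℝ) - 1) := by
  set C₁ := 8 * θ * cauchyConst θ P L (R / 4) + 5 * (8 * L / R) + 1 with hC₁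
  have hK₁ := cauchyConst_nonneg (L := L) hθ hP (by positivity : 0 < R / 4)
  have hK := cauchyConst_nonneg (L := L) hθ hP (by positivity : 0 < R / 1024)
  have hC₁0 : 0 ≤ C₁ := by positivity
  have hpi := Real.pi_pos
  set K := cauchyConst θ P L (R / 1024) with hKdef
  set κ := Real.pi / (2 * θ) with hκ
  have hκ0 : 0 < κ := by positivity
  set b := κ * (9 * C₁) with hb
  have hb0 : 0 ≤ b := by positivity
  refine ⟨2 * K + (8 * θ * K * (b + 1) + 5 * (8 * L / R) + 1), by positivity,
    fun V φ h z hz hz0 hz1 => ?_⟩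
  have hR1 := h.R_le
  have htr : ∀ s : ℝ, |s| ≤ R / 1024 →
      |Real.cos (κ * (deriv (fun x : ℝ => V x) (z.re + s)).im)| ≤
        |Real.cos (κ * (deriv V z).im)| + b * (|s| + z.im) ^ (1 / 4 : ℝ) := by
    intro s hs
    have hx : |z.re + s| < R / 256 := (abs_add_le _ _).trans_lt (by linarith)
    have h1 := (h.exists_hasDerivAt_trace (γ := 1 / 4) (ρ := R / 256) (by norm_num) hC₁0
      (by positivity) (by linarith) (fun z h1 h2 h3 => h.norm_deriv_deriv_le_quarter h1 h2 h3)
      hx).2 z (|s| + z.im) (by linarith) (by linarith) hz0 (by linarith [abs_nonneg s])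
      (by simpa using hz0.le)
    have h2 : (2 / (1 / 4 : ℝ) + 1) = 9 := by norm_num
    rw [h2] at h1
    have h3 := (Complex.abs_im_le_norm _).trans h1
    rw [sub_im] at h3
    have h4 : |Real.cos (κ * (deriv (fun x : ℝ => V x) (z.re + s)).im) -
        Real.cos (κ * (deriv V z).im)| ≤ κ * (9 * C₁ * (|s| + z.im) ^ (1 / 4 : ℝ)) := by
      refine (Real.abs_cos_sub_cos_le _ _).trans ?_
      rw [← mul_sub, abs_mul, abs_of_pos hκ0]
      exact mul_le_mul_of_nonneg_left h3 hκ0.le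
    have h5 := abs_sub_abs_le_abs_sub (Real.cos (κ * (deriv (fun x : ℝ => V x) (z.re + s)).im))
      (Real.cos (κ * (deriv V z).im))
    rw [hb]
    linarith
  have hE1 := h.norm_deriv_deriv_le (z := z) (by linarith) hz0 (by linarith)
  have hE2 := h.norm_deriv_deriv_mul_cos_le_of_trace (x₀ := z.re) (y := z.im) (r := R / 1024)
    (by linarith) (by linarith) (by linarith) hz0 (by linarith) (abs_nonneg _) hb0 htr
  rw [re_add_im] at hE2
  set N := ‖deriv (deriv V) z‖ with hN
  have hN0 : 0 ≤ N := norm_nonneg _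
  have hcc0 : 0 ≤ |Real.cos (κ * (deriv V z).im)| := abs_nonneg _
  set cc := |Real.cos (κ * (deriv V z).im)|
  have eq : ((1 / 2 : ℝ) - 1) = -(1 / 2) := by norm_num
  rw [eq]
  have hq1 : 1 ≤ z.im ^ (-(1 / 2) : ℝ) := Real.one_le_rpow_of_pos_of_le_one_of_nonpos hz0
    (by linarith) (by norm_num)
  have e : z.im ^ (-(1 / 2) : ℝ) * z.im ^ (-(1 / 2) : ℝ) = 1 / z.im := by
    rw [← Real.rpow_add hz0, one_div z.im, ← Real.rpow_neg_one z.im]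
    norm_num
  set q := z.im ^ (-(1 / 2) : ℝ)
  rw [add_mul]
  rcases le_or_gt N (2 * K * q) with hle | hgt
  · have : 0 ≤ (8 * θ * K * (b + 1) + 5 * (8 * L / R) + 1) * q := by positivity
    linarith
  · have h1 : N * cc ≤ 2 * K * (b + 1) := by nlinarith [mul_le_mul_of_nonneg_right hgt.le hcc0]
    have h0 : 0 ≤ 2 * K * q := by positivity
    refine le_add_of_nonneg_of_le h0 ?_
    refine le_of_sq_le_add_mul (by positivity) (by positivity) hq1 ?_
    rw [e]
    have h2 := mul_le_mul_of_nonneg_right hE1 hN0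
    have h3 : 4 * θ * (N * cc) / z.im ≤ 4 * θ * (2 * K * (b + 1)) / z.im := by gcongr
    calc N * N ≤ 4 * θ * (N * cc) / z.im + 5 * (8 * L / R) * N := by
          refine h2.trans (le_of_eq ?_); ring
      _ ≤ _ := by
          have : 4 * θ * (2 * K * (b + 1)) / z.im = 8 * θ * K * (b + 1) * (1 / z.im) := by ring
          linarith

end LipschitzThinSolution

/-- The trace of a thin solution in the unit half disc is of class `C^{1,1/2}` near the origin. -/
theorem ThinSolution.exists_trace_regularity {θ P M : ℝ} (hθ : 0 < θ) :
    ∃ C, 0 ≤ C ∧ ∀ 𝒰 u φ, ThinSolution θ P M 𝒰 u φ → ∀ x : ℝ, |x| < 1 / 8388608 →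
      DifferentiableAt ℝ (fun t : ℝ => u t) x ∧ |deriv (fun t : ℝ => u t) x| ≤ C ∧
        ∀ y : ℝ, |y| < 1 / 8388608 →
          |deriv (fun t : ℝ => u t) x - deriv (fun t : ℝ => u t) y| ≤ C * |x - y| ^ (1 / 2 : ℝ) := by
  obtain ⟨L, hL⟩ := ThinSolution.exists_lipschitzThinSolution (P := P) (M := M) hθ
  by_cases h0 : 0 ≤ L ∧ 0 ≤ P
  swap
  · refine ⟨0, le_rfl, fun 𝒰 u φ h => ?_⟩
    obtain ⟨V, hV, -⟩ := hL 𝒰 u φ h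
    exact absurd ⟨hV.L_nonneg, hV.P_nonneg⟩ h0
  obtain ⟨C, hC, hCV⟩ := LipschitzThinSolution.exists_norm_deriv_deriv_le_half
    (R := 1 / 64) (by norm_num) hθ h0.2 h0.1
  refine ⟨L + 10 * C, by linarith [h0.1], fun 𝒰 u φ h x hx => ?_⟩
  obtain ⟨V, hV, -, hVu⟩ := hL 𝒰 u φ h
  have hpos : (0 : ℝ) < 1 / 4194304 := by norm_num
  have key := fun (x : ℝ) (hx : |x| < 1 / 4194304) =>
    hV.exists_hasDerivAt_trace (γ := 1 / 2) (ρ := 1 / 4194304) (by norm_num) hC hpos (by norm_num)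
      (fun z h1 h2 h3 => hCV V φ hV z (h1.trans (by norm_num)) h2 (h3.trans (by norm_num))) hx
  have hder : ∀ x : ℝ, |x| < 1 / 4194304 →
      HasDerivAt (fun t : ℝ => u t) (deriv (fun t : ℝ => V t) x).re x := by
    intro x hx
    have h1 := (key x hx).1.hasDerivAt.complex_re
    refine h1.congr_of_eventuallyEq ?_
    have h2 : ∀ᶠ t : ℝ in 𝓝 x, |t| < 1 / 4194304 :=
      continuous_abs.continuousAt.eventually_lt continuousAt_const hx
    filter_upwards [h2] with t ht
    exact (hVu t (ht.trans (by norm_num))).symm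
  have hx' : |x| < 1 / 4194304 := hx.trans (by norm_num)
  refine ⟨(hder x hx').differentiableAt, ?_, fun y hy => ?_⟩
  · rw [(hder x hx').deriv]
    exact (Complex.abs_re_le_norm _).trans ((hV.norm_trace_deriv_le x).trans (by linarith))
  · have hy' : |y| < 1 / 4194304 := hy.trans (by norm_num)
    rw [(hder x hx').deriv, (hder y hy').deriv, ← sub_re]
    refine (Complex.abs_re_le_norm _).trans ?_
    rcases eq_or_ne x y with rfl | hxy
    · simp
    have hd : 0 < |x - y| := abs_pos.2 (sub_ne_zero.2 hxy)
    have hd' : |x - y| ≤ 1 / 4194304 := by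
      have := abs_sub x y
      have e : (1 / 8388608 : ℝ) + 1 / 8388608 = 1 / 4194304 := by norm_num
      linarith
    have hre : ((x : ℂ) + (|x - y| : ℝ) * I).re = x := by simp
    have him : ((x : ℂ) + (|x - y| : ℝ) * I).im = |x - y| := by simp
    have h1 := (key x hx').2 (x + (|x - y| : ℝ) * I) |x - y| hd' (by rw [hre]; exact hx'.le)
      (by rwa [him]) him.le (by rw [hre]; simp)
    have h2 := (key y hy').2 (x + (|x - y| : ℝ) * I) |x - y| hd' (by rw [hre]; exact hx'.le)
      (by rwa [him]) him.le (by rw [hre, abs_sub_comm])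
    have h3 := norm_sub_le_norm_sub_add_norm_sub (deriv (fun t : ℝ => V t) x)
      (deriv V (x + (|x - y| : ℝ) * I)) (deriv (fun t : ℝ => V t) y)
    rw [norm_sub_rev (deriv V _)] at h3
    have e : (2 / (1 / 2 : ℝ) + 1) = 5 := by norm_num
    rw [e] at h1 h2
    have hq : 0 ≤ |x - y| ^ (1 / 2 : ℝ) := by positivity
    nlinarith [mul_nonneg h0.1 hq]

open InnerProductSpace in
theorem InnerProductSpace.HarmonicOnNhd.continuous_circleMap {u : ℂ → ℝ} {z : ℂ} {r : ℝ}
    (hr : 0 ≤ r) (hu : HarmonicOnNhd u (Metric.closedBall z r)) :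
    Continuous fun t => u (circleMap z r t) :=
  continuous_iff_continuousAt.2 fun t =>
    ((hu (circleMap z r t) (circleMap_mem_closedBall z hr t)).1.continuousAt).comp
      (_root_.continuous_circleMap z r).continuousAt

open InnerProductSpace in
theorem InnerProductSpace.HarmonicOnNhd.two_pi_mul_sq_le {u : ℂ → ℝ} {z : ℂ} {r : ℝ} (hr : 0 ≤ r)
    (hu : HarmonicOnNhd u (Metric.closedBall z r)) :
    2 * Real.pi * u z ^ 2 ≤ ∫ t in (-Real.pi)..Real.pi, u (circleMap z r t) ^ 2 := by
  have hpi := Real.pi_pos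
  have hm : Real.circleAverage u z r = u z :=
    HarmonicOnNhd.circleAverage_eq (by rwa [abs_of_nonneg hr])
  have hcont := hu.continuous_circleMap hr
  rw [Real.circleAverage_eq_integral_add (-Real.pi),
    intervalIntegral.integral_comp_add_right (fun t => u (circleMap z r t)), smul_eq_mul,
    show 0 + -Real.pi = -Real.pi by ring, show 2 * Real.pi + -Real.pi = Real.pi by ring,
    inv_mul_eq_iff_eq_mul₀ (by positivity)] at hm
  have h0 : 0 ≤ ∫ t in (-Real.pi)..Real.pi, (u (circleMap z r t) - u z) ^ 2 :=
    intervalIntegral.integral_nonneg (by linarith) fun t _ => sq_nonneg _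
  have h1 : ∀ t, (u (circleMap z r t) - u z) ^ 2 =
      u (circleMap z r t) ^ 2 - (2 * u z * u (circleMap z r t) - u z ^ 2) := fun t => by ring
  have i1 : IntervalIntegrable (fun t => u (circleMap z r t) ^ 2) volume (-Real.pi) Real.pi :=
    (hcont.pow 2).intervalIntegrable _ _
  have i2 : IntervalIntegrable (fun t => 2 * u z * u (circleMap z r t)) volume (-Real.pi) Real.pi :=
    (hcont.const_mul _).intervalIntegrable _ _
  have i3 : IntervalIntegrable (fun _ : ℝ => u z ^ 2) volume (-Real.pi) Real.pi :=
    continuous_const.intervalIntegrable _ _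
  simp_rw [h1] at h0
  rw [intervalIntegral.integral_sub i1 (i2.sub i3), intervalIntegral.integral_sub i2 i3,
    intervalIntegral.integral_const_mul, hm, intervalIntegral.integral_const, smul_eq_mul] at h0
  nlinarith

open InnerProductSpace in
/-- A harmonic function is controlled by its `L²` norm on a ball. -/
theorem InnerProductSpace.HarmonicOnNhd.abs_le_div {u : ℂ → ℝ} {z : ℂ} {ρ A : ℝ} (hρ : 0 < ρ)
    (hu : HarmonicOnNhd u (Metric.ball z ρ))
    (hA : ∫⁻ w in Metric.ball z ρ, ENNReal.ofReal (u w ^ 2) ≤ ENNReal.ofReal (A ^ 2)) :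
    |u z| ≤ |A| / ρ := by
  have hpi := Real.pi_pos
  set f : ℂ → ENNReal := (Metric.ball z ρ).indicator fun w => ENNReal.ofReal (u w ^ 2) with hf
  have hfm : Measurable f := by
    classical
    have h1 : ContinuousOn (fun w => ENNReal.ofReal (u w ^ 2)) (Metric.ball z ρ) :=
      ENNReal.continuous_ofReal.comp_continuousOn (hu.continuousOn.pow 2)
    rw [hf, ← piecewise_eq_indicator]
    exact h1.measurable_piecewise continuousOn_const measurableSet_ball
  have hm2 : Measurable fun p : ℝ × ℝ => ENNReal.ofReal p.1 • f (z + Complex.polarCoord.symm p) := by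
    simp_rw [Complex.polarCoord_symm_apply, smul_eq_mul]
    exact (by fun_prop : Measurable fun p : ℝ × ℝ => ENNReal.ofReal p.1).mul
      (hfm.comp (by fun_prop))
  rw [← lintegral_indicator measurableSet_ball, ← hf, ← lintegral_add_left_eq_self f z,
    ← Complex.lintegral_comp_polarCoord_symm, polarCoord_target, Measure.volume_eq_prod,
    ← Measure.prod_restrict, lintegral_prod _ hm2.aemeasurable] at hA
  have hc : 0 ≤ 2 * Real.pi * u z ^ 2 := by positivity
  have h1 : ∫⁻ x in Ioo 0 ρ, ENNReal.ofReal (x * (2 * Real.pi * u z ^ 2)) ≤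
      ENNReal.ofReal (A ^ 2) := by
    refine le_trans ?_ ((lintegral_mono_set (Ioo_subset_Ioi_self : Ioo 0 ρ ⊆ Ioi 0)).trans hA)
    refine setLIntegral_mono' measurableSet_Ioo fun x hx => ?_
    have hcb : Metric.closedBall z x ⊆ Metric.ball z ρ := Metric.closedBall_subset_ball hx.2
    have h2 := (hu.mono hcb).two_pi_mul_sq_le hx.1.le
    have hcont := (hu.mono hcb).continuous_circleMap hx.1.le
    simp_rw [smul_eq_mul]
    rw [lintegral_const_mul' _ _ ENNReal.ofReal_ne_top, ENNReal.ofReal_mul hx.1.le]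
    refine mul_le_mul_right ?_ _
    have h3 : ∀ y : ℝ, f (z + Complex.polarCoord.symm (x, y)) =
        ENNReal.ofReal (u (circleMap z x y) ^ 2) := by
      intro y
      have e : z + Complex.polarCoord.symm (x, y) = circleMap z x y := by
        rw [Complex.polarCoord_symm_apply, circleMap, Complex.exp_mul_I]
        simp
      rw [e, hf, indicator_of_mem (hcb (circleMap_mem_closedBall z hx.1.le y))]
    simp_rw [h3]
    have hu_int : IntegrableOn (fun y => u (circleMap z x y) ^ 2) (Ioo (-Real.pi) Real.pi) :=
      ((hcont.pow 2).integrableOn_Icc).mono_set Ioo_subset_Icc_self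
    rw [← ofReal_integral_eq_lintegral_ofReal hu_int (Eventually.of_forall fun _ => sq_nonneg _),
      ← integral_Ioc_eq_integral_Ioo, ← intervalIntegral.integral_of_le (by linarith)]
    exact ENNReal.ofReal_le_ofReal h2
  have hu_int : IntegrableOn (fun x => x * (2 * Real.pi * u z ^ 2)) (Ioo 0 ρ) :=
    ((by fun_prop : Continuous fun x : ℝ => x * (2 * Real.pi * u z ^ 2)).integrableOn_Icc).mono_set
      Ioo_subset_Icc_self
  rw [← ofReal_integral_eq_lintegral_ofReal hu_int
    ((ae_restrict_iff' measurableSet_Ioo).2 (Eventually.of_forall fun x hx =>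
      mul_nonneg hx.1.le hc)), ← integral_Ioc_eq_integral_Ioo,
    ← intervalIntegral.integral_of_le hρ.le, intervalIntegral.integral_mul_const, integral_id,
    ENNReal.ofReal_le_ofReal_iff (sq_nonneg A)] at h1
  rw [le_div_iff₀ hρ, ← abs_of_pos hρ, ← abs_mul]
  refine sq_le_sq.1 ?_
  have h2 : 0 ≤ (u z * ρ) ^ 2 := sq_nonneg _
  nlinarith [Real.pi_gt_three]

/-- A solution `u` of the two-phase thin obstacle problem in the open unit half disc, together with
a holomorphic function `𝒰` with real part `u`. -/
structure OpenThinSolution (θ P : ℝ) (𝒰 : ℂ → ℂ) (u : ℂ → ℝ) (φ : ℝ → ℝ) : Prop where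
  cont : ContinuousOn u {z | ‖z‖ < 1 ∧ 0 ≤ z.im}
  holo : DifferentiableOn ℂ 𝒰 (upperHalfDisc 0 1)
  re_eq : ∀ z ∈ upperHalfDisc 0 1, (𝒰 z).re = u z
  flat : ∀ x : ℝ, |x| < 1 → ∃ L, HasFlatNormalDeriv u x L ∧ |L| ≤ θ ∧
    (φ x < u x → L = θ) ∧ (u x < φ x → L = -θ)
  obst_diff : ∀ x : ℝ, |x| < 1 → DifferentiableAt ℝ φ x
  obst_deriv_le : ∀ x : ℝ, |x| < 1 → |deriv φ x| ≤ P
  obst_deriv_lip : ∀ x y : ℝ, |x| < 1 → |y| < 1 → |deriv φ x - deriv φ y| ≤ P * |x - y|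

namespace OpenThinSolution

variable {θ P : ℝ} {𝒰 : ℂ → ℂ} {u : ℂ → ℝ} {φ : ℝ → ℝ}

theorem closedUpperHalfDisc_subset {a r : ℝ} (h : |a| + r < 1) :
    closedUpperHalfDisc a r ⊆ {z | ‖z‖ < 1 ∧ 0 ≤ z.im} := by
  intro z hz
  have := (closedUpperHalfDisc_subset_closedUpperHalfDisc (a := 0) (b := a) (r := |a| + r) (s := r)
    (by simp)) hz
  refine ⟨?_, hz.2⟩
  have h1 := this.1
  rw [ofReal_zero, sub_zero] at h1
  linarith

/-- A bound `±u ≤ N / √y` on a half disc yields a bound at the centre. -/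
theorem mul_le_of_barrier (h : OpenThinSolution θ P 𝒰 u φ) (hθ : 0 ≤ θ) {σ : ℝ} (hσ : |σ| = 1)
    {a r N : ℝ} (hr : 0 < r) (har : |a| + r < 1) (hN : 0 < N)
    (hu : ∀ z ∈ closedUpperHalfDisc a r, 0 < z.im → |u z| ≤ N / √z.im) {z : ℂ}
    (hz : z ∈ closedUpperHalfDisc a (r / 2)) : σ * u z ≤ θ * r + 9 * N / √r := by
  have hsub := closedUpperHalfDisc_subset har
  have hsub' : upperHalfDisc a r ⊆ upperHalfDisc 0 1 :=
    upperHalfDisc_subset_upperHalfDisc (by rw [sub_zero]; exact har.le)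
  have him : ∀ z ∈ closedUpperHalfDisc a r, z.im ≤ r := by
    intro z hz
    have h1 := Complex.abs_im_le_norm (z - a)
    rw [sub_im, ofReal_im, sub_zero] at h1
    exact (le_abs_self _).trans (h1.trans hz.1)
  have key := le_of_halfDisc_barrier (w := fun z => σ * u z + θ * (z.im - r))
    (W := fun z => σ * 𝒰 z + θ * (-I * z - r)) hr hN ?_ ?_ ?_ ?_ ?_ z hz
  · have h0 : 0 ≤ θ * z.im := mul_nonneg hθ hz.2
    linarith
  · exact ((h.cont.mono hsub).const_mul σ |>.add (by fun_prop))
  · have := h.holo.mono hsub'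
    exact (this.const_mul _).add (by fun_prop)
  · intro z hz
    have := h.re_eq z (hsub' hz)
    simp [this]
  · intro x hx _
    have hx1 : |x| < 1 := by
      have := abs_add_le (x - a) a
      rw [sub_add_cancel] at this
      linarith
    obtain ⟨L, hL, hLθ, -⟩ := h.flat x hx1
    refine ⟨σ * L + θ, ?_, (hL.const_mul σ).add ?_⟩
    · have h1 : |σ * L| ≤ θ := by rwa [abs_mul, hσ, one_mul]
      linarith [(abs_le.1 h1).1]
    · refine Tendsto.congr' ?_ tendsto_const_nhds
      filter_upwards [self_mem_nhdsWithin] with t ht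
      have ht' : t ≠ 0 := (mem_Ioi.1 ht).ne'
      simp
      field_simp
      ring
  · intro z hz1 hz2
    have hzm : z ∈ closedUpperHalfDisc a r := ⟨hz1.le, hz2.le⟩
    have h1 : σ * u z ≤ |u z| := by
      refine (le_abs_self _).trans ?_
      rw [abs_mul, hσ, one_mul]
    have h2 : θ * (z.im - r) ≤ 0 := mul_nonpos_of_nonneg_of_nonpos hθ (by linarith [him z hzm])
    linarith [hu z hzm hz2]

/-- An interior bound for `u` which degenerates at the boundary gives a bound up to the flat
boundary. -/
theorem abs_le_of_interior (h : OpenThinSolution θ P 𝒰 u φ) (hθ : 0 ≤ θ) {N : ℝ} (hN : 0 < N)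
    (hu_int : ∀ z ρ, 0 < ρ → Metric.ball z ρ ⊆ upperHalfDisc 0 1 → |u z| ≤ N / ρ) {z : ℂ}
    (hz : ‖z‖ ≤ 3 / 4) (hz0 : 0 ≤ z.im) : |u z| ≤ 8 * (θ + 432 * N) := by
  have hball : ∀ (z : ℂ) (ρ : ℝ), ρ ≤ z.im → ‖z‖ + ρ ≤ 1 →
      Metric.ball z ρ ⊆ upperHalfDisc 0 1 := by
    intro z ρ h1 h2 w hw
    rw [Metric.mem_ball, dist_eq_norm] at hw
    have h3 := Complex.abs_im_le_norm (w - z)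
    rw [sub_im] at h3
    have h4 := (abs_le.1 h3).1
    have h5 := norm_add_le (w - z) z
    rw [sub_add_cancel] at h5
    refine ⟨?_, by linarith⟩
    rw [ofReal_zero, sub_zero]
    linarith
  have hcont : ContinuousOn (fun z : ℂ => (7 / 8 - ‖z‖) * |u z|) (closedUpperHalfDisc 0 (7 / 8)) :=
    ContinuousOn.mul (by fun_prop)
      (h.cont.mono (closedUpperHalfDisc_subset (by norm_num))).abs
  obtain ⟨z₀, ⟨hz₀, hz₀'⟩, hmax⟩ := (isCompact_closedUpperHalfDisc 0 (7 / 8)).exists_isMaxOn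
    ⟨0, by simp [closedUpperHalfDisc]; norm_num⟩ hcont
  rw [ofReal_zero, sub_zero] at hz₀
  have hmax' : ∀ z : ℂ, ‖z‖ ≤ 7 / 8 → 0 ≤ z.im →
      (7 / 8 - ‖z‖) * |u z| ≤ (7 / 8 - ‖z₀‖) * |u z₀| := fun z h1 h2 =>
    isMaxOn_iff.1 hmax z ⟨by simpa using h1, h2⟩
  suffices hS : (7 / 8 - ‖z₀‖) * |u z₀| ≤ θ + 432 * N by
    have h1 := hmax' z (by linarith) hz0
    have h2 : 1 / 8 * |u z| ≤ (7 / 8 - ‖z‖) * |u z| :=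
      mul_le_mul_of_nonneg_right (by linarith) (abs_nonneg _)
    linarith
  set S := |u z₀| with hSdef
  set d := 7 / 8 - ‖z₀‖ with hd
  have hS0 : 0 ≤ S := abs_nonneg _
  have hd1 : d ≤ 1 := by linarith [norm_nonneg z₀]
  rcases eq_or_lt_of_le hS0 with hS0' | hSpos
  · rw [← hS0', mul_zero]
    positivity
  have hd0' : 0 ≤ d := by linarith
  rcases eq_or_lt_of_le hd0' with hd0'' | hdpos
  · rw [← hd0'', zero_mul]
    positivity
  rcases le_or_gt (d / 8) z₀.im with hy | hy
  · have h1 := hu_int z₀ (d / 8) (by positivity) (hball z₀ _ hy (by linarith))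
    rw [← hSdef, le_div_iff₀ (by positivity)] at h1
    linarith
  have hre := Complex.abs_re_le_norm z₀
  have hz₀mem : z₀ ∈ closedUpperHalfDisc z₀.re (d / 4 / 2) := by
    refine ⟨?_, hz₀'⟩
    have e : z₀ - z₀.re = z₀.im * I := by
      apply Complex.ext <;> simp
    rw [e, norm_mul, norm_I, mul_one, Complex.norm_real, Real.norm_eq_abs, abs_of_nonneg hz₀']
    linarith
  have hNS : 0 < √(4 / 3 * S * N) := Real.sqrt_pos.2 (by positivity)
  have hbd : ∀ z ∈ closedUpperHalfDisc z₀.re (d / 4), 0 < z.im →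
      |u z| ≤ √(4 / 3 * S * N) / √z.im := by
    intro z hz hzp
    have hzn : ‖z‖ ≤ ‖z₀‖ + d / 4 := by
      have h5 := norm_add_le (z - z₀.re) z₀.re
      rw [sub_add_cancel, Complex.norm_real, Real.norm_eq_abs] at h5
      linarith [hz.1]
    have him : z.im ≤ d / 4 := by
      have h1 := Complex.abs_im_le_norm (z - z₀.re)
      rw [sub_im, ofReal_im, sub_zero] at h1
      exact (le_abs_self _).trans (h1.trans hz.1)
    have h1 : |u z| ≤ N / z.im := hu_int z z.im hzp (hball z _ le_rfl (by linarith))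
    have h2 : |u z| ≤ 4 / 3 * S := by
      have h3 := hmax' z (by linarith) hzp.le
      have h4 : 3 * d / 4 * |u z| ≤ (7 / 8 - ‖z‖) * |u z| :=
        mul_le_mul_of_nonneg_right (by linarith) (abs_nonneg _)
      have h5 : d * |u z| ≤ d * (4 / 3 * S) := by linarith
      exact le_of_mul_le_mul_left h5 hdpos
    rw [← Real.sqrt_div' _ hzp.le]
    refine Real.le_sqrt_of_sq_le ?_
    rw [pow_two, mul_div_assoc]
    exact mul_le_mul h2 h1 (abs_nonneg _) (by positivity)
  have hup : S ≤ θ * (d / 4) + 9 * √(4 / 3 * S * N) / √(d / 4) := by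
    rcases abs_cases (u z₀) with ⟨h1, -⟩ | ⟨h1, -⟩
    · have := h.mul_le_of_barrier hθ (σ := 1) (by simp) (by positivity) (by linarith) hNS hbd hz₀mem
      rwa [one_mul, ← h1, ← hSdef] at this
    · have := h.mul_le_of_barrier hθ (σ := -1) (by simp) (by positivity) (by linarith) hNS hbd hz₀mem
      rwa [neg_one_mul, ← h1, ← hSdef] at this
  rw [mul_div_assoc, ← Real.sqrt_div' _ (by positivity)] at hup
  have hq : 9 * √(4 / 3 * S * N / (d / 4)) ≤ S / 2 + 216 * N / d := by
    have e : √(4 / 3 * S * N / (d / 4)) ≤ (S / 2 + 216 * N / d) / 9 := by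
      refine Real.sqrt_le_iff.2 ⟨by positivity, ?_⟩
      have e1 : ((S / 2 + 216 * N / d) / 9) ^ 2 - 4 / 3 * S * N / (d / 4) =
        ((S / 2 - 216 * N / d) / 9) ^ 2 := by
        field_simp
        ring
      linarith [sq_nonneg ((S / 2 - 216 * N / d) / 9)]
    linarith
  have h1 : S ≤ θ * (d / 2) + 432 * N / d := by
    have : 432 * N / d = 2 * (216 * N / d) := by ring
    linarith
  have h2 := mul_le_mul_of_nonneg_left h1 hdpos.le
  have h3 : d * (θ * (d / 2) + 432 * N / d) = θ * (d * d / 2) + 432 * N := by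
    field_simp
  have h4 : θ * (d * d / 2) ≤ θ * 1 := mul_le_mul_of_nonneg_left (by nlinarith) hθ
  linarith

end OpenThinSolution

theorem HasFlatNormalDeriv.comp_add_mul {w : ℂ → ℝ} {a ρ x L : ℝ} (hρ : 0 < ρ)
    (hw : HasFlatNormalDeriv w (a + ρ * x) L) :
    HasFlatNormalDeriv (fun z => w (a + ρ * z)) x (ρ * L) := by
  have h1 : Tendsto (fun t : ℝ => ρ * t) (𝓝[>] 0) (𝓝[>] 0) := by
    refine tendsto_nhdsWithin_iff.2 ⟨?_, ?_⟩
    · have : Tendsto (fun t : ℝ => ρ * t) (𝓝 0) (𝓝 (ρ * 0)) := tendsto_id.const_mul ρ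
      rw [mul_zero] at this
      exact this.mono_left nhdsWithin_le_nhds
    · filter_upwards [self_mem_nhdsWithin] with t ht
      exact mul_pos hρ ht
  refine ((hw.comp h1).const_mul ρ).congr' ?_
  filter_upwards [self_mem_nhdsWithin] with t ht
  have ht' : t ≠ 0 := (mem_Ioi.1 ht).ne'
  have e1 : ((a + ρ * x : ℝ) : ℂ) + ((ρ * t : ℝ) : ℂ) * I = a + ρ * (x + t * I) := by
    push_cast; ring
  have e2 : ((a + ρ * x : ℝ) : ℂ) = a + ρ * x := by push_cast; ring
  simp only [Function.comp_apply]
  rw [e1, e2]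
  field_simp

namespace OpenThinSolution

variable {θ P : ℝ} {𝒰 : ℂ → ℂ} {u : ℂ → ℝ} {φ : ℝ → ℝ}

theorem P_nonneg (h : OpenThinSolution θ P 𝒰 u φ) : 0 ≤ P :=
  (abs_nonneg _).trans (h.obst_deriv_le 0 (by simp))

/-- The restriction of a solution to a smaller half disc, rescaled to the unit half disc. -/
theorem rescale (h : OpenThinSolution θ P 𝒰 u φ) {a ρ M : ℝ} (hρ : 0 < ρ) (ha : |a| + ρ < 1)
    (hM : ∀ z ∈ closedUpperHalfDisc a ρ, |u z| ≤ M) :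
    ThinSolution (ρ * θ) P M (fun z => 𝒰 (a + ρ * z)) (fun z => u (a + ρ * z))
      (fun t => φ (a + ρ * t)) := by
  have hρ1 : ρ ≤ 1 := by linarith [abs_nonneg a]
  have hP := h.P_nonneg
  have hmaps : MapsTo (fun z : ℂ => a + ρ * z) (closedUpperHalfDisc 0 1)
      (closedUpperHalfDisc a ρ) := by
    rintro z ⟨h1, h2⟩
    rw [ofReal_zero, sub_zero] at h1
    refine ⟨?_, ?_⟩
    · rw [add_sub_cancel_left, norm_mul, Complex.norm_real, Real.norm_eq_abs, abs_of_pos hρ]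
      exact mul_le_of_le_one_right hρ.le h1
    · simp; positivity
  have hmaps' : MapsTo (fun z : ℂ => a + ρ * z) (upperHalfDisc 0 1) (upperHalfDisc 0 1) := by
    rintro z ⟨h1, h2⟩
    refine upperHalfDisc_subset_upperHalfDisc (a := 0) (b := a) (s := ρ)
      (by rw [sub_zero]; exact ha.le) ⟨?_, ?_⟩
    · rw [ofReal_zero, sub_zero] at h1
      rw [add_sub_cancel_left, norm_mul, Complex.norm_real, Real.norm_eq_abs, abs_of_pos hρ]
      exact mul_lt_of_lt_one_right hρ h1
    · simp; positivity
  have hx1 : ∀ x : ℝ, |x| < 1 → |a + ρ * x| < 1 := by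
    intro x hx
    have h1 := abs_add_le a (ρ * x)
    rw [abs_mul, abs_of_pos hρ] at h1
    have := mul_le_of_le_one_right hρ.le hx.le
    linarith
  have hder : ∀ x : ℝ, |x| < 1 →
      HasDerivAt (fun t => φ (a + ρ * t)) (ρ * deriv φ (a + ρ * x)) x := by
    intro x hx
    have h1 := (h.obst_diff _ (hx1 x hx)).hasDerivAt
    have h2 : HasDerivAt (fun t : ℝ => a + ρ * t) ρ x := by
      have := ((hasDerivAt_id x).const_mul ρ).const_add a
      rw [mul_one] at this
      exact this
    have h3 := h1.comp x h2
    rw [mul_comm] at h3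
    exact h3
  refine ⟨?_, ?_, ?_, ?_, ?_, ?_, ?_, ?_⟩
  · exact (h.cont.mono (closedUpperHalfDisc_subset ha)).comp (by fun_prop) hmaps
  · exact h.holo.comp (by fun_prop) hmaps'
  · exact fun z hz => h.re_eq _ (hmaps' hz)
  · exact fun z hz => hM _ (hmaps hz)
  · intro x hx
    obtain ⟨L, hL, hLθ, h1, h2⟩ := h.flat _ (hx1 x hx)
    refine ⟨ρ * L, hL.comp_add_mul hρ, ?_, ?_, ?_⟩
    · rw [abs_mul, abs_of_pos hρ]
      exact mul_le_mul_of_nonneg_left hLθ hρ.le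
    · intro h3
      rw [h1 (by push_cast; exact h3)]
    · intro h3
      rw [h2 (by push_cast; exact h3), mul_neg]
  · exact fun x hx => (hder x hx).differentiableAt
  · intro x hx
    rw [(hder x hx).deriv, abs_mul, abs_of_pos hρ]
    have := h.obst_deriv_le _ (hx1 x hx)
    calc ρ * |deriv φ (a + ρ * x)| ≤ 1 * P := by gcongr
      _ = P := one_mul P
  · intro x y hx hy
    rw [(hder x hx).deriv, (hder y hy).deriv, ← mul_sub, abs_mul, abs_of_pos hρ]
    have h1 := h.obst_deriv_lip _ _ (hx1 x hx) (hx1 y hy)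
    have e : a + ρ * x - (a + ρ * y) = ρ * (x - y) := by ring
    rw [e, abs_mul, abs_of_pos hρ] at h1
    have h2 : P * (ρ * |x - y|) ≤ P * (1 * |x - y|) := by gcongr
    rw [one_mul] at h2
    calc ρ * |deriv φ (a + ρ * x) - deriv φ (a + ρ * y)| ≤ 1 * (P * |x - y|) := by
          gcongr
          exact h1.trans h2
      _ = _ := one_mul _

theorem exists_local_regularity {ρ M : ℝ} (hθ : 0 < θ) (hρ : 0 < ρ) :
    ∃ C, 0 ≤ C ∧ ∀ 𝒰 u φ, OpenThinSolution θ P 𝒰 u φ → ∀ a : ℝ, |a| + ρ < 1 →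
      (∀ z ∈ closedUpperHalfDisc a ρ, |u z| ≤ M) → ∀ x : ℝ, |x - a| < ρ / 8388608 →
      DifferentiableAt ℝ (fun t : ℝ => u t) x ∧ |deriv (fun t : ℝ => u t) x| ≤ C ∧
        ∀ y : ℝ, |y - a| < ρ / 8388608 →
          |deriv (fun t : ℝ => u t) x - deriv (fun t : ℝ => u t) y| ≤ C * |x - y| ^ (1 / 2 : ℝ) := by
  obtain ⟨C, hC, hreg⟩ := ThinSolution.exists_trace_regularity (θ := ρ * θ) (P := P) (M := M)
    (by positivity)
  refine ⟨C / ρ + C / ρ / ρ ^ (1 / 2 : ℝ), by positivity, fun 𝒰 u φ h a ha hM => ?_⟩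
  have key := hreg _ _ _ (h.rescale hρ ha hM)
  set T : ℝ → ℝ := fun t : ℝ => u (a + ρ * t) with hT
  have hmem : ∀ x : ℝ, |x - a| < ρ / 8388608 → |(x - a) / ρ| < 1 / 8388608 := by
    intro x hx
    rw [abs_div, abs_of_pos hρ, div_lt_iff₀ hρ]
    linarith
  have hder : ∀ x : ℝ, |x - a| < ρ / 8388608 →
      HasDerivAt (fun t : ℝ => u t) (deriv T ((x - a) / ρ) / ρ) x := by
    intro x hx
    have h1 := (key _ (hmem x hx)).1.hasDerivAt
    have h2 : HasDerivAt (fun t : ℝ => (t - a) / ρ) (1 / ρ) x :=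
      ((hasDerivAt_id x).sub_const a).div_const ρ
    have h3 := h1.comp x h2
    rw [mul_one_div] at h3
    have e : (fun t : ℝ => u t) = T ∘ fun t : ℝ => (t - a) / ρ := by
      funext t
      simp only [hT, Function.comp_apply]
      congr 1
      push_cast
      have : (ρ : ℂ) ≠ 0 := by exact_mod_cast hρ.ne'
      field_simp
      ring
    rw [e]
    exact h3
  intro x hx
  refine ⟨(hder x hx).differentiableAt, ?_, fun y hy => ?_⟩
  · rw [(hder x hx).deriv, abs_div, abs_of_pos hρ]
    have h1 : |deriv T ((x - a) / ρ)| / ρ ≤ C / ρ :=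
      div_le_div_of_nonneg_right (key _ (hmem x hx)).2.1 hρ.le
    have h2 : 0 ≤ C / ρ / ρ ^ (1 / 2 : ℝ) := by positivity
    linarith
  · rw [(hder x hx).deriv, (hder y hy).deriv, ← sub_div, abs_div, abs_of_pos hρ]
    have h1 := (key _ (hmem x hx)).2.2 _ (hmem y hy)
    have e : (x - a) / ρ - (y - a) / ρ = (x - y) / ρ := by ring
    rw [e, abs_div, abs_of_pos hρ, Real.div_rpow (abs_nonneg _) hρ.le] at h1
    have h2 : 0 ≤ C / ρ * |x - y| ^ (1 / 2 : ℝ) := by positivity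
    calc _ ≤ C * (|x - y| ^ (1 / 2 : ℝ) / ρ ^ (1 / 2 : ℝ)) / ρ :=
          div_le_div_of_nonneg_right h1 hρ.le
      _ = C / ρ / ρ ^ (1 / 2 : ℝ) * |x - y| ^ (1 / 2 : ℝ) := by ring
      _ ≤ _ := by linarith

/-- The trace of a solution is continuously differentiable. -/
theorem trace_contDiff (h : OpenThinSolution θ P 𝒰 u φ) (hθ : 0 < θ) {x : ℝ} (hx : |x| < 1) :
    DifferentiableAt ℝ (fun t : ℝ => u t) x ∧ ContinuousAt (deriv fun t : ℝ => u t) x := by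
  have hρ : 0 < (1 - |x|) / 2 := by linarith
  have ha : |x| + (1 - |x|) / 2 < 1 := by linarith
  obtain ⟨M, hM⟩ := (isCompact_closedUpperHalfDisc x ((1 - |x|) / 2)).exists_bound_of_continuousOn
    (h.cont.mono (closedUpperHalfDisc_subset ha))
  obtain ⟨C, -, hC⟩ := exists_local_regularity (θ := θ) (P := P) (M := M) hθ hρ
  have hsmall : 0 < (1 - |x|) / 2 / 8388608 := by positivity
  obtain ⟨h1, -, h3⟩ := hC 𝒰 u φ h x ha hM x (by simpa using hsmall)
  refine ⟨h1, ?_⟩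
  refine tendsto_iff_norm_sub_tendsto_zero.2 ?_
  have hlim : Tendsto (fun y : ℝ => C * |x - y| ^ (1 / 2 : ℝ)) (𝓝 x) (𝓝 0) := by
    have : ContinuousAt (fun y : ℝ => C * |x - y| ^ (1 / 2 : ℝ)) x := by
      refine ContinuousAt.const_mul ?_ C
      exact ContinuousAt.rpow_const (by fun_prop) (Or.inr (by norm_num))
    have h2 := this.tendsto
    simp only [sub_self, abs_zero] at h2
    rwa [Real.zero_rpow (by norm_num), mul_zero] at h2
  refine squeeze_zero' (Eventually.of_forall fun _ => norm_nonneg _) ?_ hlim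
  have hnear : ∀ᶠ y : ℝ in 𝓝 x, |y - x| < (1 - |x|) / 2 / 8388608 := by
    have : ContinuousAt (fun y : ℝ => |y - x|) x := by fun_prop
    exact this.eventually_lt continuousAt_const (by simpa using hsmall)
  filter_upwards [hnear] with y hy
  rw [Real.norm_eq_abs, abs_sub_comm]
  exact h3 y hy

/-- The interior `C^{1,1/2}` estimate for the trace. -/
theorem exists_regularity {N : ℝ} (hθ : 0 < θ) (hN : 0 < N) :
    ∃ C > 0, ∀ 𝒰 u φ, OpenThinSolution θ P 𝒰 u φ →
      (∀ z ρ, 0 < ρ → Metric.ball z ρ ⊆ upperHalfDisc 0 1 → |u z| ≤ N / ρ) →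
      (∀ x : ℝ, |x| ≤ 1 / 2 → |u x| + |deriv (fun t : ℝ => u t) x| ≤ C) ∧
      ∀ x y : ℝ, |x| ≤ 1 / 2 → |y| ≤ 1 / 2 →
        |deriv (fun t : ℝ => u t) x - deriv (fun t : ℝ => u t) y| ≤ C * |x - y| ^ (1 / 2 : ℝ) := by
  set M := 8 * (θ + 432 * N) with hMdef
  have hM0 : 0 < M := by positivity
  obtain ⟨C, hC, hreg⟩ := exists_local_regularity (θ := θ) (P := P) (ρ := 1 / 8) (M := M) hθ
    (by norm_num)
  set c : ℝ := 1 / 8 / 8388608 with hc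
  have hc0 : 0 < c := by norm_num [hc]
  have hq0 : 0 < c ^ (1 / 2 : ℝ) := by positivity
  refine ⟨M + C + 2 * C / c ^ (1 / 2 : ℝ), by positivity, fun 𝒰 u φ h hu_int => ?_⟩
  have hloc : ∀ x : ℝ, |x| ≤ 1 / 2 → |deriv (fun t : ℝ => u t) x| ≤ C ∧ ∀ y : ℝ, |y - x| < c →
      |deriv (fun t : ℝ => u t) x - deriv (fun t : ℝ => u t) y| ≤ C * |x - y| ^ (1 / 2 : ℝ) := by
    intro x hx
    refine (hreg 𝒰 u φ h x (by linarith) (fun z hz => ?_) x (by simpa using hc0)).2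
    refine h.abs_le_of_interior hθ.le hN hu_int ?_ hz.2
    have h5 := norm_add_le (z - x) x
    rw [sub_add_cancel, Complex.norm_real, Real.norm_eq_abs] at h5
    linarith [hz.1]
  have hCq : 0 ≤ 2 * C / c ^ (1 / 2 : ℝ) := by positivity
  refine ⟨fun x hx => ?_, fun x y hx hy => ?_⟩
  · have h1 : |u x| ≤ M := h.abs_le_of_interior hθ.le hN hu_int
      (by rw [Complex.norm_real, Real.norm_eq_abs]; linarith) (by simp)
    linarith [(hloc x hx).1]
  · have hp : 0 ≤ |x - y| ^ (1 / 2 : ℝ) := by positivity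
    have hMp : 0 ≤ M * |x - y| ^ (1 / 2 : ℝ) := by positivity
    rw [add_mul, add_mul]
    rcases lt_or_ge |y - x| c with hxy | hxy
    · have h1 := (hloc x hx).2 y hxy
      have h2 : 0 ≤ 2 * C / c ^ (1 / 2 : ℝ) * |x - y| ^ (1 / 2 : ℝ) := by positivity
      linarith
    · rw [abs_sub_comm] at hxy
      have h1 := abs_sub (deriv (fun t : ℝ => u t) x) (deriv (fun t : ℝ => u t) y)
      have h2 : 2 * C ≤ 2 * C / c ^ (1 / 2 : ℝ) * |x - y| ^ (1 / 2 : ℝ) := by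
        rw [div_mul_eq_mul_div, le_div_iff₀ hq0]
        exact mul_le_mul_of_nonneg_left (Real.rpow_le_rpow hc0.le hxy (by norm_num))
          (by positivity)
      have h3 : 0 ≤ C * |x - y| ^ (1 / 2 : ℝ) := by positivity
      linarith [(hloc x hx).1, (hloc y hy).1]

end OpenThinSolution

theorem deriv_deriv_comp_line {E : Type*} [NormedAddCommGroup E] [NormedSpace ℝ E] {f : E → ℝ}
    {p v : E} {t : ℝ} (hf : ContDiffAt ℝ 2 f (p + t • v)) :
    deriv (deriv fun s : ℝ => f (p + s • v)) t = iteratedFDeriv ℝ 2 f (p + t • v) ![v, v] := by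
  have hline : ∀ s : ℝ, HasDerivAt (fun s : ℝ => p + s • v) v s := by
    intro s
    have := ((hasDerivAt_id s).smul_const v).const_add p
    rw [one_smul] at this
    exact this
  have hev : ∀ᶠ s in 𝓝 t, ContDiffAt ℝ 2 f (p + s • v) :=
    (hline t).continuousAt.eventually (hf.eventually (by simp))
  have h1 : deriv (fun s : ℝ => f (p + s • v)) =ᶠ[𝓝 t] fun s => fderiv ℝ f (p + s • v) v := by
    filter_upwards [hev] with s hs
    exact (HasFDerivAt.comp_hasDerivAt (f := fun s : ℝ => p + s • v) s
      (hs.differentiableAt (by norm_num)).hasFDerivAt (hline s)).deriv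
  have h2 : DifferentiableAt ℝ (fderiv ℝ f) (p + t • v) :=
    (hf.fderiv_right (m := 1) (by norm_num)).differentiableAt (by norm_num)
  have h3 : HasDerivAt (fun s : ℝ => fderiv ℝ f (p + s • v))
      (fderiv ℝ (fderiv ℝ f) (p + t • v) v) t :=
    HasFDerivAt.comp_hasDerivAt (f := fun s : ℝ => p + s • v) t h2.hasFDerivAt (hline t)
  have h4 : HasDerivAt (fun s : ℝ => fderiv ℝ f (p + s • v) v)
      (fderiv ℝ (fderiv ℝ f) (p + t • v) v v) t :=
    (ContinuousLinearMap.apply ℝ ℝ v).hasFDerivAt.comp_hasDerivAt t h3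
  rw [h1.deriv_eq, h4.deriv, iteratedFDeriv_two_apply]
  simp only [Matrix.cons_val_zero, Matrix.cons_val_one]

open InnerProductSpace in
/-- A harmonic function on an open convex set is the real part of a holomorphic function. -/
theorem InnerProductSpace.HarmonicOnNhd.exists_differentiableOn_re_eq {f : ℂ → ℝ} {s : Set ℂ}
    (hs : IsOpen s) (hc : Convex ℝ s) (hf : HarmonicOnNhd f s) :
    ∃ F : ℂ → ℂ, DifferentiableOn ℂ F s ∧ ∀ z ∈ s, (F z).re = f z := by
  rcases s.eq_empty_or_nonempty with rfl | ⟨z₀, hz₀⟩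
  · exact ⟨0, by simp, by simp⟩
  have hg : DifferentiableOn ℂ (fun z => (fderiv ℝ f z 1 : ℂ) - I * fderiv ℝ f z I) s :=
    fun x hx => (HarmonicAt.differentiableAt_complex_partial (hf x hx)).differentiableWithinAt
  obtain ⟨G, hG⟩ := hc.exists_forall_hasDerivWithinAt hg
  have hG' : ∀ z ∈ s, HasDerivAt G ((fderiv ℝ f z 1 : ℂ) - I * fderiv ℝ f z I) z :=
    fun z hz => (hG z hz).hasDerivAt (hs.mem_nhds hz)
  have hderiv : ∀ z ∈ s, HasFDerivAt (fun z => (G z).re - f z) (0 : ℂ →L[ℝ] ℝ) z := by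
    intro z hz
    have h1 := (hG' z hz).hasFDerivAt.restrictScalars ℝ
    have h2 := reCLM.hasFDerivAt.comp z h1
    have h3 := ((hf z hz).1.differentiableAt (by norm_num)).hasFDerivAt
    refine (h2.sub h3).congr_fderiv ?_
    ext a
    have e : a = a.re • (1 : ℂ) + a.im • (I : ℂ) := by simp
    have e' : fderiv ℝ f z a = a.re * fderiv ℝ f z 1 + a.im * fderiv ℝ f z I := by
      conv_lhs => rw [e]
      simp only [map_add, map_smul, smul_eq_mul]
    simp [e']
  have hconst : ∀ z ∈ s, (G z).re - f z = (G z₀).re - f z₀ := by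
    intro z hz
    refine hc.is_const_of_fderivWithin_eq_zero (𝕜 := ℝ)
      (fun w hw => (hderiv w hw).differentiableAt.differentiableWithinAt) (fun w hw => ?_) hz hz₀
    rw [fderivWithin_of_isOpen hs hw, (hderiv w hw).fderiv]
  refine ⟨fun z => G z - ((G z₀).re - f z₀ : ℝ), fun z hz => ?_, fun z hz => ?_⟩
  · exact ((hG' z hz).differentiableAt.sub_const _).differentiableWithinAt
  · rw [sub_re, ofReal_re]
    linarith [hconst z hz]

theorem isOpen_upB : IsOpen upB :=
  (isOpen_lt (f := fun p : ℝ × ℝ => p.1 ^ 2 + p.2 ^ 2) (by fun_prop) continuous_const).inter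
    (isOpen_lt continuous_const continuous_snd)

theorem norm_lt_one_iff_sq_add_sq (z : ℂ) : ‖z‖ < 1 ↔ z.re ^ 2 + z.im ^ 2 < 1 := by
  rw [← sq_lt_one_iff₀ (norm_nonneg z), Complex.sq_norm, normSq_apply]
  ring_nf

theorem mem_upperHalfDisc_iff_mem_upB (z : ℂ) : z ∈ upperHalfDisc 0 1 ↔ (z.re, z.im) ∈ upB := by
  simp only [upperHalfDisc, upB, mem_ofPred_eq, ofReal_zero, sub_zero, norm_lt_one_iff_sq_add_sq]

open InnerProductSpace in
theorem HarmonicOn2.harmonicOnNhd {u : ℝ × ℝ → ℝ} (hu : HarmonicOn2 u upB) :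
    HarmonicOnNhd (fun z : ℂ => u (z.re, z.im)) (upperHalfDisc 0 1) := by
  have hcd : ∀ z ∈ upperHalfDisc 0 1, ContDiffAt ℝ 2 (fun z : ℂ => u (z.re, z.im)) z := by
    intro z hz
    have h1 : ContDiffAt ℝ 2 u (z.re, z.im) :=
      hu.1.contDiffAt (isOpen_upB.mem_nhds ((mem_upperHalfDisc_iff_mem_upB z).1 hz))
    exact ContDiffAt.comp (f := fun z : ℂ => (z.re, z.im)) z h1
      (reCLM.contDiff.contDiffAt.prodMk imCLM.contDiff.contDiffAt)
  have hlap : ∀ z ∈ upperHalfDisc 0 1, Laplacian.laplacian (fun z : ℂ => u (z.re, z.im)) z = 0 := by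
    intro z hz
    have e1 : ((z.im * I : ℂ) + z.re • (1 : ℂ)) = z := by
      apply Complex.ext <;> simp
    have e2 : ((z.re : ℂ) + z.im • I) = z := by
      apply Complex.ext <;> simp
    have h1 := deriv_deriv_comp_line (f := fun z : ℂ => u (z.re, z.im)) (p := z.im * I) (v := 1)
      (t := z.re) (by rw [e1]; exact hcd z hz)
    have h2 := deriv_deriv_comp_line (f := fun z : ℂ => u (z.re, z.im)) (p := z.re) (v := I)
      (t := z.im) (by rw [e2]; exact hcd z hz)
    rw [e1] at h1
    rw [e2] at h2
    have h3 := hu.2 _ ((mem_upperHalfDisc_iff_mem_upB z).1 hz)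
    rw [laplacian_eq_iteratedFDeriv_complexPlane]
    simp only
    rw [← h1, ← h2, ← h3, lap2]
    simp
  intro z hz
  refine ⟨hcd z hz, ?_⟩
  filter_upwards [(isOpen_upperHalfDisc 0 1).mem_nhds hz] with w hw
  exact hlap w hw

theorem lintegral_upperHalfDisc_le {u : ℝ × ℝ → ℝ} {A : ℝ} (hu : ContinuousOn u upB)
    (hu_int : IntegrableOn (fun p => (u p) ^ 2 + gradSq2 u p) upB volume)
    (hA : (∫ p in upB, (u p) ^ 2) ≤ A ^ 2) :
    ∫⁻ z in upperHalfDisc 0 1, ENNReal.ofReal (u (z.re, z.im) ^ 2) ≤ ENNReal.ofReal (A ^ 2) := by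
  have hsq : IntegrableOn (fun p => (u p) ^ 2) upB volume := by
    refine Integrable.mono' hu_int ((hu.pow 2).aestronglyMeasurable isOpen_upB.measurableSet)
      (Eventually.of_forall fun p => ?_)
    rw [Real.norm_eq_abs, abs_of_nonneg (sq_nonneg _)]
    refine le_add_of_nonneg_right ?_
    unfold gradSq2
    positivity
  have h1 : ∫⁻ p in upB, ENNReal.ofReal (u p ^ 2) ≤ ENNReal.ofReal (A ^ 2) := by
    rw [← ofReal_integral_eq_lintegral_ofReal hsq (Eventually.of_forall fun _ => sq_nonneg _)]
    exact ENNReal.ofReal_le_ofReal hA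
  have hpre : measurableEquivRealProd ⁻¹' upB = upperHalfDisc 0 1 := by
    ext z
    exact (mem_upperHalfDisc_iff_mem_upB z).symm
  rw [← volume_preserving_equiv_real_prod.setLIntegral_comp_preimage_emb
    measurableEquivRealProd.measurableEmbedding, hpre] at h1
  exact h1

theorem exists_openThinSolution {θ P A : ℝ} {φ : ℝ → ℝ} {u : ℝ × ℝ → ℝ}
    (hφ : ∀ x₁ ∈ Ioo (-1 : ℝ) 1, DifferentiableAt ℝ φ x₁ ∧ |φ x₁| ≤ P ∧ |deriv φ x₁| ≤ P)
    (hφ' : ∀ x₁ ∈ Ioo (-1 : ℝ) 1, ∀ y₁ ∈ Ioo (-1 : ℝ) 1,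
      |deriv φ x₁ - deriv φ y₁| ≤ P * |x₁ - y₁|)
    (hc : ContinuousOn u (upB ∪ flatB)) (hu : HarmonicOn2 u upB)
    (hflat : ∀ x₁ ∈ Ioo (-1 : ℝ) 1, ∃ L : ℝ,
      Tendsto (fun t => (u (x₁, t) - u (x₁, 0)) / t) (𝓝[>] 0) (𝓝 L) ∧
      |L| ≤ θ ∧ (u (x₁, 0) ≠ φ x₁ → L = θ * Real.sign (u (x₁, 0) - φ x₁)))
    (hu_int : IntegrableOn (fun p => (u p) ^ 2 + gradSq2 u p) upB volume)
    (hA : (∫ p in upB, (u p) ^ 2) ≤ A ^ 2) :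
    (∃ 𝒰, OpenThinSolution θ P 𝒰 (fun z => u (z.re, z.im)) φ) ∧
      ∀ z ρ, 0 < ρ → Metric.ball z ρ ⊆ upperHalfDisc 0 1 → |u (z.re, z.im)| ≤ |A| / ρ := by
  constructor
  · obtain ⟨𝒰, h𝒰, hre⟩ := hu.harmonicOnNhd.exists_differentiableOn_re_eq
      (isOpen_upperHalfDisc 0 1) (convex_upperHalfDisc 0 1)
    refine ⟨𝒰, ?_, h𝒰, hre, ?_, fun x hx => (hφ x (abs_lt.1 hx)).1,
      fun x hx => (hφ x (abs_lt.1 hx)).2.2, fun x y hx hy => hφ' x (abs_lt.1 hx) y (abs_lt.1 hy)⟩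
    · refine hc.comp (f := fun z : ℂ => (z.re, z.im)) (by fun_prop) ?_
      rintro z ⟨hz1, hz2⟩
      rw [norm_lt_one_iff_sq_add_sq] at hz1
      rcases hz2.lt_or_eq with h | h
      · exact Or.inl ⟨hz1, h⟩
      · exact Or.inr ⟨hz1, h.symm⟩
    · intro x hx
      obtain ⟨L, hL, hLθ, hsign⟩ := hflat x (abs_lt.1 hx)
      refine ⟨L, ?_, hLθ, fun h => ?_, fun h => ?_⟩
      · simpa [HasFlatNormalDeriv] using hL
      · simp only [ofReal_re, ofReal_im] at h
        rw [hsign h.ne', Real.sign_of_pos (by linarith), mul_one]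
      · simp only [ofReal_re, ofReal_im] at h
        rw [hsign h.ne, Real.sign_of_neg (by linarith), mul_neg_one]
  · intro z ρ hρ hball
    refine InnerProductSpace.HarmonicOnNhd.abs_le_div (u := fun z : ℂ => u (z.re, z.im)) hρ
      (hu.harmonicOnNhd.mono hball) ?_
    exact (lintegral_mono_set hball).trans
      (lintegral_upperHalfDisc_le (hc.mono subset_union_left) hu_int hA)

end

/-- **optimal `C^{1,1/2}` regularity, `d = 1`, `f ≡ θ`.** For every
solution `u` of the two-phase thin obstacle problem in `B₁ ⊂ ℝ²` with `C^{1,1}` obstacle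
`φ`, the trace `u(·,0)` is continuously differentiable on `(−1,1)`, and there is `C > 0`
depending only on `θ`, `‖u‖_{L²(B₁⁺)}` and `‖φ‖_{C^{1,1}}` with
`|u(·,0)| + |∂₁u(·,0)| ≤ C` on `[−1/2,1/2]` and `∂₁u(·,0)` being `C`-Hölder of exponent
`1/2` there. -/
theorem statement18 (θ A P : ℝ) (hθ : 0 < θ) :
    ∃ C > 0, ∀ (φ : ℝ → ℝ) (u : ℝ × ℝ → ℝ),
      (∀ x₁ ∈ Set.Ioo (-1:ℝ) 1, DifferentiableAt ℝ φ x₁ ∧ |φ x₁| ≤ P ∧ |deriv φ x₁| ≤ P) →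
      (∀ x₁ ∈ Set.Ioo (-1:ℝ) 1, ∀ y₁ ∈ Set.Ioo (-1:ℝ) 1,
        |deriv φ x₁ - deriv φ y₁| ≤ P * |x₁ - y₁|) →
      ContinuousOn u (upB ∪ flatB) →
      HarmonicOn2 u upB →
      (∀ x₁ ∈ Set.Ioo (-1:ℝ) 1, ∃ L : ℝ,
        Filter.Tendsto (fun t => (u (x₁, t) - u (x₁, 0)) / t)
          (nhdsWithin 0 (Set.Ioi 0)) (nhds L) ∧
        |L| ≤ θ ∧ (u (x₁, 0) ≠ φ x₁ → L = θ * Real.sign (u (x₁, 0) - φ x₁))) →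
      IntegrableOn (fun p => (u p)^2 + gradSq2 u p) upB volume →
      (∫ p in upB, (u p)^2) ≤ A^2 →
      ((∀ x₁ ∈ Set.Ioo (-1:ℝ) 1, DifferentiableAt ℝ (fun t => u (t, 0)) x₁) ∧
       ContinuousOn (deriv (fun t => u (t, 0))) (Set.Ioo (-1:ℝ) 1) ∧
       (∀ x₁ ∈ Set.Icc (-(1:ℝ)/2) (1/2),
          |u (x₁, 0)| + |deriv (fun t => u (t, 0)) x₁| ≤ C) ∧
       (∀ x₁ ∈ Set.Icc (-(1:ℝ)/2) (1/2), ∀ y₁ ∈ Set.Icc (-(1:ℝ)/2) (1/2),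
          |deriv (fun t => u (t, 0)) x₁ - deriv (fun t => u (t, 0)) y₁|
            ≤ C * |x₁ - y₁| ^ ((1:ℝ)/2))) := by
  obtain ⟨C, hC, hreg⟩ := OpenThinSolution.exists_regularity (P := P) (N := |A| + 1) hθ
    (by positivity)
  refine ⟨C, hC, fun φ u hφ hφ' hc hu hflat hu_int hA => ?_⟩
  obtain ⟨⟨𝒰, h𝒰⟩, hball⟩ := exists_openThinSolution hφ hφ' hc hu hflat hu_int hA
  obtain ⟨h1, h2⟩ := hreg _ _ _ h𝒰 fun z ρ hρ hz => (hball z ρ hρ hz).trans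
    (div_le_div_of_nonneg_right (by linarith) hρ.le)
  have habs : ∀ x ∈ Icc (-(1 : ℝ) / 2) (1 / 2), |x| ≤ 1 / 2 := fun x hx =>
    abs_le.2 ⟨by linarith [hx.1], hx.2⟩
  refine ⟨fun x hx => ?_, fun x hx => ?_, fun x hx => ?_, fun x hx y hy => ?_⟩
  · exact (h𝒰.trace_contDiff hθ (abs_lt.2 hx)).1
  · exact (h𝒰.trace_contDiff hθ (abs_lt.2 hx)).2.continuousWithinAt
  · exact h1 x (habs x hx)
  · exact h2 x y (habs x hx) (habs y hy)
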